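/- arXiv:1306.5469 — 2 statements merged into one kernel-verified Lean document; each statement's English description precedes it below -/
import Mathlib

section
/- Let 𝒥 ⊆ ℝ² be a self-similar set, 𝒥 = ⋃_{i=1}^s T_i(𝒥) with T_i(x) = λ_i x + z_i (each 𝒪_i the identity, so the maps are homotheties), satisfying the Strong Separation Condition (the sets T_i(𝒥) are pairwise disjoint), and assume 𝒥 is not contained in a line. Then for every a ∈ ℝ² ∖ 𝒥, the Hausdorff dimension of the radial projection satisfies dim_H(P_a(𝒥)) = min{1, dim_H 𝒥}. -/
open MeasureTheory Metric Set

/-- The radial projection from the vantage point `a`: `P_a(x) = (x - a)/|x - a|`. -/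
noncomputable def radialProj (a x : ℂ) : ℂ := ‖x - a‖⁻¹ • (x - a)


/-! basic -/
noncomputable def cdet (u v : ℂ) : ℝ := u.re * v.im - u.im * v.re

lemma cdet_sub (u v w : ℂ) : cdet u (v - w) = cdet u v - cdet u w := by
  simp [cdet]; ring
lemma cdet_add (u v w : ℂ) : cdet u (v + w) = cdet u v + cdet u w := by
  simp [cdet]; ring
lemma cdet_sub_left (u v w : ℂ) : cdet (u - v) w = cdet u w - cdet v w := by
  simp [cdet]; ring
lemma cdet_smul (u v : ℂ) (r : ℝ) : cdet u (r • v) = r * cdet u v := by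
  simp [cdet]; ring
lemma cdet_smul_left (u v : ℂ) (r : ℝ) : cdet (r • u) v = r * cdet u v := by
  simp [cdet]; ring
lemma cdet_self (u : ℂ) : cdet u u = 0 := by
  simp [cdet]; ring
lemma cdet_swap (u v : ℂ) : cdet u v = - cdet v u := by
  simp [cdet]; ring
lemma cdet_sum {α : Type*} (u : ℂ) (s : Finset α) (f : α → ℂ) :
    cdet u (∑ i ∈ s, f i) = ∑ i ∈ s, cdet u (f i) := by
  classical
  induction s using Finset.induction_on with
  | empty => simp [cdet]
  | insert a s ha ih => rw [Finset.sum_insert ha, Finset.sum_insert ha, cdet_add, ih]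

lemma abs_cdet_le (u v : ℂ) : |cdet u v| ≤ ‖u‖ * ‖v‖ := by
  apply abs_le_of_sq_le_sq _ (by positivity)
  rw [mul_pow, Complex.sq_norm, Complex.sq_norm, Complex.normSq_apply, Complex.normSq_apply, cdet]
  nlinarith [sq_nonneg (u.re * v.re + u.im * v.im)]

lemma plucker (a b c : ℂ) : cdet a b • c = cdet c b • a - cdet c a • b := by
  apply Complex.ext <;> simp [cdet] <;> ring

lemma plucker_norm (a b c : ℂ) (ha : ‖a‖ = 1) (hb : ‖b‖ = 1) :
    |cdet a b| * ‖c‖ ≤ |cdet a c| + |cdet b c| := by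
  have h := plucker a b c
  have : ‖cdet a b • c‖ ≤ |cdet c b| + |cdet c a| := by
    rw [h]
    refine (norm_sub_le _ _).trans ?_
    rw [norm_smul, norm_smul, ha, hb]; simp
  rw [norm_smul, Real.norm_eq_abs] at this
  rw [cdet_swap a c, cdet_swap b c, abs_neg, abs_neg]; linarith

/-- tree of directions -/
def DTree (E : Set ℂ) (ρ σ : ℝ) : Prop :=
  ∃ (B n : ℕ) (c : ℝ) (g : (ℕ → Fin B) → ℂ), 0 < B ∧ 0 < n ∧ 0 < c ∧ 1 ≤ (B : ℝ) * (ρ ^ n) ^ σ ∧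
    (∀ w, g w ∈ E ∧ ‖g w‖ = 1) ∧
    ∀ (w w' : ℕ → Fin B) (j : ℕ), (∀ i < j, w i = w' i) → w j ≠ w' j →
      c * (ρ ^ n) ^ j ≤ |cdet (g w) (g w')|

lemma dimH_of_tree (E : Set ℂ) (ρ σ : ℝ) (hρ : 0 < ρ) (hρ1 : ρ < 1) (hσ : 0 < σ)
    (h : DTree E ρ σ) : ENNReal.ofReal σ ≤ dimH E := by
  classical
  obtain ⟨B, n, c, g, hB, hn, hc, hBr, hg, hsep⟩ := h
  set r := ρ ^ n with hr
  have hr0 : 0 < r := by positivity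
  have hr1 : r < 1 := pow_lt_one₀ hρ.le hρ1 hn.ne'
  have hrs : r ^ σ < 1 := Real.rpow_lt_one hr0.le hr1 hσ
  have hrs0 : 0 < r ^ σ := by positivity
  have hB1 : 1 < B := by
    by_contra hcon
    have : B = 1 := by omega
    subst this; simp at hBr; linarith
  have hsepn : ∀ (w w' : ℕ → Fin B) (j : ℕ), (∀ i < j, w i = w' i) → w j ≠ w' j →
      c * r ^ j ≤ ‖g w - g w'‖ := by
    intro w w' j h1 h2
    refine (hsep w w' j h1 h2).trans ?_
    have : cdet (g w) (g w') = cdet (g w - g w') (g w') := by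
      rw [cdet_sub_left, cdet_self, sub_zero]
    rw [this]
    refine (abs_cdet_le _ _).trans ?_
    rw [(hg w').2, mul_one]
  have hinj : Function.Injective g := by
    intro w w' h
    by_contra hne
    have hex : ∃ j, w j ≠ w' j := Function.ne_iff.mp hne
    have := hsepn w w' (Nat.find hex) (fun i hi => not_not.mp (Nat.find_min hex hi)) (Nat.find_spec hex)
    rw [h, sub_self, norm_zero] at this
    have : 0 < c * r ^ (Nat.find hex) := by positivity
    linarith
  have : Nonempty (ℕ → Fin B) := ⟨fun _ => ⟨0, hB⟩⟩
  let f : ℂ → ℝ := fun x => Real.ofDigits (Function.invFun g x)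
  have hfg : ∀ w, f (g w) = Real.ofDigits w := fun w => by
    simp only [f]; rw [Function.leftInverse_invFun hinj w]
  have hBinv : ((B : ℝ))⁻¹ ≤ r ^ σ := by
    rw [inv_le_iff_one_le_mul₀ (by positivity)]; linarith
  have hhol : HolderOnWith (Real.toNNReal ((c⁻¹) ^ σ)) (Real.toNNReal σ) f (range g) := by
    rintro _ ⟨w, rfl⟩ _ ⟨w', rfl⟩
    rw [hfg, hfg]
    by_cases hne : w = w'
    · subst hne; simp
    have hex : ∃ j, w j ≠ w' j := Function.ne_iff.mp hne
    set j := Nat.find hex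
    have hj : ∀ i < j, w i = w' i := fun i hi => not_not.mp (Nat.find_min hex hi)
    have h1 := hsepn w w' j hj (Nat.find_spec hex)
    have h2 := Real.abs_ofDigits_sub_ofDigits_le (n := j) hj
    rw [edist_dist, edist_dist, Real.dist_eq, dist_eq_norm]
    rw [Real.coe_toNNReal _ hσ.le, ENNReal.ofReal_rpow_of_nonneg (norm_nonneg _) hσ.le]
    change _ ≤ ENNReal.ofReal _ * _
    rw [← ENNReal.ofReal_mul (by positivity)]
    apply ENNReal.ofReal_le_ofReal
    refine h2.trans ?_
    rw [← Real.mul_rpow (by positivity) (norm_nonneg _)]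
    calc ((B : ℝ) ^ j)⁻¹ = ((B : ℝ)⁻¹) ^ j := by rw [inv_pow]
      _ ≤ (r ^ σ) ^ j := by gcongr
      _ = (r ^ j) ^ σ := by
        rw [← Real.rpow_natCast, ← Real.rpow_mul hr0.le, ← Real.rpow_natCast, ← Real.rpow_mul hr0.le, mul_comm]
      _ ≤ _ := by
        apply Real.rpow_le_rpow (by positivity) _ hσ.le
        rw [inv_mul_eq_div, le_div_iff₀ hc]; linarith
  have hd := hhol.dimH_image_le (by simpa using hσ)
  have himg : Ico (0:ℝ) 1 ⊆ f '' range g := by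
    intro x hx
    have : NeZero B := ⟨hB.ne'⟩
    exact ⟨g (Real.digits x B), ⟨_, rfl⟩, by rw [hfg]; exact Real.ofDigits_digits hB1 hx⟩
  have h1 : (1 : ENNReal) ≤ dimH (f '' range g) := by
    refine le_trans ?_ (dimH_mono himg)
    rw [Real.dimH_of_nonempty_interior]
    · simp
    · rw [interior_Ico]; exact ⟨1/2, by norm_num, by norm_num⟩
  have h2 : dimH (range g) ≤ dimH E := dimH_mono (by rintro _ ⟨w, rfl⟩; exact (hg w).1)
  have h3 := (h1.trans hd)
  rw [ENNReal.le_div_iff_mul_le (by left; simpa using hσ) (by left; simp), one_mul] at h3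
  exact h3.trans h2

/-- energy lower bound from separated sets -/
lemma pairs_lower {X : Type*} [Fintype X] (f : X → ℝ) (δ N : ℝ) (hδ : 0 < δ)
    (hN : ∀ W : Finset X, (∀ x ∈ W, ∀ y ∈ W, x ≠ y → δ ≤ |f x - f y|) → (W.card : ℝ) ≤ N) :
    (Fintype.card X : ℝ) ^ 2 ≤ N * ((Finset.univ.filter (fun p : X × X => |f p.1 - f p.2| ≤ 2 * δ)).card : ℝ) := by
  classical
  obtain ⟨P, hPdef⟩ : ∃ P : Finset X → Prop, P = fun W => ∀ x ∈ W, ∀ y ∈ W, x ≠ y → δ ≤ |f x - f y| := ⟨_, rfl⟩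
  obtain ⟨W, hW, hmax⟩ := Finset.exists_max_image (Finset.univ.filter P) Finset.card
    ⟨∅, by simp [hPdef]⟩
  have hWP0 : P W := (Finset.mem_filter.mp hW).2
  have hWP : ∀ x ∈ W, ∀ y ∈ W, x ≠ y → δ ≤ |f x - f y| := by rw [hPdef] at hWP0; exact hWP0
  have hclose : ∀ x, ∃ y ∈ W, |f x - f y| ≤ δ := by
    intro x
    by_contra hcon
    push Not at hcon
    by_cases hx : x ∈ W
    · have := hcon x hx
      simp at this
      linarith
    · have hP' : P (insert x W) := by
        rw [hPdef]
        intro y hy z hz hyz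
        rw [Finset.mem_insert] at hy hz
        rcases hy with rfl | hy <;> rcases hz with rfl | hz
        · exact absurd rfl hyz
        · exact (hcon z hz).le
        · rw [abs_sub_comm]; exact (hcon y hy).le
        · exact hWP y hy z hz hyz
      have := hmax (insert x W) (by simp [hP'])
      rw [Finset.card_insert_of_notMem hx] at this
      omega
  choose φ hφW hφ using hclose
  have h1 : (Fintype.card X : ℝ) = ∑ y ∈ W, ((Finset.univ.filter (fun x => φ x = y)).card : ℝ) := by
    have := Finset.card_eq_sum_card_fiberwise (s := (Finset.univ : Finset X)) (t := W) (f := φ)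
      (fun x _ => hφW x)
    rw [Finset.card_univ] at this
    exact_mod_cast this
  have h2 := sq_sum_le_card_mul_sum_sq (s := W) (f := fun y => ((Finset.univ.filter (fun x => φ x = y)).card : ℝ))
  rw [← h1] at h2
  have h3 : ∑ y ∈ W, ((Finset.univ.filter (fun x => φ x = y)).card : ℝ) ^ 2 ≤
      ((Finset.univ.filter (fun p : X × X => |f p.1 - f p.2| ≤ 2 * δ)).card : ℝ) := by
    have : ∑ y ∈ W, ((Finset.univ.filter (fun x => φ x = y)).card) ^ 2 ≤
      ((Finset.univ.filter (fun p : X × X => |f p.1 - f p.2| ≤ 2 * δ)).card) := by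
      have e : ∀ y ∈ W, ((Finset.univ.filter (fun x => φ x = y)).card) ^ 2 =
          ((Finset.univ.filter (fun x => φ x = y)) ×ˢ (Finset.univ.filter (fun x => φ x = y))).card := by
        intro y _; rw [Finset.card_product, sq]
      rw [Finset.sum_congr rfl e, ← Finset.card_biUnion]
      · apply Finset.card_le_card
        intro p hp
        simp only [Finset.mem_biUnion, Finset.mem_product, Finset.mem_filter, Finset.mem_univ, true_and] at hp ⊢
        obtain ⟨y, _, hy1, hy2⟩ := hp
        have a1 := hφ p.1
        have a2 := hφ p.2
        rw [hy1] at a1; rw [hy2] at a2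
        rw [abs_le] at a1 a2 ⊢
        constructor <;> linarith
      · intro y _ y' _ hne
        rw [Function.onFun, Finset.disjoint_left]
        intro p hp hp'
        simp only [Finset.mem_product, Finset.mem_filter, Finset.mem_univ, true_and] at hp hp'
        exact hne (hp.1.symm.trans hp'.1)
    exact_mod_cast this
  have hWN := hN W hWP
  exact h2.trans (mul_le_mul hWN h3 (Finset.sum_nonneg fun _ _ => sq_nonneg _) (le_trans (Nat.cast_nonneg _) hWN))

lemma prefix_card {κ : Type*} [Fintype κ] (L k : ℕ) (hk : k ≤ L) (v : Fin L → κ)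
    (S : Finset (Fin L → κ)) (hS : ∀ w ∈ S, ∀ i : Fin L, (i : ℕ) < k → w i = v i) :
    (Fintype.card κ) ^ k * S.card ≤ (Fintype.card κ) ^ L := by
  classical
  have : Fintype.card ((Fin k → κ) × S) ≤ Fintype.card (Fin L → κ) := by
    apply Fintype.card_le_of_injective
      (fun p => fun i : Fin L => if h : (i : ℕ) < k then p.1 ⟨i, h⟩ else p.2.1 i)
    rintro ⟨p, w, hw⟩ ⟨p', w', hw'⟩ heq
    have hp : p = p' := by
      funext i
      have := congrFun heq ⟨i, i.2.trans_le hk⟩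
      simpa using this
    have hww : w = w' := by
      funext i
      by_cases hi : (i : ℕ) < k
      · rw [hS w hw i hi, hS w' hw' i hi]
      · have := congrFun heq i
        simpa [hi] using this
    subst hp hww; rfl
  simpa using this

lemma frostman (E : Set ℂ) (ρ σ : ℝ) (hρ : 0 < ρ) (hρ1 : ρ < 1) (hσ : 0 < σ)
    (h : DTree E ρ σ) : ∃ C > 0, ∀ r0 > 0, ∃ (B N : ℕ) (θ : (Fin N → Fin B) → ℂ), 0 < B ∧
      (∀ ω, θ ω ∈ E ∧ ‖θ ω‖ = 1) ∧
      ∀ r ≥ r0, ∀ S : Finset (Fin N → Fin B), (∀ ω ∈ S, ∀ ω' ∈ S, |cdet (θ ω) (θ ω')| ≤ r) →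
        (S.card : ℝ) ≤ C * (Fintype.card (Fin N → Fin B) : ℝ) * r ^ σ := by
  classical
  obtain ⟨B, n, c, g, hB, hn, hc, hBr, hg, hsep⟩ := h
  set R := ρ ^ n with hr
  have hR0 : 0 < R := by positivity
  have hR1 : R < 1 := pow_lt_one₀ hρ.le hρ1 hn.ne'
  refine ⟨(c⁻¹) ^ σ, by positivity, fun r0 hr0 => ?_⟩
  obtain ⟨N, hN⟩ := exists_pow_lt_of_lt_one (div_pos hr0 hc) hR1
  rw [lt_div_iff₀ hc] at hN
  refine ⟨B, N, fun ω => g (fun i => if h : i < N then ω ⟨i, h⟩ else ⟨0, hB⟩), hB, fun ω => hg _, ?_⟩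
  intro r hr S hS
  have hex : ∃ k, c * R ^ k ≤ r := ⟨N, by linarith⟩
  set k := Nat.find hex with hk
  have hkN : k ≤ N := Nat.find_min' hex (by linarith)
  have hkr : c * R ^ k ≤ r := Nat.find_spec hex
  have hkm : ∀ j < k, r < c * R ^ j := fun j hj => not_le.mp (Nat.find_min hex hj)
  rcases S.eq_empty_or_nonempty with rfl | ⟨v, hv⟩
  · simp; have : 0 < r := by linarith
    positivity
  have hpre : ∀ w ∈ S, ∀ i : Fin N, (i : ℕ) < k → w i = v i := by
    intro w hw
    by_contra hcon
    push Not at hcon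
    obtain ⟨i, hik, hne⟩ := hcon
    have hex2 : ∃ j, (fun i => if h : i < N then w ⟨i, h⟩ else (⟨0, hB⟩ : Fin B)) j ≠
        (fun i => if h : i < N then v ⟨i, h⟩ else (⟨0, hB⟩ : Fin B)) j := ⟨i, by simpa using hne⟩
    have h1 := hsep _ _ (Nat.find hex2) (fun i hi => not_not.mp (Nat.find_min hex2 hi)) (Nat.find_spec hex2)
    have h2 : Nat.find hex2 ≤ i := Nat.find_min' hex2 (by simpa using hne)
    have h3 := hkm (Nat.find hex2) (by omega)
    have h4 := hS w hw v hv
    linarith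
  have h5 := prefix_card N k hkN v S hpre
  have h6 : (B : ℝ) ^ k * S.card ≤ (B : ℝ) ^ N := by
    simp only [Fintype.card_fin] at h5
    exact_mod_cast h5
  have hr0' : 0 < r := by linarith
  have h7 : 1 ≤ (B : ℝ) ^ k * (c⁻¹ ^ σ * r ^ σ) := by
    calc (1:ℝ) ≤ ((B : ℝ) * R ^ σ) ^ k := one_le_pow₀ hBr
      _ = (B : ℝ) ^ k * (R ^ k) ^ σ := by
        rw [mul_pow, ← Real.rpow_natCast (R ^ σ), ← Real.rpow_mul hR0.le, ← Real.rpow_natCast R, ← Real.rpow_mul hR0.le, mul_comm σ]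
      _ ≤ _ := by
        rw [← Real.mul_rpow (by positivity) hr0'.le]
        gcongr
        rw [inv_mul_eq_div, le_div_iff₀ hc]; linarith
  have h8 : (Fintype.card (Fin N → Fin B) : ℝ) = (B:ℝ) ^ N := by simp
  rw [h8]
  calc (S.card : ℝ) ≤ S.card * ((B : ℝ) ^ k * (c⁻¹ ^ σ * r ^ σ)) := le_mul_of_one_le_right (by positivity) h7
    _ = ((B : ℝ) ^ k * S.card) * (c⁻¹ ^ σ * r ^ σ) := by ring
    _ ≤ (B:ℝ) ^ N * (c⁻¹ ^ σ * r ^ σ) := by gcongr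
    _ = _ := by ring


noncomputable def hker (y : ℝ) : ℝ := ∫ ξ in (0:ℝ)..1, (1 - ξ) * Real.cos (ξ * y)

lemma hker_closed (y : ℝ) (hy : y ≠ 0) : hker y = (1 - Real.cos y) / y ^ 2 := by
  have hd : ∀ ξ ∈ uIcc (0:ℝ) 1, HasDerivAt (fun ξ => (1 - ξ) * Real.sin (ξ * y) / y - Real.cos (ξ * y) / y ^ 2)
      ((1 - ξ) * Real.cos (ξ * y)) ξ := by
    intro ξ _
    have h1 : HasDerivAt (fun ξ : ℝ => ξ * y) y ξ := by simpa using (hasDerivAt_id ξ).mul_const y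
    have h2 := ((((hasDerivAt_id ξ).const_sub 1).mul h1.sin).div_const y).sub (h1.cos.div_const (y ^ 2))
    convert! h2 using 1
    simp only [id]
    field_simp
    ring
  rw [hker, intervalIntegral.integral_eq_sub_of_hasDerivAt hd]
  · simp; field_simp; ring
  · apply Continuous.intervalIntegrable; fun_prop

lemma hker_zero : hker 0 = 1 / 2 := by
  simp only [hker, mul_zero, Real.cos_zero, mul_one]
  rw [intervalIntegral.integral_sub (by simp) (by simp)]; simp; norm_num

lemma hker_nonneg (y : ℝ) : 0 ≤ hker y := by
  by_cases hy : y = 0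
  · subst hy; rw [hker_zero]; norm_num
  · rw [hker_closed y hy]; have := Real.cos_le_one y; apply div_nonneg <;> nlinarith [sq_nonneg y]

lemma hker_le_one (y : ℝ) : hker y ≤ 1 := by
  by_cases hy : y = 0
  · subst hy; rw [hker_zero]; norm_num
  · rw [hker_closed y hy, div_le_one (by positivity)]
    have := Real.one_sub_sq_div_two_le_cos (x := y); nlinarith [sq_nonneg y]

lemma hker_le (y : ℝ) (hy : y ≠ 0) : hker y ≤ 2 / y ^ 2 := by
  rw [hker_closed y hy]; have := Real.neg_one_le_cos y
  gcongr; linarith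

lemma hker_ge (y : ℝ) (hy : |y| ≤ 1) : 1 / 8 ≤ hker y := by
  by_cases hy0 : y = 0
  · subst hy0; rw [hker_zero]; norm_num
  · rw [hker_closed y hy0, le_div_iff₀ (by positivity)]
    have h1 := Real.cos_le_one_sub_mul_cos_sq (x := y) (by linarith [Real.pi_gt_three])
    have h2 : 1 / 8 ≤ 2 / Real.pi ^ 2 := by
      rw [div_le_div_iff₀ (by norm_num) (by positivity)]
      nlinarith [Real.pi_le_four, Real.pi_pos]
    nlinarith [sq_nonneg y]

lemma hker_dyadic (y : ℝ) : ∃ j : ℕ, |y| ≤ 2 ^ j ∧ hker y ≤ 8 * (1 / 4) ^ j := by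
  have hex : ∃ j : ℕ, |y| ≤ 2 ^ j := by
    obtain ⟨j, hj⟩ := pow_unbounded_of_one_lt |y| (by norm_num : (1:ℝ) < 2)
    exact ⟨j, hj.le⟩
  refine ⟨Nat.find hex, Nat.find_spec hex, ?_⟩
  rcases hj : Nat.find hex with _ | j
  · have := hker_le_one y; norm_num; linarith
  · have h1 := Nat.find_min hex (m := j) (by omega)
    rw [not_le] at h1
    have hy : y ≠ 0 := by
      rintro rfl; rw [abs_zero] at h1
      have : (0:ℝ) < 2 ^ j := by positivity
      linarith
    refine (hker_le y hy).trans ?_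
    have h2 : (4:ℝ) ^ j ≤ y ^ 2 := by
      rw [← sq_abs]
      calc (4:ℝ) ^ j = (2 ^ j) ^ 2 := by rw [← pow_mul, mul_comm, pow_mul]; norm_num
        _ ≤ _ := by gcongr
    have h5 : ((1:ℝ) / 4) ^ (j + 1) = ((4:ℝ) ^ j)⁻¹ / 4 := by rw [pow_succ, one_div, inv_pow]; ring
    have h6 : 0 < y ^ 2 := by positivity
    rw [h5, div_le_iff₀ h6]
    have h4 : (0:ℝ) < 4 ^ j := by positivity
    have : ((4:ℝ) ^ j)⁻¹ * y ^ 2 ≥ 1 := by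
      rw [ge_iff_le, inv_mul_eq_div, le_div_iff₀ h4]; linarith
    linarith

lemma hker_sum {X : Type*} [Fintype X] (f : X → ℝ) (τ : ℝ) :
    ∑ x, ∑ x', hker (τ * (f x - f x')) =
      ∫ ξ in (0:ℝ)..1, (1 - ξ) * ‖∑ x, Complex.exp (((ξ * τ * f x : ℝ) : ℂ) * Complex.I)‖ ^ 2 := by
  have key : ∀ ξ : ℝ, ‖∑ x, Complex.exp (((ξ * τ * f x : ℝ) : ℂ) * Complex.I)‖ ^ 2
      = ∑ x, ∑ x', Real.cos (ξ * (τ * (f x - f x'))) := by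
    intro ξ
    rw [Complex.sq_norm, Complex.normSq_apply, Complex.re_sum, Complex.im_sum]
    simp only [Complex.exp_ofReal_mul_I_re, Complex.exp_ofReal_mul_I_im]
    rw [Finset.sum_mul_sum, Finset.sum_mul_sum, ← Finset.sum_add_distrib]
    refine Finset.sum_congr rfl fun x _ => ?_
    rw [← Finset.sum_add_distrib]
    refine Finset.sum_congr rfl fun x' _ => ?_
    rw [← Real.cos_sub]; congr 1; ring
  simp_rw [key, Finset.mul_sum]
  rw [intervalIntegral.integral_finsetSum]
  · refine Finset.sum_congr rfl fun x _ => ?_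
    rw [intervalIntegral.integral_finsetSum]
    · rfl
    · intro i _; apply Continuous.intervalIntegrable; fun_prop
  · intro i _; apply Continuous.intervalIntegrable; fun_prop

/-- Kaufman type sum -/
lemma kaufman {Ω : Type*} [Fintype Ω] (θ : Ω → ℂ) (hθ : ∀ ω, ‖θ ω‖ = 1) (C σ r0 : ℝ) (hC : 0 < C)
    (hσ0 : 0 < σ) (hσ : σ ≤ 1)
    (hF : ∀ r ≥ r0, ∀ S : Finset Ω, (∀ ω ∈ S, ∀ ω' ∈ S, |cdet (θ ω) (θ ω')| ≤ r) →
        (S.card : ℝ) ≤ C * (Fintype.card Ω : ℝ) * r ^ σ)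
    (τ : ℝ) (hτ : 0 < τ) (z : ℂ) (hz : z ≠ 0) (hr : r0 * (τ * ‖z‖) ≤ 2) :
    ∑ ω, hker (τ * cdet (θ ω) z) ≤ 32 * C * Fintype.card Ω * (τ * ‖z‖) ^ (-σ) := by
  classical
  have hzn : 0 < ‖z‖ := norm_pos_iff.mpr hz
  have hq : 0 < τ * ‖z‖ := by positivity
  choose j hj1 hj2 using fun ω => hker_dyadic (τ * cdet (θ ω) z)
  obtain ⟨J, hJ⟩ : ∃ J, ∀ ω, j ω < J := by
    refine ⟨(Finset.univ.sup j) + 1, fun ω => ?_⟩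
    have := Finset.le_sup (f := j) (Finset.mem_univ ω)
    omega
  have hcount : ∀ i : ℕ, ((Finset.univ.filter (fun ω => j ω = i)).card : ℝ) ≤
      C * Fintype.card Ω * (2 * 2 ^ i / (τ * ‖z‖)) ^ σ := by
    intro i
    apply hF
    · rw [ge_iff_le, le_div_iff₀ hq]
      have : (1:ℝ) ≤ 2 ^ i := one_le_pow₀ (by norm_num)
      linarith
    · intro ω hω ω' hω'
      simp only [Finset.mem_filter, Finset.mem_univ, true_and] at hω hω'
      have h1 := hj1 ω
      have h2 := hj1 ω'
      rw [hω, abs_mul, abs_of_pos hτ] at h1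
      rw [hω', abs_mul, abs_of_pos hτ] at h2
      have h3 := plucker_norm (θ ω) (θ ω') z (hθ _) (hθ _)
      rw [le_div_iff₀ hq]
      nlinarith
  have hs : ∑ ω, hker (τ * cdet (θ ω) z) ≤ ∑ i ∈ Finset.range J, ∑ ω ∈ Finset.univ.filter (fun ω => j ω = i), (8 * (1 / 4 : ℝ) ^ i) := by
    rw [← Finset.sum_fiberwise_of_maps_to (s := Finset.univ) (t := Finset.range J) (g := j) (fun ω _ => Finset.mem_range.mpr (hJ ω))]
    refine Finset.sum_le_sum fun i _ => Finset.sum_le_sum fun ω hω => ?_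
    have := hj2 ω
    simp only [Finset.mem_filter, Finset.mem_univ, true_and] at hω
    rwa [hω] at this
  refine hs.trans ?_
  have hb : ∀ i ∈ Finset.range J, ∑ ω ∈ Finset.univ.filter (fun ω => j ω = i), (8 * (1 / 4 : ℝ) ^ i) ≤
      16 * C * Fintype.card Ω * (τ * ‖z‖) ^ (-σ) * (1 / 2) ^ i := by
    intro i _
    rw [Finset.sum_const, nsmul_eq_mul]
    have h1 := hcount i
    have h2 : (2 * 2 ^ i / (τ * ‖z‖)) ^ σ ≤ 2 * 2 ^ i * (τ * ‖z‖) ^ (-σ) := by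
      rw [Real.div_rpow (by positivity) hq.le, Real.rpow_neg hq.le, div_eq_mul_inv]
      gcongr
      have : (1:ℝ) ≤ 2 * 2 ^ i := by
        have : (1:ℝ) ≤ 2 ^ i := one_le_pow₀ (by norm_num)
        linarith
      calc _ ≤ ((2:ℝ) * 2 ^ i) ^ (1:ℝ) := Real.rpow_le_rpow_of_exponent_le this hσ
        _ = _ := Real.rpow_one _
    have h4 : (1/4:ℝ)^i * 2^i = (1/2)^i := by rw [← mul_pow]; norm_num
    calc _ ≤ (C * Fintype.card Ω * (2 * 2 ^ i * (τ * ‖z‖) ^ (-σ))) * (8 * (1 / 4 : ℝ) ^ i) := by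
            gcongr
            exact h1.trans (by gcongr)
      _ = 16 * C * Fintype.card Ω * (τ * ‖z‖) ^ (-σ) * ((1/4:ℝ)^i * 2^i) := by ring
      _ = _ := by rw [h4]
  refine (Finset.sum_le_sum hb).trans ?_
  rw [← Finset.mul_sum]
  have hg : ∑ i ∈ Finset.range J, (1 / 2 : ℝ) ^ i ≤ 2 := by
    have := geom_sum_eq (by norm_num : (1/2:ℝ) ≠ 1) J
    rw [this]
    have : (0:ℝ) < (1/2)^J := by positivity
    rw [div_le_iff_of_neg (by norm_num)]; linarith
  have : 0 ≤ 16 * C * Fintype.card Ω * (τ * ‖z‖) ^ (-σ) := by positivity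
  nlinarith


noncomputable def frset (Λ x y : ℝ) (n : ℕ) : Prop :=
  round (Λ ^ (n + 1) * x) ≠ round (Λ * (round (Λ ^ n * x) : ℝ)) ∨
  round (Λ ^ (n + 1) * y) ≠ round (Λ * (round (Λ ^ n * y) : ℝ))

open Classical in
noncomputable def frc (Λ x y : ℝ) (N : ℕ) : ℕ := ((Finset.range N).filter (frset Λ x y)).card

lemma frc_succ_of (Λ x y : ℝ) (N : ℕ) (h : frset Λ x y N) : frc Λ x y (N + 1) = frc Λ x y N + 1 := by
  classical
  rw [frc, frc, Finset.range_add_one, Finset.filter_insert, if_pos h, Finset.card_insert_of_notMem]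
  simp

lemma frc_succ_of_not (Λ x y : ℝ) (N : ℕ) (h : ¬ frset Λ x y N) : frc Λ x y (N + 1) = frc Λ x y N := by
  classical
  rw [frc, frc, Finset.range_add_one, Finset.filter_insert, if_neg h]

lemma round_step (Λ : ℝ) (hΛ : 0 < Λ) (x : ℝ) (I : ℤ) (hI : 1 + Λ / 2 ≤ I) :
    round (Λ * x) - round (Λ * (round x : ℝ)) ∈ Finset.Icc (-I) I := by
  have h1 := abs_le.mp (abs_sub_round (Λ * x))
  have h2 := abs_le.mp (abs_sub_round (Λ * (round x : ℝ)))
  have h3 := abs_le.mp (abs_sub_round x)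
  have h4 : Λ * (x - round x) ≤ Λ * (1 / 2) := by gcongr; exact h3.2
  have h5 : Λ * (-(1/2)) ≤ Λ * (x - round x) := by gcongr; exact h3.1
  rw [Finset.mem_Icc]
  constructor
  · have : (-(I:ℝ)) ≤ ((round (Λ * x) - round (Λ * (round x : ℝ)) : ℤ) : ℝ) := by push_cast; nlinarith
    exact_mod_cast this
  · have : ((round (Λ * x) - round (Λ * (round x : ℝ)) : ℤ) : ℝ) ≤ I := by push_cast; nlinarith
    exact_mod_cast this

lemma ek_count (Λ X0 : ℝ) (hΛ : 0 < Λ) : ∃ C > 0, ∃ B > 0, ∀ q : ℝ, 0 < q → q ≤ 1 → ∀ N m : ℕ,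
    ∃ Z : Finset (ℤ × ℤ), (Z.card : ℝ) ≤ C * (1 + B * q) ^ N * (q⁻¹) ^ m ∧
      ∀ x y : ℝ, |x| ≤ X0 → |y| ≤ X0 → frc Λ x y N ≤ m →
        (round (Λ ^ N * x), round (Λ ^ N * y)) ∈ Z := by
  classical
  obtain ⟨I, hI⟩ : ∃ I : ℤ, 1 + Λ / 2 ≤ I := ⟨_, Int.le_ceil _⟩
  obtain ⟨I0, hI0⟩ : ∃ I0 : ℤ, X0 + 1 ≤ I0 := ⟨_, Int.le_ceil _⟩
  let box := Finset.Icc (-I) I ×ˢ Finset.Icc (-I) I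
  let box0 := Finset.Icc (-I0) I0 ×ˢ Finset.Icc (-I0) I0
  refine ⟨box0.card + 1, by positivity, box.card + 1, by positivity, fun q hq hq1 N => ?_⟩
  have hq1' : 1 ≤ q⁻¹ := (one_le_inv₀ hq).mpr hq1
  induction N with
  | zero =>
    intro m
    refine ⟨box0, ?_, ?_⟩
    · have : (1:ℝ) ≤ (q⁻¹) ^ m := one_le_pow₀ hq1'
      simp only [pow_zero, mul_one]
      nlinarith [(Nat.cast_nonneg box0.card : (0:ℝ) ≤ _)]
    · intro x y hx hy _
      have key : ∀ x : ℝ, |x| ≤ X0 → round x ∈ Finset.Icc (-I0) I0 := by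
        intro x hx
        have h1 := abs_le.mp (abs_sub_round x)
        have h2 := abs_le.mp hx
        rw [Finset.mem_Icc]
        constructor
        · have : (-(I0:ℝ)) ≤ (round x : ℝ) := by linarith
          exact_mod_cast this
        · have : (round x : ℝ) ≤ I0 := by linarith
          exact_mod_cast this
      simp only [pow_zero, one_mul]
      exact Finset.mem_product.mpr ⟨key x hx, key y hy⟩
  | succ N ih =>
    intro m
    let F : ℤ × ℤ → ℤ × ℤ := fun p => (round (Λ * (p.1 : ℝ)), round (Λ * (p.2 : ℝ)))
    obtain ⟨Z, hZc, hZ⟩ := ih m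
    have hstep : ∀ x, round (Λ ^ (N + 1) * x) - round (Λ * (round (Λ ^ N * x) : ℝ)) ∈ Finset.Icc (-I) I := by
      intro x
      have := round_step Λ hΛ (Λ ^ N * x) I hI
      rwa [← mul_assoc, ← pow_succ'] at this
    rcases m with _ | m
    · refine ⟨Z.image F, ?_, ?_⟩
      · refine (Nat.cast_le.mpr Finset.card_image_le).trans (hZc.trans ?_)
        gcongr
        · have : (0:ℝ) < (box.card + 1) * q := by positivity
          linarith
        · omega
      · intro x y hx hy hf
        by_cases hfr : frset Λ x y N
        · rw [frc_succ_of _ _ _ _ hfr] at hf; omega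
        · rw [frc_succ_of_not _ _ _ _ hfr] at hf
          simp only [frset, not_or, not_not] at hfr
          exact Finset.mem_image.mpr ⟨_, hZ x y hx hy hf, by simp only [F]; rw [hfr.1, hfr.2]⟩
    · obtain ⟨Z', hZc', hZ'⟩ := ih m
      refine ⟨Z.image F ∪ (box ×ˢ Z').image (fun p => p.1 + F p.2), ?_, ?_⟩
      · have h1 : ((Z.image F ∪ (box ×ˢ Z').image (fun p => p.1 + F p.2)).card : ℝ) ≤ Z.card + box.card * Z'.card := by
          have a := Finset.card_union_le (Z.image F) ((box ×ˢ Z').image (fun p => p.1 + F p.2))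
          have b := Finset.card_image_le (s := Z) (f := F)
          have d := Finset.card_image_le (s := box ×ˢ Z') (f := (fun p => p.1 + F p.2))
          rw [Finset.card_product] at d
          have e := a.trans (Nat.add_le_add b d)
          exact_mod_cast e
        refine h1.trans ?_
        set T : ℝ := (box0.card + 1) * (1 + (box.card + 1) * q) ^ N with hT
        have hT0 : 0 < T := by positivity
        have e1 : T * q⁻¹ ^ m = T * q⁻¹ ^ (m+1) * q := by
          rw [pow_succ]; field_simp
        have hP : 0 < T * q⁻¹ ^ (m+1) := by positivity
        calc _ ≤ T * q⁻¹ ^ (m+1) + (box.card + 1) * (T * q⁻¹ ^ m) := by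
                gcongr
                linarith
          _ = T * q⁻¹ ^ (m+1) * (1 + (box.card + 1) * q) := by rw [e1]; ring
          _ = _ := by rw [hT]; ring
      · intro x y hx hy hf
        rw [Finset.mem_union]
        by_cases hfr : frset Λ x y N
        · right
          rw [frc_succ_of _ _ _ _ hfr] at hf
          refine Finset.mem_image.mpr ⟨((round (Λ ^ (N + 1) * x) - round (Λ * (round (Λ ^ N * x) : ℝ)),
            round (Λ ^ (N + 1) * y) - round (Λ * (round (Λ ^ N * y) : ℝ))), (round (Λ ^ N * x), round (Λ ^ N * y))), ?_, ?_⟩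
          · rw [Finset.mem_product]
            exact ⟨Finset.mem_product.mpr ⟨hstep x, hstep y⟩, hZ' x y hx hy (by omega)⟩
          · simp [F]
        · left
          rw [frc_succ_of_not _ _ _ _ hfr] at hf
          simp only [frset, not_or, not_not] at hfr
          exact Finset.mem_image.mpr ⟨_, hZ x y hx hy hf, by simp only [F]; rw [hfr.1, hfr.2]⟩

noncomputable def Gf (x y : ℝ) : ℝ :=
  ‖1 + Complex.exp ((2 * Real.pi * x : ℝ) * Complex.I) + Complex.exp ((2 * Real.pi * y : ℝ) * Complex.I)‖ / 3

lemma Gf_nonneg (x y : ℝ) : 0 ≤ Gf x y := by unfold Gf; positivity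

lemma norm_one_add_exp (x : ℝ) : ‖1 + Complex.exp ((2 * Real.pi * x : ℝ) * Complex.I)‖ ^ 2
    = 2 + 2 * Real.cos (2 * Real.pi * x) := by
  rw [Complex.sq_norm, Complex.normSq_apply]
  simp only [Complex.add_re, Complex.add_im, Complex.one_re, Complex.one_im, Complex.exp_ofReal_mul_I_re, Complex.exp_ofReal_mul_I_im]
  nlinarith [Real.sin_sq_add_cos_sq (2 * Real.pi * x)]

lemma Gf_le_one (x y : ℝ) : Gf x y ≤ 1 := by
  unfold Gf
  rw [div_le_one (by norm_num)]
  refine (norm_add₃_le).trans ?_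
  rw [Complex.norm_exp_ofReal_mul_I, Complex.norm_exp_ofReal_mul_I]; norm_num

lemma cos_round (x δ : ℝ) (hδ : 0 ≤ δ) (h : δ ≤ |x - round x|) :
    Real.cos (2 * Real.pi * x) ≤ Real.cos (2 * Real.pi * δ) := by
  have e : Real.cos (2 * Real.pi * x) = Real.cos (2 * Real.pi * |x - round x|) := by
    have : 2 * Real.pi * |x - round x| = |2 * Real.pi * x - round x * (2 * Real.pi)| := by
      rw [show 2 * Real.pi * x - round x * (2 * Real.pi) = 2 * Real.pi * (x - round x) by ring, abs_mul,
        abs_of_pos Real.two_pi_pos]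
    rw [this, Real.cos_abs, Real.cos_sub_int_mul_two_pi]
  rw [e]
  apply Real.cos_le_cos_of_nonneg_of_le_pi
  · have := Real.pi_pos; positivity
  · have := abs_sub_round x; nlinarith [Real.pi_pos]
  · have := Real.pi_pos; gcongr

lemma Gf_gap (δ : ℝ) (hδ : 0 < δ) (hδ' : δ < 1 / 2) : ∃ c0 : ℝ, 0 < c0 ∧ c0 < 1 ∧ ∀ x y : ℝ,
    (δ ≤ |x - round x| ∨ δ ≤ |y - round y|) → Gf x y ≤ 1 - c0 := by
  set C := Real.cos (2 * Real.pi * δ) with hC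
  have hC1 : C < 1 := by
    have := Real.cos_lt_cos_of_nonneg_of_le_pi (x := 0) (y := 2 * Real.pi * δ) le_rfl
      (by nlinarith [Real.pi_pos]) (by have := Real.pi_pos; positivity)
    simpa using this
  have hCm : -1 ≤ C := Real.neg_one_le_cos _
  set s := Real.sqrt (2 + 2 * C) with hs
  have hs2 : s < 2 := by
    rw [hs, Real.sqrt_lt' (by norm_num)]; linarith
  have hs0 : 0 ≤ s := Real.sqrt_nonneg _
  have key : ∀ x : ℝ, δ ≤ |x - round x| → ‖1 + Complex.exp ((2 * Real.pi * x : ℝ) * Complex.I)‖ ≤ s := by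
    intro x hx
    apply Real.le_sqrt_of_sq_le
    rw [norm_one_add_exp]
    have := cos_round x δ hδ.le hx
    linarith
  refine ⟨(2 - s) / 3, by linarith, by linarith, ?_⟩
  intro x y hxy
  unfold Gf
  rw [div_le_iff₀ (by norm_num)]
  rcases hxy with h | h
  · refine (norm_add_le _ _).trans ?_
    rw [Complex.norm_exp_ofReal_mul_I]
    have := key x h; linarith
  · rw [add_right_comm]
    refine (norm_add_le _ _).trans ?_
    rw [Complex.norm_exp_ofReal_mul_I]
    have := key y h; linarith

lemma fr_large (Λ : ℝ) (hΛ : 0 < Λ) (x : ℝ)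
    (h : round (Λ * x) ≠ round (Λ * (round x : ℝ))) :
    1 / (2 * (1 + Λ)) ≤ |x - round x| ∨ 1 / (2 * (1 + Λ)) ≤ |Λ * x - round (Λ * x)| := by
  by_contra hcon
  push Not at hcon
  apply h
  obtain ⟨h1, h2⟩ := hcon
  symm
  rw [round_eq_iff]
  have e1 : 1 / (2 * (1 + Λ)) * (1 + Λ) = 1 / 2 := by field_simp
  obtain ⟨a1, a2⟩ := abs_lt.mp h1
  obtain ⟨b1, b2⟩ := abs_lt.mp h2
  have m1 := mul_lt_mul_of_pos_left a1 hΛ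
  have m2 := mul_lt_mul_of_pos_left a2 hΛ
  generalize 1 / (2 * (1 + Λ)) = q at *
  constructor <;> nlinarith

lemma prod_bound (Λ : ℝ) (hΛ : 0 < Λ) : ∃ c0 : ℝ, 0 < c0 ∧ c0 < 1 ∧ ∀ (x y : ℝ) (N : ℕ),
    ∏ n ∈ Finset.range (N + 1), Gf (Λ ^ n * x) (Λ ^ n * y) ^ 2 ≤ (1 - c0) ^ (frc Λ x y N) := by
  obtain ⟨c0, h0, h1, hgap⟩ := Gf_gap (1 / (2 * (1 + Λ))) (by positivity) (by
    rw [div_lt_div_iff₀ (by positivity) (by norm_num)]; linarith)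
  refine ⟨c0, h0, h1, fun x y N => ?_⟩
  have main : ∀ N, (∏ n ∈ Finset.range N, Gf (Λ ^ n * x) (Λ ^ n * y) ^ 2) * Gf (Λ ^ N * x) (Λ ^ N * y)
      ≤ (1 - c0) ^ (frc Λ x y N) := by
    intro N
    induction N with
    | zero => simp [frc]; exact Gf_le_one _ _
    | succ N ih =>
      rw [Finset.prod_range_succ]
      set P := ∏ n ∈ Finset.range N, Gf (Λ ^ n * x) (Λ ^ n * y) ^ 2
      set g := Gf (Λ ^ N * x) (Λ ^ N * y) with hg
      set g' := Gf (Λ ^ (N+1) * x) (Λ ^ (N+1) * y) with hg'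
      have hg0 : 0 ≤ g := Gf_nonneg _ _
      have hg0' : 0 ≤ g' := Gf_nonneg _ _
      have hg1 : g ≤ 1 := Gf_le_one _ _
      have hg1' : g' ≤ 1 := Gf_le_one _ _
      have e : P * g ^ 2 * g' = (P * g) * (g * g') := by ring
      rw [e]
      by_cases hfr : frset Λ x y N
      · rw [frc_succ_of _ _ _ _ hfr, pow_succ]
        have hgg : g * g' ≤ 1 - c0 := by
          have aux : ∀ x : ℝ, round (Λ ^ (N + 1) * x) ≠ round (Λ * (round (Λ ^ N * x) : ℝ)) →
            1 / (2 * (1 + Λ)) ≤ |Λ ^ N * x - round (Λ ^ N * x)| ∨ 1 / (2 * (1 + Λ)) ≤ |Λ ^ (N+1) * x - round (Λ ^ (N+1) * x)| := by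
            intro x hx
            have e : Λ ^ (N + 1) * x = Λ * (Λ ^ N * x) := by ring
            rw [e] at hx ⊢
            exact fr_large Λ hΛ _ hx
          have : g ≤ 1 - c0 ∨ g' ≤ 1 - c0 := by
            rcases hfr with h | h <;> rcases aux _ h with h' | h'
            · left; exact hgap _ _ (Or.inl h')
            · right; exact hgap _ _ (Or.inl h')
            · left; exact hgap _ _ (Or.inr h')
            · right; exact hgap _ _ (Or.inr h')
          rcases this with h | h <;> nlinarith
        have : 0 ≤ (1 - c0) ^ frc Λ x y N := pow_nonneg (by linarith) _
        exact mul_le_mul ih hgg (by positivity) this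
      · rw [frc_succ_of_not _ _ _ _ hfr]
        have hP : 0 ≤ P * g := by
          apply mul_nonneg _ hg0
          exact Finset.prod_nonneg fun _ _ => sq_nonneg _
        have : g * g' ≤ 1 := by nlinarith
        nlinarith
  rw [Finset.prod_range_succ]
  refine le_trans ?_ (main N)
  have hP : 0 ≤ ∏ n ∈ Finset.range N, Gf (Λ ^ n * x) (Λ ^ n * y) ^ 2 := Finset.prod_nonneg fun _ _ => sq_nonneg _
  have := Gf_nonneg (Λ ^ N * x) (Λ ^ N * y)
  have := Gf_le_one (Λ ^ N * x) (Λ ^ N * y)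
  apply mul_le_mul_of_nonneg_left _ hP
  nlinarith

lemma fiber_close (e1 e2 : ℂ) (he : cdet e1 e2 ≠ 0) (Λ : ℝ) (hΛ : 0 < Λ) : ∃ C > 0, ∀ (θ θ' : ℂ) (s s' : ℝ) (N : ℕ),
    ‖θ‖ = 1 → ‖θ'‖ = 1 → 1 ≤ s → 1 ≤ s' →
    round (Λ ^ N * (s * (cdet θ e1 / (2 * Real.pi)))) = round (Λ ^ N * (s' * (cdet θ' e1 / (2 * Real.pi)))) →
    round (Λ ^ N * (s * (cdet θ e2 / (2 * Real.pi)))) = round (Λ ^ N * (s' * (cdet θ' e2 / (2 * Real.pi)))) →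
    |cdet θ θ'| ≤ C * (Λ ^ N)⁻¹ := by
  have hpi := Real.pi_pos
  refine ⟨|cdet e1 e2|⁻¹ * (2 * Real.pi * (‖e1‖ + ‖e2‖) + 1), by positivity, ?_⟩
  intro θ θ' s s' N hθ hθ' hs hs' h1 h2
  set v := s • θ - s' • θ' with hv
  have hΛN : 0 < Λ ^ N := by positivity
  have close : ∀ e : ℂ, round (Λ ^ N * (s * (cdet θ e / (2 * Real.pi)))) = round (Λ ^ N * (s' * (cdet θ' e / (2 * Real.pi)))) →
      |cdet v e| ≤ 2 * Real.pi * (Λ ^ N)⁻¹ := by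
    intro e h
    have a := abs_le.mp (abs_sub_round (Λ ^ N * (s * (cdet θ e / (2 * Real.pi)))))
    have b := abs_le.mp (abs_sub_round (Λ ^ N * (s' * (cdet θ' e / (2 * Real.pi)))))
    rw [h] at a
    have e1 : cdet v e = (Λ ^ N * (s * (cdet θ e / (2 * Real.pi))) - Λ ^ N * (s' * (cdet θ' e / (2 * Real.pi)))) * (2 * Real.pi * (Λ ^ N)⁻¹) := by
      rw [hv, cdet_sub_left, cdet_smul_left, cdet_smul_left]
      field_simp
    rw [e1, abs_mul, abs_of_pos (by positivity : 0 < 2 * Real.pi * (Λ ^ N)⁻¹)]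
    have : |Λ ^ N * (s * (cdet θ e / (2 * Real.pi))) - Λ ^ N * (s' * (cdet θ' e / (2 * Real.pi)))| ≤ 1 := by
      rw [abs_le]; constructor <;> linarith
    have h0 : 0 < 2 * Real.pi * (Λ ^ N)⁻¹ := by positivity
    nlinarith
  have c1 := close e1 h1
  have c2 := close e2 h2
  have hvn : |cdet e1 e2| * ‖v‖ ≤ 2 * Real.pi * (Λ ^ N)⁻¹ * ‖e1‖ + 2 * Real.pi * (Λ ^ N)⁻¹ * ‖e2‖ := by
    have := congrArg norm (plucker e1 e2 v)
    rw [norm_smul, Real.norm_eq_abs] at this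
    rw [this]
    refine (norm_sub_le _ _).trans ?_
    rw [norm_smul, norm_smul, Real.norm_eq_abs, Real.norm_eq_abs]
    gcongr
  have hd : s' * cdet θ θ' = - cdet θ v := by
    rw [hv, cdet_sub, cdet_smul, cdet_smul, cdet_self]; ring
  have hd2 : |cdet θ θ'| ≤ ‖v‖ := by
    have h := abs_cdet_le θ v
    rw [hθ, one_mul, ← abs_neg, ← hd, abs_mul, abs_of_pos (by linarith)] at h
    nlinarith [abs_nonneg (cdet θ θ')]
  have hpos : 0 < |cdet e1 e2| := abs_pos.mpr he
  refine hd2.trans ?_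
  rw [mul_assoc, inv_mul_eq_div, le_div_iff₀ hpos]
  have : 0 < (Λ ^ N)⁻¹ := by positivity
  nlinarith


/-- exceptional directions are rare -/
lemma bad_small (e1 e2 : ℂ) (he : cdet e1 e2 ≠ 0) (Λ : ℝ) (hΛ : 1 < Λ) (u : ℝ) (hu : 0 < u) :
    ∃ η : ℝ, 0 < η ∧ ∀ σ : ℝ, u / 2 < σ → ∀ C : ℝ, 0 < C → ∃ M0 : ℕ, ∀ N0 ≥ M0, ∀ L : ℕ, ∃ r1 : ℝ, 0 < r1 ∧ ∀ (Ω : Type) [Fintype Ω]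
      (θ : Ω → ℂ) (r0 : ℝ), r0 ≤ r1 → (∀ ω, ‖θ ω‖ = 1) →
      (∀ r ≥ r0, ∀ S : Finset Ω, (∀ ω ∈ S, ∀ ω' ∈ S, |cdet (θ ω) (θ ω')| ≤ r) →
        (S.card : ℝ) ≤ C * (Fintype.card Ω : ℝ) * r ^ σ) →
      ∃ G : Finset Ω, Fintype.card Ω ≤ 2 * G.card ∧ ∀ ω ∈ G, ∀ N : ℕ, N0 ≤ N → N < L → ∀ s : ℝ, 1 ≤ s → s ≤ Λ →
        η * N < frc Λ (s * (cdet (θ ω) e1 / (2 * Real.pi))) (s * (cdet (θ ω) e2 / (2 * Real.pi))) N := by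
  classical
  have hΛ0 : 0 < Λ := by linarith
  obtain ⟨C1, hC1, B, hB, hek⟩ := ek_count Λ (Λ * (‖e1‖ + ‖e2‖)) hΛ0
  obtain ⟨C', hC', hfib⟩ := fiber_close e1 e2 he Λ hΛ0
  have hx8 : 1 < Λ ^ (u / 8) := Real.one_lt_rpow hΛ (by positivity)
  obtain ⟨q, hq0, hq1, hqB⟩ : ∃ q : ℝ, 0 < q ∧ q ≤ 1 ∧ 1 + B * q ≤ Λ ^ (u / 8) := by
    refine ⟨min 1 ((Λ ^ (u / 8) - 1) / B), lt_min one_pos (div_pos (by linarith) hB), min_le_left _ _, ?_⟩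
    have : B * min 1 ((Λ ^ (u / 8) - 1) / B) ≤ B * ((Λ ^ (u / 8) - 1) / B) :=
      mul_le_mul_of_nonneg_left (min_le_right _ _) hB.le
    rw [mul_div_cancel₀ _ hB.ne'] at this
    linarith
  have hqi : 1 ≤ q⁻¹ := (one_le_inv₀ hq0).mpr hq1
  obtain ⟨η, hη, hηq⟩ : ∃ η : ℝ, 0 < η ∧ (q⁻¹) ^ η ≤ Λ ^ (u / 8) := by
    have hl : 0 ≤ Real.log q⁻¹ := Real.log_nonneg hqi
    have hl2 : 0 < Real.log Λ := Real.log_pos hΛ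
    refine ⟨(u / 8 * Real.log Λ) / (1 + Real.log q⁻¹), by positivity, ?_⟩
    rw [Real.rpow_def_of_pos (by positivity), Real.rpow_def_of_pos hΛ0]
    apply Real.exp_le_exp.mpr
    rw [mul_div_assoc', div_le_iff₀ (by positivity)]
    nlinarith [mul_pos hl2 hu]
  refine ⟨η, hη, fun σ hσ C hC => ?_⟩
  have hσ0 : 0 < σ := by linarith
  set x := Λ ^ (u / 4 - σ) with hx
  have hx0 : 0 < x := by positivity
  have hx1 : x < 1 := Real.rpow_lt_one_of_one_lt_of_neg hΛ (by linarith)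
  set K := C1 * C * C' ^ σ with hK
  have hK0 : 0 < K := by positivity
  obtain ⟨M0, hM0⟩ := exists_pow_lt_of_lt_one (show 0 < (1 - x) / (2 * K) from div_pos (by linarith) (by positivity)) hx1
  refine ⟨M0, fun N0 hN0 L => ⟨C' * (Λ ^ L)⁻¹, by positivity, fun Ω _ θ r0 hr0 hθ hF => ?_⟩⟩
  set Bad : ℕ → Finset Ω := fun N => Finset.univ.filter fun ω => ∃ s : ℝ, 1 ≤ s ∧ s ≤ Λ ∧
    (frc Λ (s * (cdet (θ ω) e1 / (2 * Real.pi))) (s * (cdet (θ ω) e2 / (2 * Real.pi))) N : ℝ) ≤ η * N with hBad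
  have hcard : ∀ N, N ≤ L → ((Bad N).card : ℝ) ≤ Fintype.card Ω * K * x ^ N := by
    intro N hNL
    obtain ⟨Z, hZ, hZm⟩ := hek q hq0 hq1 N ⌊η * N⌋₊
    have hch : ∀ ω : Ω, ∃ s : ℝ, ω ∈ Bad N → (1 ≤ s ∧ s ≤ Λ ∧
      (frc Λ (s * (cdet (θ ω) e1 / (2 * Real.pi))) (s * (cdet (θ ω) e2 / (2 * Real.pi))) N : ℝ) ≤ η * N) := by
      intro ω
      by_cases h : ω ∈ Bad N
      · obtain ⟨s, hs⟩ := (Finset.mem_filter.mp h).2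
        exact ⟨s, fun _ => hs⟩
      · exact ⟨0, fun h' => absurd h' h⟩
    choose sf hsf using hch
    have hbd : ∀ (ω : Ω) (e : ℂ) (s : ℝ), 1 ≤ s → s ≤ Λ → ‖e‖ ≤ ‖e1‖ + ‖e2‖ →
        |s * (cdet (θ ω) e / (2 * Real.pi))| ≤ Λ * (‖e1‖ + ‖e2‖) := by
      intro ω e s hs1 hs2 h
      rw [abs_mul, abs_of_nonneg (by linarith : 0 ≤ s)]
      apply mul_le_mul hs2 _ (abs_nonneg _) hΛ0.le
      rw [abs_div, abs_of_pos (by positivity : 0 < 2 * Real.pi)]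
      have h1 := abs_cdet_le (θ ω) e
      rw [hθ, one_mul] at h1
      have h2 : |cdet (θ ω) e| / (2 * Real.pi) ≤ |cdet (θ ω) e| :=
        div_le_self (abs_nonneg _) (by linarith [Real.pi_gt_three])
      linarith
    set F : Ω → ℤ × ℤ := fun ω => (round (Λ ^ N * (sf ω * (cdet (θ ω) e1 / (2 * Real.pi)))),
      round (Λ ^ N * (sf ω * (cdet (θ ω) e2 / (2 * Real.pi))))) with hFdef
    have hmaps : ∀ ω ∈ Bad N, F ω ∈ Z := by
      intro ω hω
      obtain ⟨h1, h2, h3⟩ := hsf ω hω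
      apply hZm
      · exact hbd _ _ _ h1 h2 (by linarith [norm_nonneg e2])
      · exact hbd _ _ _ h1 h2 (by linarith [norm_nonneg e1])
      · exact Nat.le_floor h3
    have hfibcard : ∀ p ∈ Z, (((Bad N).filter fun ω => F ω = p).card : ℝ) ≤
        C * Fintype.card Ω * (C' * (Λ ^ N)⁻¹) ^ σ := by
      intro p _
      apply hF
      · refine ge_iff_le.mpr (hr0.trans ?_)
        gcongr
        exact hΛ.le
      · intro ω hω ω' hω'
        obtain ⟨h1, h1'⟩ := Finset.mem_filter.mp hω
        obtain ⟨h2, h2'⟩ := Finset.mem_filter.mp hω'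
        have heq : F ω = F ω' := h1'.trans h2'.symm
        exact hfib _ _ _ _ N (hθ _) (hθ _) (hsf ω h1).1 (hsf ω' h2).1 (congrArg Prod.fst heq) (congrArg Prod.snd heq)
    have h1 : ((Bad N).card : ℝ) ≤ Z.card * (C * Fintype.card Ω * (C' * (Λ ^ N)⁻¹) ^ σ) := by
      rw [Finset.card_eq_sum_card_fiberwise hmaps]
      push_cast
      refine (Finset.sum_le_sum hfibcard).trans ?_
      rw [Finset.sum_const, nsmul_eq_mul]
    refine h1.trans ?_
    have h2 : (Z.card : ℝ) ≤ C1 * Λ ^ (u / 4 * N) := by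
      refine hZ.trans ?_
      rw [mul_assoc]
      apply mul_le_mul_of_nonneg_left _ hC1.le
      have a1 : (1 + B * q) ^ N ≤ Λ ^ (u / 8 * N) := by
        rw [Real.rpow_mul hΛ0.le, Real.rpow_natCast]
        exact pow_le_pow_left₀ (by positivity) hqB N
      have a2 : (q⁻¹) ^ ⌊η * N⌋₊ ≤ Λ ^ (u / 8 * N) := by
        rw [Real.rpow_mul hΛ0.le, ← Real.rpow_natCast]
        refine (Real.rpow_le_rpow_of_exponent_le hqi (Nat.floor_le (by positivity))).trans ?_
        rw [Real.rpow_mul (by positivity)]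
        exact Real.rpow_le_rpow (by positivity) hηq (by positivity)
      calc _ ≤ Λ ^ (u / 8 * N) * Λ ^ (u / 8 * N) := mul_le_mul a1 a2 (by positivity) (by positivity)
        _ = _ := by rw [← Real.rpow_add hΛ0]; congr 1; ring
    have h3 : (C' * (Λ ^ N)⁻¹) ^ σ = C' ^ σ * Λ ^ (-(σ * N)) := by
      rw [Real.mul_rpow hC'.le (by positivity), ← Real.rpow_natCast, ← Real.rpow_neg hΛ0.le, ← Real.rpow_mul hΛ0.le]
      congr 2; ring
    have h4 : x ^ N = Λ ^ (u / 4 * N) * Λ ^ (-(σ * N)) := by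
      rw [hx, ← Real.rpow_natCast, ← Real.rpow_mul hΛ0.le, ← Real.rpow_add hΛ0]; congr 1; ring
    rw [h3]
    calc _ ≤ (C1 * Λ ^ (u / 4 * N)) * (C * Fintype.card Ω * (C' ^ σ * Λ ^ (-(σ * N)))) := by
          apply mul_le_mul_of_nonneg_right h2; positivity
      _ = _ := by rw [h4, hK]; ring
  set U := (Finset.Ico N0 L).biUnion Bad with hU
  have hUcard : (U.card : ℝ) ≤ Fintype.card Ω / 2 := by
    have a1 : (U.card : ℝ) ≤ ∑ N ∈ Finset.Ico N0 L, ((Bad N).card : ℝ) := by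
      exact_mod_cast Finset.card_biUnion_le
    have a2 : ∑ N ∈ Finset.Ico N0 L, ((Bad N).card : ℝ) ≤ ∑ N ∈ Finset.Ico N0 L, Fintype.card Ω * K * x ^ N :=
      Finset.sum_le_sum fun N hN => hcard N (Finset.mem_Ico.mp hN).2.le
    rw [← Finset.mul_sum] at a2
    have a3 : ∑ N ∈ Finset.Ico N0 L, x ^ N ≤ x ^ N0 / (1 - x) := geom_sum_Ico_le_of_lt_one hx0.le hx1
    have a4 : x ^ N0 / (1 - x) ≤ 1 / (2 * K) := by
      rw [div_le_iff₀ (by linarith)]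
      have : x ^ N0 ≤ x ^ M0 := pow_le_pow_of_le_one hx0.le hx1.le hN0
      have e : 1 / (2 * K) * (1 - x) = (1 - x) / (2 * K) := by ring
      rw [e]; linarith
    calc _ ≤ _ := a1.trans a2
      _ ≤ Fintype.card Ω * K * (1 / (2 * K)) := mul_le_mul_of_nonneg_left (a3.trans a4) (by positivity)
      _ = _ := by field_simp
  refine ⟨Uᶜ, ?_, ?_⟩
  · have : U.card + Uᶜ.card = Fintype.card Ω := Finset.card_add_card_compl U
    have h2 : (2 * U.card : ℝ) ≤ Fintype.card Ω := by linarith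
    have h2 : 2 * U.card ≤ Fintype.card Ω := by exact_mod_cast h2
    omega
  · intro ω hω N h1 h2 s hs1 hs2
    by_contra hcon
    push Not at hcon
    apply Finset.mem_compl.mp hω
    rw [hU, Finset.mem_biUnion]
    exact ⟨N, Finset.mem_Ico.mpr ⟨h1, h2⟩, Finset.mem_filter.mpr ⟨Finset.mem_univ _, s, hs1, hs2, hcon⟩⟩


noncomputable def fs {ι : Type*} (ρ : ℝ) (d : ι → ℂ) (L : ℕ) (w : Fin L → ι) : ℂ := ∑ k : Fin L, ρ ^ (k : ℕ) • d (w k)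

lemma cdet_fs {ι : Type*} (ρ : ℝ) (d : ι → ℂ) (L : ℕ) (w : Fin L → ι) (θ : ℂ) :
    cdet θ (fs ρ d L w) = ∑ k : Fin L, ρ ^ (k : ℕ) * cdet θ (d (w k)) := by
  rw [fs, cdet_sum]; simp_rw [cdet_smul]

lemma exp_fs {ι : Type*} [Fintype ι] (ρ : ℝ) (d : ι → ℂ) (L : ℕ) (θ : ℂ) (R : ℝ) :
    ∑ w : Fin L → ι, Complex.exp (((R * cdet θ (fs ρ d L w) : ℝ) : ℂ) * Complex.I) =
      ∏ k : Fin L, ∑ i, Complex.exp (((R * ρ ^ (k : ℕ) * cdet θ (d i) : ℝ) : ℂ) * Complex.I) := by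
  classical
  rw [Fintype.prod_sum]
  refine Finset.sum_congr rfl fun w _ => ?_
  rw [← Complex.exp_sum, cdet_fs]
  congr 1
  rw [← Finset.sum_mul]
  congr 1
  push_cast
  rw [Finset.mul_sum]
  refine Finset.sum_congr rfl fun k _ => by ring

lemma exp_three (A : Fin 3 → ℂ) (θ : ℂ) (R : ℝ) :
    ‖∑ j, Complex.exp (((R * cdet θ (A j) : ℝ) : ℂ) * Complex.I)‖ =
      3 * Gf (R * (cdet θ (A 1 - A 0) / (2 * Real.pi))) (R * (cdet θ (A 2 - A 0) / (2 * Real.pi))) := by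
  have h : ∀ j, Complex.exp (((R * cdet θ (A j) : ℝ) : ℂ) * Complex.I) =
      Complex.exp (((R * cdet θ (A 0) : ℝ) : ℂ) * Complex.I) *
      Complex.exp (((2 * Real.pi * (R * (cdet θ (A j - A 0) / (2 * Real.pi))) : ℝ) : ℂ) * Complex.I) := by
    intro j
    rw [← Complex.exp_add, ← add_mul, ← Complex.ofReal_add, cdet_sub]
    congr 3
    have := Real.pi_pos
    field_simp
    ring
  rw [Fin.sum_univ_three, h 1, h 2, Gf, mul_div_cancel₀ _ (by norm_num : (3:ℝ) ≠ 0)]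
  rw [← mul_one_add, ← mul_add, norm_mul, Complex.norm_exp_ofReal_mul_I, one_mul]

lemma exp_prod {κ : Type*} [Fintype κ] (A : Fin 3 → ℂ) (b : κ → ℂ) (θ : ℂ) (R : ℝ) :
    ∑ i : Fin 3 × κ, Complex.exp (((R * cdet θ (A i.1 + b i.2) : ℝ) : ℂ) * Complex.I) =
     (∑ j, Complex.exp (((R * cdet θ (A j) : ℝ) : ℂ) * Complex.I)) *
      (∑ i, Complex.exp (((R * cdet θ (b i) : ℝ) : ℂ) * Complex.I)) := by
  rw [Finset.sum_mul_sum, Fintype.sum_prod_type]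
  refine Finset.sum_congr rfl fun j _ => Finset.sum_congr rfl fun i _ => ?_
  rw [← Complex.exp_add, ← add_mul, ← Complex.ofReal_add, cdet_add, mul_add]

lemma fourier_split {κ : Type*} [Fintype κ] (A : Fin 3 → ℂ) (b : κ → ℂ) (ρ Λ : ℝ) (hρ : 0 < ρ) (hΛ : 1 < Λ)
    (hρΛ : Λ * ρ = 1) (c0 : ℝ) (hc0 : 0 < c0) (hc01 : c0 < 1)
    (hprod : ∀ (x y : ℝ) (N : ℕ), ∏ n ∈ Finset.range (N + 1), Gf (Λ ^ n * x) (Λ ^ n * y) ^ 2 ≤ (1 - c0) ^ (frc Λ x y N))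
    (η : ℝ) (hη : 0 < η) (N0 L : ℕ) (θ : ℂ)
    (hgood : ∀ N : ℕ, N0 ≤ N → N < L → ∀ s : ℝ, 1 ≤ s → s ≤ Λ →
        η * N < frc Λ (s * (cdet θ (A 1 - A 0) / (2 * Real.pi))) (s * (cdet θ (A 2 - A 0) / (2 * Real.pi))) N)
    (τ ξ0 : ℝ) (hτ : 0 < τ) (hξ0 : 0 ≤ ξ0) (hξ01 : ξ0 ≤ 1) (h1 : Λ ^ N0 ≤ ξ0 * τ) (h2 : τ < Λ ^ L) :
    ∑ w : Fin L → Fin 3 × κ, ∑ w' : Fin L → Fin 3 × κ,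
      hker (τ * (cdet θ (fs ρ (fun i : Fin 3 × κ => A i.1 + b i.2) L w) - cdet θ (fs ρ (fun i : Fin 3 × κ => A i.1 + b i.2) L w')))
    ≤ ((3 * Fintype.card κ : ℝ) ^ L) ^ 2 * ξ0 + (9 ^ L * (1 - c0) ^ (η * N0)) * 
      ∑ v : Fin L → κ, ∑ v' : Fin L → κ, hker (τ * (cdet θ (fs ρ b L v) - cdet θ (fs ρ b L v'))) := by
  rw [hker_sum, hker_sum]
  set F : ℝ → ℝ := fun ξ => ‖∑ w : Fin L → Fin 3 × κ, Complex.exp (((ξ * τ * cdet θ (fs ρ (fun i : Fin 3 × κ => A i.1 + b i.2) L w) : ℝ) : ℂ) * Complex.I)‖ with hF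
  set H : ℝ → ℝ := fun ξ => ‖∑ v : Fin L → κ, Complex.exp (((ξ * τ * cdet θ (fs ρ b L v) : ℝ) : ℂ) * Complex.I)‖ with hH
  have hFc : Continuous fun ξ => (1 - ξ) * F ξ ^ 2 := by
    simp only [hF]; fun_prop
  have hHc : Continuous fun ξ => (1 - ξ) * H ξ ^ 2 := by
    simp only [hH]; fun_prop
  have hFb : ∀ ξ, F ξ ≤ (3 * Fintype.card κ : ℝ) ^ L := by
    intro ξ
    refine (norm_sum_le _ _).trans ?_
    simp_rw [Complex.norm_exp_ofReal_mul_I]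
    simp
  have hFH : ∀ ξ, ξ0 ≤ ξ → ξ ≤ 1 → F ξ ^ 2 ≤ (9 ^ L * (1 - c0) ^ (η * N0)) * H ξ ^ 2 := by
    intro ξ hξ hξ1
    set x := cdet θ (A 1 - A 0) / (2 * Real.pi) with hx
    set y := cdet θ (A 2 - A 0) / (2 * Real.pi) with hy
    have hR1 : Λ ^ N0 ≤ ξ * τ := h1.trans (mul_le_mul_of_nonneg_right hξ hτ.le)
    have hR2 : ξ * τ < Λ ^ L := lt_of_le_of_lt (mul_le_of_le_one_left hτ.le hξ1) h2
    obtain ⟨N, hN1, hN2⟩ := exists_nat_pow_near (le_trans (one_le_pow₀ hΛ.le) hR1) hΛ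
    have hN0N : N0 ≤ N := by
      by_contra hc
      push Not at hc
      have := pow_le_pow_right₀ hΛ.le (Nat.succ_le_of_lt hc)
      simp only [Nat.succ_eq_add_one] at this
      linarith
    have hNL : N < L := by
      by_contra hc
      push Not at hc
      have := pow_le_pow_right₀ hΛ.le hc
      linarith
    have hΛ0 : 0 < Λ := by linarith
    have hΛN : 0 < Λ ^ N := by positivity
    set s := ξ * τ / Λ ^ N with hs
    have hsR : ξ * τ = s * Λ ^ N := by rw [hs]; field_simp
    have hs1 : 1 ≤ s := by rw [hs, le_div_iff₀ hΛN]; linarith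
    have hs2 : s ≤ Λ := by rw [hs, div_le_iff₀ hΛN]; rw [pow_succ] at hN2; linarith
    have hfr := hgood N hN0N hNL s hs1 hs2
    have hFeq : F ξ ^ 2 = (9 ^ L * ∏ k ∈ Finset.range L, Gf (ξ * τ * ρ ^ k * x) (ξ * τ * ρ ^ k * y) ^ 2) * H ξ ^ 2 := by
      simp only [hF, hH]
      rw [exp_fs, exp_fs]
      simp_rw [exp_prod]
      rw [Finset.prod_mul_distrib, norm_mul, norm_prod]
      simp_rw [exp_three]
      rw [mul_pow, Finset.prod_mul_distrib, mul_pow, ← Finset.prod_pow _ 2, ← Finset.prod_pow _ 2]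
      congr 2
      · simp; norm_num
      · rw [← Fin.prod_univ_eq_prod_range (fun k => Gf (ξ * τ * ρ ^ k * x) (ξ * τ * ρ ^ k * y) ^ 2)]
    rw [hFeq]
    apply mul_le_mul_of_nonneg_right _ (sq_nonneg _)
    apply mul_le_mul_of_nonneg_left _ (by positivity)
    have e1 : ∏ k ∈ Finset.range L, Gf (ξ * τ * ρ ^ k * x) (ξ * τ * ρ ^ k * y) ^ 2 ≤
        ∏ k ∈ Finset.range (N + 1), Gf (ξ * τ * ρ ^ k * x) (ξ * τ * ρ ^ k * y) ^ 2 := by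
      apply Finset.prod_le_prod_of_subset_of_le_one
      · exact Finset.range_mono hNL
      · exact fun i _ => sq_nonneg _
      · exact fun i _ _ => pow_le_one₀ (Gf_nonneg _ _) (Gf_le_one _ _)
    have e2 : ∏ k ∈ Finset.range (N + 1), Gf (ξ * τ * ρ ^ k * x) (ξ * τ * ρ ^ k * y) ^ 2 = 
        ∏ n ∈ Finset.range (N + 1), Gf (Λ ^ n * (s * x)) (Λ ^ n * (s * y)) ^ 2 := by
      rw [← Finset.prod_range_reflect]
      refine Finset.prod_congr rfl fun k hk => ?_
      have hk : k ≤ N := by simpa [Nat.lt_succ_iff] using hk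
      have : ξ * τ * ρ ^ (N + 1 - 1 - k) = s * Λ ^ k := by
        rw [hsR, Nat.add_sub_cancel]
        have : Λ ^ N = Λ ^ k * Λ ^ (N - k) := by rw [← pow_add]; congr 1; omega
        rw [this, mul_assoc, mul_assoc, ← mul_pow, hρΛ, one_pow, mul_one]
      rw [this]; ring_nf
    refine (e1.trans (e2.trans_le (hprod _ _ _))).trans ?_
    rw [← Real.rpow_natCast]
    apply Real.rpow_le_rpow_of_exponent_ge (by linarith) (by linarith)
    have : η * N0 ≤ η * N := by gcongr
    linarith
  have hK : 0 ≤ 9 ^ L * (1 - c0) ^ (η * N0) := by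
    have : 0 ≤ (1 - c0) ^ (η * N0) := Real.rpow_nonneg (by linarith) _
    positivity
  rw [← intervalIntegral.integral_add_adjacent_intervals (hFc.intervalIntegrable 0 ξ0) (hFc.intervalIntegrable ξ0 1)]
  apply add_le_add
  · have : ∫ ξ in (0:ℝ)..ξ0, (1 - ξ) * F ξ ^ 2 ≤ ∫ ξ in (0:ℝ)..ξ0, ((3 * Fintype.card κ : ℝ) ^ L) ^ 2 := by
      apply intervalIntegral.integral_mono_on hξ0 (hFc.intervalIntegrable _ _) (continuous_const.intervalIntegrable _ _)
      intro ξ hξ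
      have a1 : F ξ ^ 2 ≤ ((3 * Fintype.card κ : ℝ) ^ L) ^ 2 := pow_le_pow_left₀ (norm_nonneg _) (hFb ξ) 2
      have a2 : 0 ≤ F ξ ^ 2 := sq_nonneg _
      nlinarith [hξ.1]
    refine this.trans (le_of_eq ?_)
    rw [intervalIntegral.integral_const]; simp; ring
  · rw [← intervalIntegral.integral_const_mul]
    have hc' : Continuous fun ξ => (9 ^ L * (1 - c0) ^ (η * N0)) * ((1 - ξ) * H ξ ^ 2) := continuous_const.mul hHc
    rw [← intervalIntegral.integral_add_adjacent_intervals (hc'.intervalIntegrable 0 ξ0) (hc'.intervalIntegrable ξ0 1)]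
    have b1 : 0 ≤ ∫ ξ in (0:ℝ)..ξ0, (9 ^ L * (1 - c0) ^ (η * N0)) * ((1 - ξ) * H ξ ^ 2) := by
      apply intervalIntegral.integral_nonneg hξ0
      intro ξ hξ
      apply mul_nonneg hK (mul_nonneg (by linarith [hξ.2]) (sq_nonneg _))
    have b2 : ∫ ξ in ξ0..1, (1 - ξ) * F ξ ^ 2 ≤ ∫ ξ in ξ0..1, (9 ^ L * (1 - c0) ^ (η * N0)) * ((1 - ξ) * H ξ ^ 2) := by
      apply intervalIntegral.integral_mono_on hξ01 (hFc.intervalIntegrable _ _) (hc'.intervalIntegrable _ _)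
      intro ξ hξ
      have := mul_le_mul_of_nonneg_left (hFH ξ hξ.1 hξ.2) (by linarith [hξ.2] : 0 ≤ 1 - ξ)
      linarith
    linarith

lemma sum_biUnion_le' {α β : Type*} [DecidableEq β] (s : Finset α) (S : α → Finset β) (f : β → ℝ) (hf : ∀ x, 0 ≤ f x) :
    ∑ x ∈ s.biUnion S, f x ≤ ∑ k ∈ s, ∑ x ∈ S k, f x := by
  classical
  induction s using Finset.induction_on with
  | empty => simp
  | insert a s ha ih =>
    rw [Finset.biUnion_insert, Finset.sum_insert ha]
    have := Finset.sum_union_inter (s₁ := S a) (s₂ := s.biUnion S) (f := f)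
    have h2 : 0 ≤ ∑ x ∈ S a ∩ s.biUnion S, f x := Finset.sum_nonneg fun x _ => hf x
    linarith

lemma kauf_sum {κ : Type*} [Fintype κ] {Ω : Type*} [Fintype Ω] (θ : Ω → ℂ) (hθ : ∀ ω, ‖θ ω‖ = 1) (C σ r0 : ℝ) (hC : 0 < C)
    (hσ0 : 0 < σ) (hσ : σ ≤ 1)
    (hF : ∀ r ≥ r0, ∀ S : Finset Ω, (∀ ω ∈ S, ∀ ω' ∈ S, |cdet (θ ω) (θ ω')| ≤ r) →
        (S.card : ℝ) ≤ C * (Fintype.card Ω : ℝ) * r ^ σ)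
    (ρ c C1 : ℝ) (hρ : 0 < ρ) (hρ1 : ρ < 1) (hc : 0 < c) (hC1 : 0 < C1) (hκ : 1 ≤ Fintype.card κ * ρ ^ σ)
    (L : ℕ) (Y : (Fin L → κ) → ℂ)
    (hY : ∀ v v' (k : Fin L), (∀ i < k, v i = v' i) → v k ≠ v' k → c * ρ ^ (k : ℕ) ≤ ‖Y v - Y v'‖)
    (hr : ∀ v v', r0 * ((C1 * ρ ^ L)⁻¹ * ‖Y v - Y v'‖) ≤ 2) :
    ∑ ω, ∑ v, ∑ v', hker ((C1 * ρ ^ L)⁻¹ * (cdet (θ ω) (Y v) - cdet (θ ω) (Y v'))) ≤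
      ((Fintype.card κ : ℝ) ^ L) ^ 2 * Fintype.card Ω * (ρ ^ L) ^ σ * (1 + 32 * C * (C1 / c) ^ σ * L) := by
  classical
  set τ := (C1 * ρ ^ L)⁻¹ with hτ
  have hτ0 : 0 < τ := by positivity
  set n : ℝ := (Fintype.card κ : ℝ) with hn
  have hn0 : 0 ≤ n := by positivity
  have hρσ : 0 < ρ ^ σ := by positivity
  have hpow : ∀ k : ℕ, 1 ≤ n ^ k * (ρ ^ k) ^ σ := by
    intro k
    have : (ρ ^ k) ^ σ = (ρ ^ σ) ^ k := by
      rw [← Real.rpow_natCast, ← Real.rpow_natCast, ← Real.rpow_mul hρ.le, ← Real.rpow_mul hρ.le, mul_comm]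
    rw [this, ← mul_pow]
    exact one_le_pow₀ hκ
  -- first difference sets
  set S : (Fin L → κ) → Fin L → Finset (Fin L → κ) := fun v k =>
    Finset.univ.filter fun v' => (∀ i < k, v i = v' i) ∧ v k ≠ v' k with hS
  have hScard : ∀ v k, ((S v k).card : ℝ) ≤ n ^ L * (ρ ^ (k : ℕ)) ^ σ := by
    intro v k
    have h1 := prefix_card L k k.2.le v (S v k) (fun w hw i hi => ((Finset.mem_filter.mp hw).2.1 i hi).symm)
    have h2 : n ^ (k : ℕ) * ((S v k).card : ℝ) ≤ n ^ L := by rw [hn]; exact_mod_cast h1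
    have h3 := hpow k
    have h4 : 0 ≤ (ρ ^ (k : ℕ)) ^ σ := by positivity
    calc ((S v k).card : ℝ) ≤ (n ^ (k : ℕ) * (ρ ^ (k : ℕ)) ^ σ) * (S v k).card := le_mul_of_one_le_left (by positivity) h3
      _ = (n ^ (k : ℕ) * (S v k).card) * (ρ ^ (k : ℕ)) ^ σ := by ring
      _ ≤ _ := mul_le_mul_of_nonneg_right h2 h4
  set g : (Fin L → κ) → (Fin L → κ) → ℝ := fun v v' => ∑ ω, hker (τ * (cdet (θ ω) (Y v) - cdet (θ ω) (Y v'))) with hg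
  have hg0 : ∀ v v', 0 ≤ g v v' := fun v v' => Finset.sum_nonneg fun _ _ => hker_nonneg _
  have hgd : ∀ v, g v v ≤ Fintype.card Ω := by
    intro v
    refine (Finset.sum_le_sum fun ω _ => hker_le_one _).trans ?_
    simp
  have hgo : ∀ v (k : Fin L), ∀ v' ∈ S v k, g v v' ≤ 32 * C * Fintype.card Ω * ((C1 / c) ^ σ * ((ρ ^ L) ^ σ / (ρ ^ (k : ℕ)) ^ σ)) := by
    intro v k v' hv'
    obtain ⟨-, h1, h2⟩ := Finset.mem_filter.mp hv'
    have h3 := hY v v' k h1 h2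
    have h3' : 0 < c * ρ ^ (k : ℕ) := by positivity
    have hz : Y v - Y v' ≠ 0 := norm_pos_iff.mp (lt_of_lt_of_le h3' h3)
    have h4 := kaufman θ hθ C σ r0 hC hσ0 hσ hF τ hτ0 (Y v - Y v') hz (hr v v')
    simp_rw [cdet_sub] at h4
    refine h4.trans ?_
    apply mul_le_mul_of_nonneg_left _ (by positivity)
    rw [Real.rpow_neg (by positivity)]
    have : (C1 / c) ^ σ * ((ρ ^ L) ^ σ / (ρ ^ (k : ℕ)) ^ σ) = ((τ * (c * ρ ^ (k : ℕ))) ^ σ)⁻¹ := by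
      rw [← Real.div_rpow (by positivity) (by positivity), ← Real.mul_rpow (by positivity) (by positivity),
        ← Real.inv_rpow (by positivity), hτ]
      congr 1; field_simp
    rw [this]
    gcongr
  have hv : ∀ v, ∑ v', g v v' ≤ n ^ L * Fintype.card Ω * (ρ ^ L) ^ σ * (1 + 32 * C * (C1 / c) ^ σ * L) := by
    intro v
    have h1 : ∑ v', g v v' ≤ g v v + ∑ k : Fin L, ∑ v' ∈ S v k, g v v' := by
      have : (Finset.univ : Finset (Fin L → κ)) = insert v (Finset.univ.biUnion (S v)) := by
        ext v'
        simp only [Finset.mem_univ, Finset.mem_insert, Finset.mem_biUnion, true_and, true_iff]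
        by_cases hvv : v' = v
        · exact Or.inl hvv
        · right
          have hne : ∃ k, v k ≠ v' k := by
            by_contra hcon; push Not at hcon
            exact hvv (funext hcon).symm
          obtain ⟨k, hk, hmin⟩ := (Finset.univ.filter fun k => v k ≠ v' k).exists_minimal (by
            obtain ⟨k, hk⟩ := hne; exact ⟨k, by simpa using hk⟩)
          refine ⟨k, Finset.mem_filter.mpr ⟨Finset.mem_univ _, ?_, (Finset.mem_filter.mp hk).2⟩⟩
          intro i hi
          by_contra hcon
          exact absurd (hmin (Finset.mem_filter.mpr ⟨Finset.mem_univ _, hcon⟩) hi.le) (not_le.mpr hi)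
      rw [this]
      have hb : ∑ v' ∈ Finset.univ.biUnion (S v), g v v' ≤ ∑ k : Fin L, ∑ v' ∈ S v k, g v v' :=
        sum_biUnion_le' _ _ _ (hg0 v)
      by_cases hm : v ∈ Finset.univ.biUnion (S v)
      · rw [Finset.insert_eq_of_mem hm]; linarith [hg0 v v]
      · rw [Finset.sum_insert hm]; linarith
    have h2 : g v v ≤ n ^ L * Fintype.card Ω * (ρ ^ L) ^ σ := by
      refine (hgd v).trans ?_
      have := hpow L
      nlinarith [show (0:ℝ) ≤ Fintype.card Ω by positivity]
    have h3 : ∀ k : Fin L, ∑ v' ∈ S v k, g v v' ≤ n ^ L * Fintype.card Ω * (ρ ^ L) ^ σ * (32 * C * (C1 / c) ^ σ) := by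
      intro k
      refine (Finset.sum_le_card_nsmul _ _ _ (hgo v k)).trans ?_
      rw [nsmul_eq_mul]
      refine (mul_le_mul_of_nonneg_right (hScard v k) (by positivity)).trans (le_of_eq ?_)
      have : (ρ ^ (k : ℕ)) ^ σ ≠ 0 := by positivity
      field_simp
    refine h1.trans ?_
    have h4 := Finset.sum_le_sum fun k (_ : k ∈ (Finset.univ : Finset (Fin L))) => h3 k
    rw [Finset.sum_const, nsmul_eq_mul] at h4
    simp only [Finset.card_univ, Fintype.card_fin] at h4
    linarith
  have hswap : ∑ ω, ∑ v, ∑ v', hker (τ * (cdet (θ ω) (Y v) - cdet (θ ω) (Y v'))) = ∑ v, ∑ v', g v v' := by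
    rw [Finset.sum_comm]
    refine Finset.sum_congr rfl fun v _ => ?_
    rw [Finset.sum_comm]
  rw [hswap]
  refine (Finset.sum_le_sum fun v _ => hv v).trans ?_
  rw [Finset.sum_const, nsmul_eq_mul]
  simp only [Finset.card_univ, Fintype.card_fun, Fintype.card_fin]
  push_cast
  rw [← hn]
  apply le_of_eq; ring


lemma ev_small (ρ e ε K : ℝ) (hρ : 0 < ρ) (hρ1 : ρ < 1) (he : 0 < e) (hε : 0 < ε) :
    ∀ᶠ L : ℕ in Filter.atTop, (ρ ^ L) ^ e * (1 + K * L) < ε := by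
  have h1 : ρ ^ e < 1 := Real.rpow_lt_one hρ.le hρ1 he
  have h0 : 0 < ρ ^ e := by positivity
  have a1 := tendsto_pow_atTop_nhds_zero_of_lt_one h0.le h1
  have a2 := tendsto_self_mul_const_pow_of_lt_one h0.le h1
  have a3 := a1.add (a2.const_mul K)
  simp only [mul_zero, add_zero] at a3
  filter_upwards [a3.eventually_lt_const hε] with L hL
  have : (ρ ^ L) ^ e = (ρ ^ e) ^ L := by
    rw [← Real.rpow_natCast, ← Real.rpow_natCast, ← Real.rpow_mul hρ.le, ← Real.rpow_mul hρ.le, mul_comm]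
  rw [this]; linarith

lemma pairs_upper {X : Type*} [Fintype X] (f : X → ℝ) (τ δ : ℝ) (hτ : 0 < τ) (h : τ * (2 * δ) ≤ 1) :
    ((Finset.univ.filter (fun p : X × X => |f p.1 - f p.2| ≤ 2 * δ)).card : ℝ) ≤ 8 * ∑ w, ∑ w', hker (τ * (f w - f w')) := by
  have e : ∑ w, ∑ w', hker (τ * (f w - f w')) = ∑ p : X × X, hker (τ * (f p.1 - f p.2)) :=
    (Fintype.sum_prod_type' (fun w w' => hker (τ * (f w - f w')))).symm
  rw [e, Finset.mul_sum, Finset.card_eq_sum_ones]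
  push_cast
  rw [Finset.sum_filter]
  refine Finset.sum_le_sum fun p _ => ?_
  split_ifs with hp
  · have : |τ * (f p.1 - f p.2)| ≤ 1 := by
      rw [abs_mul, abs_of_pos hτ]
      exact (mul_le_mul_of_nonneg_left hp hτ.le).trans h
    linarith [hker_ge _ this]
  · exact mul_nonneg (by norm_num) (hker_nonneg _)

set_option maxHeartbeats 1000000 in
lemma improve {κ : Type*} [Fintype κ] (A : Fin 3 → ℂ) (b : κ → ℂ) (ρ : ℝ) (hρ : 0 < ρ) (hρ1 : ρ < 1)
    (hA : cdet (A 1 - A 0) (A 2 - A 0) ≠ 0) (t : ℝ) (ht1 : t ≤ 1) (hκ : 1 ≤ Fintype.card κ * ρ ^ t)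
    (c : ℝ) (hc : 0 < c)
    (hY : ∀ (L : ℕ) (v v' : Fin L → κ) (k : Fin L), (∀ i < k, v i = v' i) → v k ≠ v' k →
      c * ρ ^ (k : ℕ) ≤ ‖fs ρ b L v - fs ρ b L v'‖)
    (E : Set ℂ) (u : ℝ) (hu : 0 < u) (hut : u < t) :
    ∃ γ : ℝ, 0 < γ ∧ γ ≤ u / 2 ∧ ∀ σ : ℝ, u - γ < σ → σ ≤ u → DTree E ρ σ → ∀ C1 : ℝ, 1 < C1 →
      ∃ θ ∈ E, ‖θ‖ = 1 ∧ ∃ L : ℕ, 0 < L ∧ ∃ W : Finset (Fin L → Fin 3 × κ),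
        (∀ x ∈ W, ∀ y ∈ W, x ≠ y → C1 / 2 * ρ ^ L ≤
          |cdet θ (fs ρ (fun i : Fin 3 × κ => A i.1 + b i.2) L x) -
            cdet θ (fs ρ (fun i : Fin 3 × κ => A i.1 + b i.2) L y)|) ∧
        1 < W.card * (ρ ^ L) ^ u := by
  classical
  set Λ := ρ⁻¹ with hΛdef
  have hΛ : 1 < Λ := (one_lt_inv₀ hρ).mpr hρ1
  have hΛ0 : 0 < Λ := by linarith
  have hΛρ : Λ * ρ = 1 := inv_mul_cancel₀ hρ.ne'
  obtain ⟨η, hη, hbad⟩ := bad_small (A 1 - A 0) (A 2 - A 0) hA Λ hΛ u hu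
  obtain ⟨c0, hc0, hc01, hprod⟩ := prod_bound Λ hΛ0
  set β := (1 + u) / 2 with hβ
  have hβ1 : β < 1 := by rw [hβ]; linarith
  have hβu : u < β := by rw [hβ]; linarith
  set g0 := η * (1 - β) / 4 * (Real.log (1 - c0) / Real.log ρ) with hg0
  have hlρ : Real.log ρ < 0 := Real.log_neg hρ hρ1
  have hg0pos : 0 < g0 := by
    have h1 : Real.log (1 - c0) < 0 := Real.log_neg (by linarith) (by linarith)
    have h3 : 0 < 1 - β := by linarith
    have := div_pos_of_neg_of_neg h1 hlρ
    positivity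
  have hρg : ∀ L : ℕ, (1 - c0) ^ (η * (1 - β) / 4 * L) = (ρ ^ L) ^ g0 := by
    intro L
    rw [← Real.rpow_natCast ρ L, ← Real.rpow_mul hρ.le, Real.rpow_def_of_pos hρ, Real.rpow_def_of_pos (by linarith : 0 < 1 - c0)]
    congr 1
    rw [hg0]
    have := hlρ.ne
    field_simp
  refine ⟨min (g0 / 2) (u / 2), by positivity, min_le_right _ _, ?_⟩
  intro σ hσ1 hσu htree C1 hC1
  have hσa : u - g0 / 2 < σ := by linarith [min_le_left (g0 / 2) (u / 2)]
  have hσb : u / 2 < σ := by linarith [min_le_right (g0 / 2) (u / 2)]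
  have hσ0 : 0 < σ := by linarith
  obtain ⟨C, hC, hfro⟩ := frostman E ρ σ hρ hρ1 hσ0 htree
  obtain ⟨M0, hM0⟩ := hbad σ hσb C hC
  by_contra hcon
  push Not at hcon
  set K := 32 * C * (C1 / c) ^ σ with hK
  -- choose L
  have ev1 := ev_small ρ (β - u) (1 / 16) 0 hρ hρ1 (by linarith) (by norm_num)
  have ev2 := ev_small ρ (g0 + σ - u) (1 / 32) K hρ hρ1 (by linarith) (by norm_num)
  have ev3 := ev_small ρ ((1 - β) / 2) C1⁻¹ 0 hρ hρ1 (by linarith) (by positivity)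
  have ev4 : ∀ᶠ L : ℕ in Filter.atTop, max (4 / (1 - β)) ((M0 + 1) * (2 / (1 - β))) ≤ (L : ℝ) :=
    tendsto_natCast_atTop_atTop.eventually_ge_atTop _
  obtain ⟨L, ⟨⟨⟨hL1, hL2⟩, hL3⟩, hL4⟩, hL5⟩ := ((((ev1.and ev2).and ev3).and ev4).and (Filter.eventually_gt_atTop 0)).exists
  simp only [zero_mul, add_zero, mul_one] at hL1 hL3
  set y := ρ ^ L with hy
  have hy0 : 0 < y := by positivity
  have h1β : 0 < 1 - β := by linarith
  set N0 := ⌊(1 - β) * L / 2⌋₊ with hN0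
  have hN0le : (N0 : ℝ) ≤ (1 - β) * L / 2 := Nat.floor_le (by positivity)
  have hN0ge : (1 - β) / 4 * L ≤ N0 := by
    have h1 := Nat.lt_floor_add_one ((1 - β) * L / 2)
    have h2 : 4 / (1 - β) ≤ L := (le_max_left _ _).trans hL4
    rw [div_le_iff₀ h1β] at h2
    rw [← hN0] at h1
    linarith
  have hN0M : M0 ≤ N0 := by
    apply Nat.le_floor
    have h2 : (M0 + 1) * (2 / (1 - β)) ≤ L := (le_max_right _ _).trans hL4
    have h3 : (M0 + 1) * (2 / (1 - β)) * (1 - β) ≤ L * (1 - β) := mul_le_mul_of_nonneg_right h2 h1β.le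
    have h4 : ((M0 : ℝ) + 1) * (2 / (1 - β)) * (1 - β) = 2 * (M0 + 1) := by field_simp
    linarith
  obtain ⟨r1, hr1, hgood⟩ := hM0 N0 hN0M L
  set τ := (C1 * y)⁻¹ with hτ
  have hC1' : 0 < C1 := by linarith
  have hτ0 : 0 < τ := by positivity
  set M := ∑ v : Fin L → κ, ‖fs ρ b L v‖ with hM
  have hM0' : 0 ≤ M := Finset.sum_nonneg fun _ _ => norm_nonneg _
  have hMle : ∀ v v' : Fin L → κ, ‖fs ρ b L v - fs ρ b L v'‖ ≤ 2 * M := by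
    intro v v'
    have a : ∀ v : Fin L → κ, ‖fs ρ b L v‖ ≤ M := fun v =>
      Finset.single_le_sum (f := fun v => ‖fs ρ b L v‖) (fun _ _ => norm_nonneg _) (Finset.mem_univ v)
    linarith [norm_sub_le (fs ρ b L v) (fs ρ b L v'), a v, a v']
  set r0 := min r1 (τ * (M + 1))⁻¹ with hr0
  have hr0pos : 0 < r0 := lt_min hr1 (by positivity)
  obtain ⟨B, N, θ, hB, hθ, hF⟩ := hfro r0 hr0pos
  obtain ⟨G, hGcard, hG⟩ := hgood _ θ r0 (min_le_left _ _) (fun ω => (hθ ω).2) hF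
  have hκσ : 1 ≤ Fintype.card κ * ρ ^ σ := by
    refine hκ.trans ?_
    apply mul_le_mul_of_nonneg_left _ (by positivity)
    exact Real.rpow_le_rpow_of_exponent_ge hρ hρ1.le (by linarith)
  have hks := kauf_sum θ (fun ω => (hθ ω).2) C σ r0 hC hσ0 (by linarith) hF ρ c C1 hρ hρ1 hc hC1' hκσ L (fs ρ b L)
    (hY L) (by
      intro v v'
      have h1 : r0 ≤ (τ * (M + 1))⁻¹ := min_le_right _ _
      calc r0 * (τ * ‖fs ρ b L v - fs ρ b L v'‖) ≤ (τ * (M + 1))⁻¹ * (τ * (2 * (M + 1))) := by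
            apply mul_le_mul h1 _ (by positivity) (by positivity)
            apply mul_le_mul_of_nonneg_left _ hτ0.le
            linarith [hMle v v']
        _ = 2 := by field_simp)
  set n : ℝ := (Fintype.card κ : ℝ) with hn
  have hn0 : 0 < n := by
    by_contra h
    have : n = 0 := le_antisymm (not_lt.mp h) (by positivity)
    rw [this] at hκσ; linarith
  set H : (Fin N → Fin B) → ℝ := fun ω => ∑ v, ∑ v', hker (τ * (cdet (θ ω) (fs ρ b L v) - cdet (θ ω) (fs ρ b L v'))) with hH
  have hH0 : ∀ ω, 0 ≤ H ω := fun ω => Finset.sum_nonneg fun _ _ => Finset.sum_nonneg fun _ _ => hker_nonneg _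
  have hyβ : y ^ β ≤ y ^ u / 16 := by
    have : y ^ β = y ^ (β - u) * y ^ u := by rw [← Real.rpow_add hy0]; congr 1; ring
    rw [this]
    have := mul_le_mul_of_nonneg_right hL1.le (Real.rpow_pos_of_pos hy0 u).le
    linarith only [this]
  have key : ∀ ω ∈ G, ((3 * n) ^ L) ^ 2 * (y ^ u / 16) ≤ (9 ^ L * y ^ g0) * H ω := by
    intro ω hω
    set f : (Fin L → Fin 3 × κ) → ℝ := fun w => cdet (θ ω) (fs ρ (fun i : Fin 3 × κ => A i.1 + b i.2) L w) with hf
    have h1 := pairs_lower f (C1 / 2 * y) (y ^ u)⁻¹ (by positivity) (by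
      intro W hW
      have := hcon (θ ω) (hθ ω).1 (hθ ω).2 L hL5 W hW
      rw [← one_div, le_div_iff₀ (Real.rpow_pos_of_pos hy0 u)]
      exact this)
    have hyu := Real.rpow_pos_of_pos hy0 u
    have hX : (Fintype.card (Fin L → Fin 3 × κ) : ℝ) = (3 * n) ^ L := by
      simp [hn]
    rw [hX] at h1
    set P := Finset.univ.filter (fun p : (Fin L → Fin 3 × κ) × (Fin L → Fin 3 × κ) => |f p.1 - f p.2| ≤ 2 * (C1 / 2 * y)) with hP
    have h2 : (P.card : ℝ) ≤ 8 * ∑ w, ∑ w', hker (τ * (f w - f w')) := by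
      exact pairs_upper f τ (C1 / 2 * y) hτ0 (by rw [hτ, inv_mul_le_iff₀ (by positivity)]; linarith)
    have h3 := fourier_split A b ρ Λ hρ hΛ hΛρ c0 hc0 hc01 hprod η hη N0 L (θ ω) (hG ω hω) τ (y ^ β) hτ0 (by positivity)
      (Real.rpow_le_one hy0.le (pow_le_one₀ hρ.le hρ1.le) (by linarith)) (by
        have hΛN : Λ ^ N0 ≤ y ^ (-((1 - β) / 2)) := by
          rw [← Real.rpow_natCast Λ N0]
          refine (Real.rpow_le_rpow_of_exponent_le hΛ.le hN0le).trans (le_of_eq ?_)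
          rw [hy, ← Real.rpow_natCast ρ L, ← Real.rpow_mul hρ.le, hΛdef, Real.inv_rpow hρ.le, ← Real.rpow_neg hρ.le]
          congr 1; ring
        refine hΛN.trans ?_
        have e1 : y ^ β * τ = y ^ (β - 1) * C1⁻¹ := by
          rw [hτ, mul_inv, Real.rpow_sub hy0, Real.rpow_one]; field_simp
        have e2 : y ^ (-((1 - β) / 2)) = y ^ (β - 1) * y ^ ((1 - β) / 2) := by
          rw [← Real.rpow_add hy0]; congr 1; ring
        rw [e1, e2]
        exact mul_le_mul_of_nonneg_left hL3.le (by positivity)) (by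
        rw [hτ, hy, hΛdef, mul_inv, ← inv_pow]
        have : 0 < ρ⁻¹ ^ L := by positivity
        have h' : C1⁻¹ < 1 := inv_lt_one_of_one_lt₀ hC1
        exact mul_lt_of_lt_one_left this h')
    have h4 : (1 - c0) ^ (η * N0) ≤ y ^ g0 := by
      rw [← hρg L]
      apply Real.rpow_le_rpow_of_exponent_ge (by linarith) (by linarith)
      have := mul_le_mul_of_nonneg_left hN0ge hη.le
      linarith only [this]
    have h5 : ((3 * n) ^ L) ^ 2 * y ^ u ≤ P.card := by
      have := mul_le_mul_of_nonneg_right h1 hyu.le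
      have e : (y ^ u)⁻¹ * (P.card : ℝ) * y ^ u = P.card := by field_simp
      rw [e] at this; exact this
    have h6 : 9 ^ L * (1 - c0) ^ (η * N0) * H ω ≤ 9 ^ L * y ^ g0 * H ω := by
      apply mul_le_mul_of_nonneg_right _ (hH0 ω)
      apply mul_le_mul_of_nonneg_left h4 (by positivity)
    have h7 : ((3 * n) ^ L) ^ 2 * y ^ β ≤ ((3 * n) ^ L) ^ 2 * (y ^ u / 16) :=
      mul_le_mul_of_nonneg_left hyβ (by positivity)
    linarith
  have hsum : (G.card : ℝ) * (((3 * n) ^ L) ^ 2 * (y ^ u / 16)) ≤ (9 ^ L * y ^ g0) * ∑ ω, H ω := by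
    rw [Finset.mul_sum, ← nsmul_eq_mul]
    refine (Finset.card_nsmul_le_sum G _ _ key).trans ?_
    apply Finset.sum_le_sum_of_subset_of_nonneg (Finset.subset_univ _)
    intro ω _ _
    have := hH0 ω
    positivity
  have hG2 : (Fintype.card (Fin N → Fin B) : ℝ) ≤ 2 * G.card := by exact_mod_cast hGcard
  set Q : ℝ := (Fintype.card (Fin N → Fin B) : ℝ) with hQ
  have hQ0 : 0 < Q := by
    rw [hQ]; simp only [Fintype.card_fun, Fintype.card_fin]; push_cast
    have : (0:ℝ) < B := by exact_mod_cast hB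
    positivity
  have hX2 : ((3 * n) ^ L) ^ 2 = 9 ^ L * (n ^ L) ^ 2 := by
    rw [mul_pow, mul_pow, ← pow_mul, mul_comm L 2, pow_mul]; norm_num
  have hyu := Real.rpow_pos_of_pos hy0 u
  have hyg := Real.rpow_pos_of_pos hy0 g0
  have hZ : 0 < 9 ^ L * (n ^ L) ^ 2 * Q * y ^ u := by positivity
  have f1 : 9 ^ L * (n ^ L) ^ 2 * Q * y ^ u * (1 / 32) ≤ (G.card : ℝ) * (((3 * n) ^ L) ^ 2 * (y ^ u / 16)) := by
    rw [hX2]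
    have : 0 ≤ 9 ^ L * (n ^ L) ^ 2 * y ^ u := by positivity
    have := mul_le_mul_of_nonneg_left hG2 this
    linarith only [this]
  have f2 : (9 ^ L * y ^ g0) * ∑ ω, H ω ≤ 9 ^ L * (n ^ L) ^ 2 * Q * y ^ u * (y ^ (g0 + σ - u) * (1 + K * L)) := by
    refine (mul_le_mul_of_nonneg_left hks (by positivity)).trans (le_of_eq ?_)
    rw [Real.rpow_sub hy0, Real.rpow_add hy0, ← hy, ← hK]
    generalize y ^ g0 = p1 at *
    generalize y ^ σ = p2 at *
    generalize y ^ u = p3 at *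
    have := hyu.ne'
    field_simp
  have f3 := mul_lt_mul_of_pos_left hL2 hZ
  linarith


noncomputable def pt {ι : Type*} (ρ : ℝ) (d : ι → ℂ) (w : ℕ → ι) : ℂ := ∑' k, ρ ^ k • d (w k)

lemma pt_summable {ι : Type*} [Fintype ι] (ρ : ℝ) (hρ : 0 < ρ) (hρ1 : ρ < 1) (d : ι → ℂ) (w : ℕ → ι) :
    Summable fun k => ρ ^ k • d (w k) := by
  have hM : ∀ i, ‖d i‖ ≤ ∑ i, ‖d i‖ := fun i =>
    Finset.single_le_sum (f := fun i => ‖d i‖) (fun _ _ => norm_nonneg _) (Finset.mem_univ i)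
  refine Summable.of_norm_bounded (g := fun k => ρ ^ k * ∑ i, ‖d i‖) ?_ ?_
  · exact (summable_geometric_of_lt_one hρ.le hρ1).mul_right _
  · intro k
    rw [norm_smul, Real.norm_of_nonneg (by positivity)]
    exact mul_le_mul_of_nonneg_left (hM _) (by positivity)

lemma pt_bdd {ι : Type*} [Fintype ι] (ρ : ℝ) (hρ : 0 < ρ) (hρ1 : ρ < 1) (d : ι → ℂ) :
    ∃ D : ℝ, 0 < D ∧ ∀ w w' : ℕ → ι, ‖pt ρ d w - pt ρ d w'‖ ≤ D := by
  have hM : ∀ i, ‖d i‖ ≤ ∑ i, ‖d i‖ := fun i =>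
    Finset.single_le_sum (f := fun i => ‖d i‖) (fun _ _ => norm_nonneg _) (Finset.mem_univ i)
  have hb : ∀ w : ℕ → ι, ‖pt ρ d w‖ ≤ (1 - ρ)⁻¹ * ∑ i, ‖d i‖ := by
    intro w
    apply tsum_of_norm_bounded ((hasSum_geometric_of_lt_one hρ.le hρ1).mul_right _)
    intro k
    rw [norm_smul, Real.norm_of_nonneg (by positivity)]
    exact mul_le_mul_of_nonneg_left (hM _) (by positivity)
  have h0 : 0 ≤ (1 - ρ)⁻¹ * ∑ i, ‖d i‖ := 
    mul_nonneg (inv_nonneg.mpr (by linarith)) (Finset.sum_nonneg fun _ _ => norm_nonneg _)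
  refine ⟨2 * ((1 - ρ)⁻¹ * ∑ i, ‖d i‖) + 1, by linarith, fun w w' => ?_⟩
  linarith [norm_sub_le (pt ρ d w) (pt ρ d w'), hb w, hb w']

lemma pt_split {ι : Type*} [Fintype ι] (ρ : ℝ) (hρ : 0 < ρ) (hρ1 : ρ < 1) (d : ι → ℂ) (L : ℕ) (w : ℕ → ι) :
    pt ρ d w = fs ρ d L (fun i => w i) + ρ ^ L • pt ρ d (fun k => w (k + L)) := by
  rw [pt, ← (pt_summable ρ hρ hρ1 d w).sum_add_tsum_nat_add L, fs,
    Fin.sum_univ_eq_sum_range (fun k => ρ ^ k • d (w k))]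
  congr 1
  rw [pt, ← tsum_const_smul'']
  congr 1; funext k
  rw [smul_smul]; congr 1; ring

lemma tree_of_rate {ι : Type*} [Fintype ι] (ρ : ℝ) (hρ : 0 < ρ) (hρ1 : ρ < 1) (d : ι → ℂ) (a : ℂ)
    (ha : ∀ w, pt ρ d w ≠ a) (D : ℝ) (hD0 : 0 < D) (hD : ∀ w w' : ℕ → ι, ‖pt ρ d w - pt ρ d w'‖ ≤ D) (σ : ℝ)
    (v : ℕ → ι) (n : ℕ) (hn : 0 < n) (W : Finset (Fin n → ι))
    (hW : ∀ x ∈ W, ∀ y ∈ W, x ≠ y → (D + 1) * ρ ^ n ≤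
      |cdet (radialProj a (pt ρ d v)) (fs ρ d n x) - cdet (radialProj a (pt ρ d v)) (fs ρ d n y)|)
    (hcard : 1 ≤ W.card * (ρ ^ n) ^ σ) : DTree (radialProj a '' range (pt ρ d)) ρ σ := by
  classical
  set X := pt ρ d v with hX
  set r := ‖X - a‖ with hr
  have hr0 : 0 < r := norm_pos_iff.mpr (sub_ne_zero.mpr (ha v))
  set θ := radialProj a X with hθ
  have hθr : X - a = r • θ := by
    rw [hθ, radialProj, smul_smul, ← hr, mul_inv_cancel₀ hr0.ne', one_smul]
  have hθ1 : ‖θ‖ = 1 := by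
    rw [hθ, radialProj, norm_smul, norm_inv, norm_norm]; exact inv_mul_cancel₀ hr0.ne'
  obtain ⟨m, hm⟩ := exists_pow_lt_of_lt_one (show 0 < r * ρ ^ n / (2 * D ^ 2) by positivity) hρ1
  have hm' : ρ ^ m * D * D ≤ r * ρ ^ n / 2 := by
    rw [lt_div_iff₀ (by positivity)] at hm
    linarith
  have hWpos : 0 < W.card := by
    by_contra h
    have : W.card = 0 := by omega
    rw [this] at hcard; norm_num at hcard
  let g : Fin W.card → (Fin n → ι) := fun i => (W.equivFin.symm i).1
  have hg : ∀ i, g i ∈ W := fun i => (W.equivFin.symm i).2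
  have hginj : Function.Injective g := fun i j h => W.equivFin.symm.injective (Subtype.ext h)
  let ζ : (ℕ → Fin W.card) → ℕ → ι := fun ω k => g (ω (k / n)) ⟨k % n, Nat.mod_lt _ hn⟩
  let x : (ℕ → Fin W.card) → ℕ → ι := fun ω k => if k < m then v k else ζ ω (k - m)
  have hx : ∀ ω, pt ρ d (x ω) = fs ρ d m (fun i => v i) + ρ ^ m • pt ρ d (ζ ω) := by
    intro ω
    rw [pt_split ρ hρ hρ1 d m (x ω)]
    congr 2
    · funext i; simp [x]
    · congr 1; funext k; simp [x]
  have hζ1 : ∀ ω, pt ρ d (ζ ω) = fs ρ d n (g (ω 0)) + ρ ^ n • pt ρ d (ζ fun k => ω (k + 1)) := by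
    intro ω
    rw [pt_split ρ hρ hρ1 d n (ζ ω)]
    congr 2
    · funext i; simp [ζ, Nat.div_eq_of_lt i.2, Nat.mod_eq_of_lt i.2]
    · congr 1; funext k; simp [ζ, Nat.add_div_right _ hn]
  clear_value x ζ g
  have hζj : ∀ j (ω ω' : ℕ → Fin W.card), (∀ i < j, ω i = ω' i) →
      pt ρ d (ζ ω) - pt ρ d (ζ ω') = (ρ ^ n) ^ j • (pt ρ d (ζ fun k => ω (k + j)) - pt ρ d (ζ fun k => ω' (k + j))) := by
    intro j
    induction j with
    | zero => intro ω ω' _; simp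
    | succ j ih =>
      intro ω ω' h
      rw [hζ1 ω, hζ1 ω', h 0 (by omega), add_sub_add_left_eq_sub, ← smul_sub,
        ih (fun k => ω (k + 1)) (fun k => ω' (k + 1)) (fun i hi => h (i + 1) (by omega)), smul_smul, pow_succ' (ρ ^ n) j]
      rfl
  refine ⟨W.card, n, ρ ^ m * (r * ρ ^ n / 2) / ((r + D) * (r + D)), fun ω => radialProj a (pt ρ d (x ω)), hWpos, hn, by positivity, hcard, ?_, ?_⟩
  · intro ω
    refine ⟨⟨_, ⟨_, rfl⟩, rfl⟩, ?_⟩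
    have := norm_pos_iff.mpr (sub_ne_zero.mpr (ha (x ω)))
    show ‖radialProj a (pt ρ d (x ω))‖ = 1
    rw [radialProj, norm_smul, norm_inv, norm_norm]; exact inv_mul_cancel₀ this.ne'
  · intro ω ω' j hpre hj
    set Y := pt ρ d (x ω) with hY
    set Y' := pt ρ d (x ω') with hY'
    set p := pt ρ d (ζ ω) with hp
    set p' := pt ρ d (ζ ω') with hp'
    have hYa : 0 < ‖Y - a‖ := norm_pos_iff.mpr (sub_ne_zero.mpr (ha _))
    have hYa' : 0 < ‖Y' - a‖ := norm_pos_iff.mpr (sub_ne_zero.mpr (ha _))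
    have hYX : ‖Y - X‖ ≤ ρ ^ m * D := by
      rw [hY, hX, hx, pt_split ρ hρ hρ1 d m v, add_sub_add_left_eq_sub, ← smul_sub, norm_smul, Real.norm_of_nonneg (by positivity)]
      exact mul_le_mul_of_nonneg_left (hD _ _) (by positivity)
    have hpp := hζj j ω ω' hpre
    rw [← hp, ← hp'] at hpp
    have hn1 : ‖p - p'‖ ≤ (ρ ^ n) ^ j * D := by
      rw [hpp, norm_smul, Real.norm_of_nonneg (by positivity)]
      exact mul_le_mul_of_nonneg_left (hD _ _) (by positivity)
    have hn2 : (ρ ^ n) ^ j * ρ ^ n ≤ |cdet θ (p - p')| := by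
      rw [hpp, cdet_smul, abs_mul, abs_of_pos (by positivity : 0 < (ρ ^ n) ^ j)]
      apply mul_le_mul_of_nonneg_left _ (by positivity)
      rw [hζ1 (fun k => ω (k + j)), hζ1 (fun k => ω' (k + j))]
      simp only [zero_add]
      set q1 := pt ρ d (ζ fun k => ω (k + 1 + j))
      set q2 := pt ρ d (ζ fun k => ω' (k + 1 + j))
      have e : cdet θ (fs ρ d n (g (ω j)) + ρ ^ n • q1 - (fs ρ d n (g (ω' j)) + ρ ^ n • q2)) =
          (cdet θ (fs ρ d n (g (ω j))) - cdet θ (fs ρ d n (g (ω' j)))) + ρ ^ n * cdet θ (q1 - q2) := by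
        simp only [cdet_sub, cdet_add, cdet_smul]; ring
      rw [e]
      have h1 := hW _ (hg (ω j)) _ (hg (ω' j)) (fun h => hj (hginj h))
      have h2 : |ρ ^ n * cdet θ (q1 - q2)| ≤ ρ ^ n * D := by
        rw [abs_mul, abs_of_pos (by positivity : 0 < ρ ^ n)]
        apply mul_le_mul_of_nonneg_left _ (by positivity)
        refine (abs_cdet_le _ _).trans ?_
        rw [hθ1, one_mul]; exact hD _ _
      have h3 := abs_sub_abs_le_abs_sub (cdet θ (fs ρ d n (g (ω j))) - cdet θ (fs ρ d n (g (ω' j)))) (-(ρ ^ n * cdet θ (q1 - q2)))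
      rw [abs_neg, sub_neg_eq_add] at h3
      linarith
    have hYY : Y - Y' = ρ ^ m • (p - p') := by
      rw [hY, hY', hx, hx, add_sub_add_left_eq_sub, ← smul_sub]
    have hdet : cdet (Y - a) (Y' - a) = - (ρ ^ m * cdet (Y - a) (p - p')) := by
      have : Y' - a = (Y - a) - ρ ^ m • (p - p') := by rw [← hYY]; ring
      rw [this, cdet_sub, cdet_self, cdet_smul]; ring
    have hlow : (ρ ^ n) ^ j * (r * ρ ^ n / 2) ≤ |cdet (Y - a) (p - p')| := by
      have e : cdet (Y - a) (p - p') = r * cdet θ (p - p') + cdet (Y - X) (p - p') := by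
        have : Y - X = (Y - a) - (X - a) := by ring
        rw [this, cdet_sub_left (Y - a), hθr, cdet_smul_left]; ring
      have h1 : |cdet (Y - X) (p - p')| ≤ (ρ ^ m * D) * ((ρ ^ n) ^ j * D) :=
        (abs_cdet_le _ _).trans (mul_le_mul hYX hn1 (norm_nonneg _) (by positivity))
      have h3 := abs_sub_abs_le_abs_sub (r * cdet θ (p - p')) (-(cdet (Y - X) (p - p')))
      rw [abs_neg, sub_neg_eq_add, ← e, abs_mul, abs_of_pos hr0] at h3
      have h4 := mul_le_mul_of_nonneg_left hn2 hr0.le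
      have h5 := mul_le_mul_of_nonneg_left hm' (by positivity : 0 ≤ (ρ ^ n) ^ j)
      linarith
    have hb : ∀ Z, (∃ w, Z = pt ρ d w) → ‖Z - a‖ ≤ r + D := by
      rintro Z ⟨w, rfl⟩
      have := norm_add_le (X - a) (pt ρ d w - X)
      have e : X - a + (pt ρ d w - X) = pt ρ d w - a := by ring
      rw [e] at this
      linarith [hD w v]
    show _ ≤ |cdet (‖Y - a‖⁻¹ • (Y - a)) (‖Y' - a‖⁻¹ • (Y' - a))|
    rw [cdet_smul, cdet_smul_left, hdet, abs_mul, abs_mul, abs_neg, abs_mul,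
      abs_of_pos (inv_pos.mpr hYa), abs_of_pos (inv_pos.mpr hYa'), abs_of_pos (by positivity : 0 < ρ ^ m)]
    have hi : ‖Y' - a‖⁻¹ * ‖Y - a‖⁻¹ ≥ ((r + D) * (r + D))⁻¹ := by
      rw [← mul_inv]
      apply inv_anti₀ (by positivity)
      exact mul_le_mul (hb _ ⟨_, rfl⟩) (hb _ ⟨_, rfl⟩) hYa.le (by positivity)
    calc ρ ^ m * (r * ρ ^ n / 2) / ((r + D) * (r + D)) * (ρ ^ n) ^ j
        = ((r + D) * (r + D))⁻¹ * (ρ ^ m * ((ρ ^ n) ^ j * (r * ρ ^ n / 2))) := by ring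
      _ ≤ (‖Y' - a‖⁻¹ * ‖Y - a‖⁻¹) * (ρ ^ m * |cdet (Y - a) (p - p')|) := by
          apply mul_le_mul hi _ (by positivity) (by positivity)
          exact mul_le_mul_of_nonneg_left hlow (by positivity)
      _ = _ := by ring

lemma rate_gap (y : ℝ) (hy : 0 < y) (hy1 : y < 1) (k u : ℝ) (h : 1 < k * y ^ u) :
    ∃ σ, u < σ ∧ 1 ≤ k * y ^ σ := by
  have hk : 0 < k := by
    by_contra hk
    have := mul_nonpos_of_nonpos_of_nonneg (not_lt.mp hk) (Real.rpow_pos_of_pos hy u).le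
    linarith
  have hl : Real.log y < 0 := Real.log_neg hy hy1
  have e : k * y ^ (-(Real.log k) / Real.log y) = 1 := by
    rw [Real.rpow_def_of_pos hy, mul_div_cancel₀ _ hl.ne, Real.exp_neg, Real.exp_log hk, mul_inv_cancel₀ hk.ne']
  refine ⟨-(Real.log k) / Real.log y, ?_, e.ge⟩
  by_contra hcon
  have := Real.rpow_le_rpow_of_exponent_ge hy hy1.le (not_lt.mp hcon)
  have := mul_le_mul_of_nonneg_left this hk.le
  linarith

lemma core {κ : Type*} [Fintype κ] [Nonempty κ] (A : Fin 3 → ℂ) (b : κ → ℂ) (ρ : ℝ) (hρ : 0 < ρ) (hρ1 : ρ < 1)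
    (hA : cdet (A 1 - A 0) (A 2 - A 0) ≠ 0) (t : ℝ) (ht1 : t ≤ 1) (hκ : 1 ≤ Fintype.card κ * ρ ^ t)
    (c : ℝ) (hc : 0 < c) (d : Fin 3 × κ → ℂ) (hd : ∀ i, d i = A i.1 + b i.2)
    (hsep : ∀ w w' : ℕ → Fin 3 × κ, w 0 ≠ w' 0 → c ≤ ‖pt ρ d w - pt ρ d w'‖)
    (a : ℂ) (ha : ∀ w, pt ρ d w ≠ a) (u0 : ℝ) (hu0 : u0 < t) :
    ENNReal.ofReal u0 ≤ dimH (radialProj a '' range (pt ρ d)) := by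
  classical
  obtain ⟨D, hD0, hD⟩ := pt_bdd ρ hρ hρ1 d
  set E := radialProj a '' range (pt ρ d) with hE
  have i0 : κ := Classical.arbitrary κ
  have hdf : d = fun i : Fin 3 × κ => A i.1 + b i.2 := funext hd
  have hY : ∀ (L : ℕ) (v v' : Fin L → κ) (k : Fin L), (∀ i < k, v i = v' i) → v k ≠ v' k →
      c * ρ ^ (k : ℕ) ≤ ‖fs ρ b L v - fs ρ b L v'‖ := by
    intro L v v' k hpre hk
    obtain ⟨ext, hext⟩ : ∃ ext : (Fin L → κ) → ℕ → Fin 3 × κ, ∀ v m, ext v m = (0, if h : m < L then v ⟨m, h⟩ else i0) :=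
      ⟨fun v m => (0, if h : m < L then v ⟨m, h⟩ else i0), fun _ _ => rfl⟩
    have h1 : ∀ v, pt ρ d (ext v) = fs ρ d L (fun i => (0, v i)) + ρ ^ L • pt ρ d (fun _ => (0, i0)) := by
      intro v
      rw [pt_split ρ hρ hρ1 d L]
      congr 2
      · funext i; simp [hext]
      · congr 1; funext m; simp [hext]
    have h2 : fs ρ b L v - fs ρ b L v' = pt ρ d (ext v) - pt ρ d (ext v') := by
      rw [h1, h1, add_sub_add_right_eq_sub, fs, fs, fs, fs, ← Finset.sum_sub_distrib, ← Finset.sum_sub_distrib]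
      refine Finset.sum_congr rfl fun i _ => ?_
      rw [hd, hd, ← smul_sub, ← smul_sub, add_sub_add_left_eq_sub]
    have h3 : pt ρ d (ext v) - pt ρ d (ext v') = ρ ^ (k : ℕ) • (pt ρ d (fun m => ext v (m + k)) - pt ρ d (fun m => ext v' (m + k))) := by
      rw [pt_split ρ hρ hρ1 d k (ext v), pt_split ρ hρ hρ1 d k (ext v')]
      have : (fun i : Fin k => ext v i) = fun i : Fin k => ext v' i := by
        funext i
        rw [hext, hext]
        have hi : (i : ℕ) < L := i.2.trans k.2
        rw [dif_pos hi, dif_pos hi, hpre ⟨i, hi⟩ i.2]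
      rw [this, add_sub_add_left_eq_sub, ← smul_sub]
    rw [h2, h3, norm_smul, Real.norm_of_nonneg (by positivity), mul_comm]
    apply mul_le_mul_of_nonneg_left _ (by positivity)
    apply hsep
    simp [hext, hk]
  have hunit : ∀ w, ‖radialProj a (pt ρ d w)‖ = 1 := by
    intro w
    have := norm_pos_iff.mpr (sub_ne_zero.mpr (ha w))
    rw [radialProj, norm_smul, norm_inv, norm_norm]; exact inv_mul_cancel₀ this.ne'
  -- starting rate
  have hstart : ∃ σ, 0 < σ ∧ DTree E ρ σ := by
    set v : ℕ → Fin 3 × κ := fun _ => (0, i0) with hv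
    set θ := radialProj a (pt ρ d v) with hθ
    obtain ⟨j, hj⟩ : ∃ j : Fin 3, cdet θ (A j - A 0) ≠ 0 := by
      by_contra hcon
      push Not at hcon
      have h := plucker (A 1 - A 0) (A 2 - A 0) θ
      rw [hcon 1, hcon 2, zero_smul, zero_smul, sub_zero, smul_eq_zero] at h
      rcases h with h | h
      · exact hA h
      · have := hunit v
        rw [← hθ, h, norm_zero] at this
        norm_num at this
    have hq : 0 < |cdet θ (A j - A 0)| := abs_pos.mpr hj
    obtain ⟨n, hn⟩ := exists_pow_lt_of_lt_one (show 0 < |cdet θ (A j - A 0)| / (D + 1) by positivity) hρ1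
    have hn' : (D + 1) * ρ ^ (n + 1) ≤ |cdet θ (A j - A 0)| := by
      rw [lt_div_iff₀ (by positivity)] at hn
      have : ρ ^ (n + 1) ≤ ρ ^ n := pow_le_pow_of_le_one hρ.le hρ1.le (by omega)
      nlinarith
    set x0 : Fin (n + 1) → Fin 3 × κ := fun _ => (0, i0) with hx0
    set x1 : Fin (n + 1) → Fin 3 × κ := fun k => if k = 0 then (j, i0) else (0, i0) with hx1
    have hj0 : j ≠ 0 := by rintro rfl; simp [cdet] at hj
    have hne : x0 ≠ x1 := by
      intro h
      have := congrFun h 0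
      simp [hx0, hx1] at this
      exact hj0 this.symm
    have hdiff : cdet θ (fs ρ d (n + 1) x1) - cdet θ (fs ρ d (n + 1) x0) = cdet θ (A j - A 0) := by
      rw [← cdet_sub]
      congr 1
      rw [fs, fs, ← Finset.sum_sub_distrib, Fin.sum_univ_succ, Finset.sum_eq_zero]
      · simp [hx0, hx1, hd]
      · intro i _; simp [hx0, hx1]
    obtain ⟨σ, hσ, hσ'⟩ := rate_gap (ρ ^ (n + 1)) (by positivity) (pow_lt_one₀ hρ.le hρ1 (by omega)) 2 0 (by norm_num)
    refine ⟨σ, hσ, tree_of_rate ρ hρ hρ1 d a ha D hD0 hD σ v (n + 1) (by omega) {x0, x1} ?_ ?_⟩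
    · intro x hx y hy hxy
      rw [← hθ]
      simp only [Finset.mem_insert, Finset.mem_singleton] at hx hy
      rcases hx with rfl | rfl <;> rcases hy with rfl | rfl
      · exact absurd rfl hxy
      · rw [abs_sub_comm, hdiff]; exact hn'
      · rw [hdiff]; exact hn'
      · exact absurd rfl hxy
    · rw [Finset.card_pair hne]; exact_mod_cast hσ'
  by_contra hcon
  set S := {σ : ℝ | 0 < σ ∧ DTree E ρ σ} with hS
  have hSb : ∀ σ ∈ S, σ ≤ u0 := by
    rintro σ ⟨h1, h2⟩
    by_contra h
    apply hcon
    exact (ENNReal.ofReal_le_ofReal (not_le.mp h).le).trans (dimH_of_tree E ρ σ hρ hρ1 h1 h2)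
  obtain ⟨σ0, hσ0, hσ0t⟩ := hstart
  have hSne : S.Nonempty := ⟨σ0, hσ0, hσ0t⟩
  have hSbdd : BddAbove S := ⟨u0, hSb⟩
  set u := sSup S with hu
  have hu1 : 0 < u := lt_of_lt_of_le hσ0 (le_csSup hSbdd ⟨hσ0, hσ0t⟩)
  have hu2 : u ≤ u0 := csSup_le hSne hSb
  obtain ⟨γ, hγ, hγu, himp⟩ := improve A b ρ hρ hρ1 hA t ht1 hκ c hc hY E u hu1 (by linarith)
  obtain ⟨σ, hσS, hσ⟩ := exists_lt_of_lt_csSup hSne (show u - γ < sSup S by linarith)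
  obtain ⟨θ, hθE, -, L, hL, W, hW, hWc⟩ := himp σ hσ (le_csSup hSbdd hσS) hσS.2 (2 * (D + 1)) (by linarith)
  obtain ⟨_, ⟨v, rfl⟩, rfl⟩ := hθE
  obtain ⟨σ', hσ', hσ'c⟩ := rate_gap (ρ ^ L) (by positivity) (pow_lt_one₀ hρ.le hρ1 hL.ne') _ u hWc
  have ht' := tree_of_rate ρ hρ hρ1 d a ha D hD0 hD σ' v L hL W (by
    intro x hx y hy hxy
    have := hW x hx y hy hxy
    rw [← hdf] at this
    have e : 2 * (D + 1) / 2 = D + 1 := by ring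
    rwa [e] at this) hσ'c
  have := le_csSup hSbdd (show σ' ∈ S from ⟨by linarith, ht'⟩)
  linarith


noncomputable def cr {s : ℕ} (lam : Fin s → ℝ) (w : List (Fin s)) : ℝ := (w.map lam).prod

noncomputable def cz {s : ℕ} (lam : Fin s → ℝ) (z : Fin s → ℂ) : List (Fin s) → ℂ
  | [] => 0
  | i :: w => lam i • cz lam z w + z i

noncomputable def Tw {s : ℕ} (lam : Fin s → ℝ) (z : Fin s → ℂ) (w : List (Fin s)) (x : ℂ) : ℂ := cr lam w • x + cz lam z w

lemma Tw_cons {s : ℕ} (lam : Fin s → ℝ) (z : Fin s → ℂ) (i : Fin s) (w : List (Fin s)) (x : ℂ) :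
    Tw lam z (i :: w) x = lam i • Tw lam z w x + z i := by
  simp only [Tw, cr, cz, List.map_cons, List.prod_cons, smul_add, smul_smul, add_assoc]

lemma cr_append {s : ℕ} (lam : Fin s → ℝ) (w w' : List (Fin s)) : cr lam (w ++ w') = cr lam w * cr lam w' := by
  simp [cr]

lemma Tw_append {s : ℕ} (lam : Fin s → ℝ) (z : Fin s → ℂ) (w w' : List (Fin s)) (x : ℂ) :
    Tw lam z (w ++ w') x = Tw lam z w (Tw lam z w' x) := by
  induction w with
  | nil => simp [Tw, cr, cz]
  | cons i w ih => rw [List.cons_append, Tw_cons, ih, Tw_cons]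

lemma cz_eq {s : ℕ} (lam : Fin s → ℝ) (z : Fin s → ℂ) (w : List (Fin s)) : cz lam z w = Tw lam z w 0 := by simp [Tw]

lemma cz_append {s : ℕ} (lam : Fin s → ℝ) (z : Fin s → ℂ) (w w' : List (Fin s)) :
    cz lam z (w ++ w') = cz lam z w + cr lam w • cz lam z w' := by
  rw [cz_eq lam z (w ++ w'), Tw_append, ← cz_eq, Tw, add_comm]

section words
variable {s : ℕ} {T : Fin s → ℂ → ℂ} {lam : Fin s → ℝ} {z : Fin s → ℂ}
    (hlam : ∀ i, 0 < lam i ∧ lam i < 1) (hT : ∀ i x, T i x = lam i • x + z i) {J : Set ℂ}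
    (hself : J = ⋃ i, T i '' J)

lemma cr_pos (hlam : ∀ i, 0 < lam i ∧ lam i < 1) (w : List (Fin s)) : 0 < cr lam w := by
  induction w with
  | nil => simp [cr]
  | cons i w ih => 
    have : cr lam (i :: w) = lam i * cr lam w := by simp [cr]
    rw [this]; exact mul_pos (hlam i).1 ih

lemma cr_le (hlam : ∀ i, 0 < lam i ∧ lam i < 1) (r : ℝ) (hr : ∀ i, lam i ≤ r) (w : List (Fin s)) : cr lam w ≤ r ^ w.length := by
  induction w with
  | nil => simp [cr]
  | cons i w ih =>
    have : cr lam (i :: w) = lam i * cr lam w := by simp [cr]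
    rw [this, List.length_cons, pow_succ']
    exact mul_le_mul (hr i) ih (cr_pos hlam w).le ((hlam i).1.le.trans (hr i))

lemma T_mem (hself : J = ⋃ i, T i '' J) (i : Fin s) {x : ℂ} (hx : x ∈ J) : T i x ∈ J := by
  rw [hself]; exact mem_iUnion.mpr ⟨i, x, hx, rfl⟩

lemma Tw_mem (hT : ∀ i x, T i x = lam i • x + z i) (hself : J = ⋃ i, T i '' J) (w : List (Fin s)) {x : ℂ} (hx : x ∈ J) :
    Tw lam z w x ∈ J := by
  induction w with
  | nil => simpa [Tw, cr, cz] using hx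
  | cons i w ih => rw [Tw_cons, ← hT]; exact T_mem hself i ih

lemma Tw_cover (hT : ∀ i x, T i x = lam i • x + z i) (hself : J = ⋃ i, T i '' J) (n : ℕ) :
    ∀ x ∈ J, ∃ w : Fin n → Fin s, x ∈ Tw lam z (List.ofFn w) '' J := by
  induction n with
  | zero => intro x hx; exact ⟨Fin.elim0, x, hx, by simp [Tw, cr, cz]⟩
  | succ n ih =>
    intro x hx
    rw [hself] at hx
    obtain ⟨i, y, hy, rfl⟩ := mem_iUnion.mp hx
    obtain ⟨w, y', hy', rfl⟩ := ih y hy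
    refine ⟨Fin.cons i w, y', hy', ?_⟩
    rw [List.ofFn_cons, Tw_cons, hT]

lemma Tw_disj (hlam : ∀ i, 0 < lam i ∧ lam i < 1) (hT : ∀ i x, T i x = lam i • x + z i) (hself : J = ⋃ i, T i '' J)
    (hSSC : ∀ i j, i ≠ j → Disjoint (T i '' J) (T j '' J)) (w : List (Fin s)) :
    ∀ w' : List (Fin s), w.length = w'.length → w ≠ w' → Disjoint (Tw lam z w '' J) (Tw lam z w' '' J) := by
  induction w with
  | nil => intro w' h hne; exact absurd (List.length_eq_zero_iff.mp h.symm).symm hne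
  | cons i w ih =>
    intro w' h hne
    cases w' with
    | nil => simp at h
    | cons j w' =>
      rw [Set.disjoint_left]
      rintro _ ⟨x, hx, rfl⟩ ⟨y, hy, hxy⟩
      rw [Tw_cons, Tw_cons, ← hT, ← hT] at hxy
      by_cases hij : i = j
      · subst hij
        have hww : w ≠ w' := fun h => hne (by rw [h])
        rw [hT, hT, add_left_inj] at hxy
        have := smul_right_injective ℂ (hlam i).1.ne' hxy
        exact Set.disjoint_left.mp (ih w' (by simpa using h) hww) ⟨x, hx, rfl⟩ ⟨y, hy, this⟩
      · exact Set.disjoint_left.mp (hSSC i j hij) ⟨_, Tw_mem hT hself w hx, rfl⟩ ⟨_, Tw_mem hT hself w' hy, hxy⟩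

lemma Tw_dist (hlam : ∀ i, 0 < lam i ∧ lam i < 1) (w : List (Fin s)) (x y : ℂ) :
    ‖Tw lam z w x - Tw lam z w y‖ = cr lam w * ‖x - y‖ := by
  rw [Tw, Tw, add_sub_add_right_eq_sub, ← smul_sub, norm_smul, Real.norm_of_nonneg (cr_pos hlam w).le]

lemma exists_ratio (hlam : ∀ i, 0 < lam i ∧ lam i < 1) : ∃ r : ℝ, 0 < r ∧ r < 1 ∧ ∀ i, lam i ≤ r := by
  rcases isEmpty_or_nonempty (Fin s) with h | h
  · exact ⟨1 / 2, by norm_num, by norm_num, fun i => h.elim i⟩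
  · obtain ⟨i, hi⟩ := Finite.exists_max lam
    exact ⟨lam i, (hlam i).1, (hlam i).2, hi⟩

lemma sum_gt_one (hlam : ∀ i, 0 < lam i ∧ lam i < 1) (hT : ∀ i x, T i x = lam i • x + z i) (hself : J = ⋃ i, T i '' J)
    (hJc : IsCompact J) (t : NNReal) (ht : (t : ENNReal) < dimH J) : 1 < ∑ i, lam i ^ (t : ℝ) := by
  by_contra hcon
  rw [not_lt] at hcon
  apply absurd ht
  rw [not_lt]
  apply dimH_le_of_hausdorffMeasure_ne_top
  obtain ⟨r, hr0, hr1, hr⟩ := exists_ratio hlam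
  have hdiam : ediam J ≠ ⊤ := hJc.isBounded.ediam_ne_top
  have hd : ∀ w : List (Fin s), ediam (Tw lam z w '' J) ≤ ENNReal.ofReal (cr lam w) * ediam J := by
    intro w
    have : LipschitzWith (Real.toNNReal (cr lam w)) (Tw lam z w) := by
      apply LipschitzWith.of_dist_le_mul
      intro x y
      rw [dist_eq_norm, dist_eq_norm, Tw_dist hlam, Real.coe_toNNReal _ (cr_pos hlam w).le]
    exact this.ediam_image_le J
  have hlim : Filter.Tendsto (fun n : ℕ => ENNReal.ofReal (r ^ n) * ediam J) Filter.atTop (nhds 0) := by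
    have h1 := ENNReal.tendsto_ofReal (tendsto_pow_atTop_nhds_zero_of_lt_one hr0.le hr1)
    rw [ENNReal.ofReal_zero] at h1
    have := ENNReal.Tendsto.mul_const h1 (b := ediam J) (Or.inr hdiam)
    rwa [zero_mul] at this
  have hle := Measure.hausdorffMeasure_le_liminf_sum (X := ℂ) (t : ℝ) J (fun n : ℕ => ENNReal.ofReal (r ^ n) * ediam J) hlim
    (fun n (w : Fin n → Fin s) => Tw lam z (List.ofFn w) '' J)
    (Filter.Eventually.of_forall fun n w => (hd _).trans (by
      gcongr
      have := cr_le hlam r hr (List.ofFn w)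
      rwa [List.length_ofFn] at this))
    (Filter.Eventually.of_forall fun n x hx => by
      obtain ⟨w, hw⟩ := Tw_cover hT hself n x hx
      exact mem_iUnion.mpr ⟨w, hw⟩)
  have hfin : ∀ n : ℕ, ∑ w : Fin n → Fin s, ediam (Tw lam z (List.ofFn w) '' J) ^ (t : ℝ) ≤ ediam J ^ (t : ℝ) := by
    intro n
    have h1 : ∀ w : Fin n → Fin s, ediam (Tw lam z (List.ofFn w) '' J) ^ (t : ℝ) ≤
        ENNReal.ofReal (∏ k, lam (w k) ^ (t : ℝ)) * ediam J ^ (t : ℝ) := by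
      intro w
      refine (ENNReal.rpow_le_rpow (hd _) t.2).trans ?_
      rw [ENNReal.mul_rpow_of_nonneg _ _ t.2, ENNReal.ofReal_rpow_of_pos (cr_pos hlam _),
        Real.finset_prod_rpow _ _ (fun i _ => (hlam _).1.le), cr, List.map_ofFn, List.prod_ofFn]
      rfl
    refine (Finset.sum_le_sum fun w _ => h1 w).trans ?_
    rw [← Finset.sum_mul, ← ENNReal.ofReal_sum_of_nonneg (fun w _ => Finset.prod_nonneg fun i _ => Real.rpow_nonneg (hlam _).1.le _)]
    have e : ∑ w : Fin n → Fin s, ∏ k, lam (w k) ^ (t : ℝ) = (∑ i, lam i ^ (t : ℝ)) ^ n := by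
      rw [Fintype.sum_pow]
    rw [e]
    apply mul_le_of_le_one_left zero_le
    rw [ENNReal.ofReal_le_one]
    exact pow_le_one₀ (Finset.sum_nonneg fun i _ => Real.rpow_nonneg (hlam i).1.le _) hcon
  refine ne_top_of_le_ne_top (ENNReal.rpow_ne_top_of_nonneg t.2 hdiam) (hle.trans ?_)
  refine (Filter.liminf_le_liminf (Filter.Eventually.of_forall hfin)).trans ?_
  simp

end words


lemma cr_ofFn {s n : ℕ} (lam : Fin s → ℝ) (w : Fin n → Fin s) : cr lam (List.ofFn w) = ∏ k, lam (w k) := by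
  rw [cr, List.map_ofFn, List.prod_ofFn]; rfl

lemma pigeon {s : ℕ} (lam : Fin s → ℝ) (hlam : ∀ i, 0 < lam i ∧ lam i < 1) (t : ℝ)
    (hS : 1 < ∑ i, lam i ^ t) (q : ℝ) (hq : 0 < q) :
    ∃ (n : ℕ) (l : ℝ) (K : Finset (Fin n → Fin s)), 0 < l ∧ (∀ w ∈ K, cr lam (List.ofFn w) = l) ∧
      1 ≤ (K.card : ℝ) * (q * l) ^ t := by
  classical
  set S := ∑ i, lam i ^ t with hSdef
  have hlim := tendsto_pow_const_div_const_pow_of_one_lt s hS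
  have hlim2 := hlim.comp (Filter.tendsto_add_atTop_nat 1)
  have hqt : 0 < q ^ t / S := div_pos (Real.rpow_pos_of_pos hq t) (by linarith)
  obtain ⟨n, hn⟩ := (hlim2.eventually (gt_mem_nhds hqt)).exists
  simp only [Function.comp_apply] at hn
  have hn' : ((n + 1 : ℕ) : ℝ) ^ s < q ^ t * S ^ n := by
    rw [div_lt_iff₀ (by positivity)] at hn
    have : q ^ t / S * S ^ (n + 1) = q ^ t * S ^ n := by rw [pow_succ]; field_simp
    rwa [this] at hn
  let cnt : (Fin n → Fin s) → (Fin s → Fin (n + 1)) := fun w i =>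
    ⟨(Finset.univ.filter fun k => w k = i).card, Nat.lt_succ_of_le ((Finset.card_le_univ _).trans (by simp))⟩
  let ell : (Fin s → Fin (n + 1)) → ℝ := fun m => ∏ i, lam i ^ (m i : ℕ)
  have hell : ∀ m, 0 < ell m := fun m => Finset.prod_pos fun i _ => pow_pos (hlam i).1 _
  have hprod : ∀ w, ∏ k, lam (w k) = ell (cnt w) := by
    intro w
    rw [← Finset.prod_fiberwise (s := Finset.univ) (g := w)]
    refine Finset.prod_congr rfl fun i _ => ?_
    rw [Finset.prod_congr rfl (g := fun _ => lam i) (fun k hk => by rw [(Finset.mem_filter.mp hk).2])]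
    rw [Finset.prod_const]
  by_contra hcon
  push Not at hcon
  have hm : ∀ m, ((Finset.univ.filter fun w => cnt w = m).card : ℝ) * (q * ell m) ^ t < 1 := fun m =>
    hcon n (ell m) _ (hell m) (fun w hw => by rw [cr_ofFn, hprod, (Finset.mem_filter.mp hw).2])
  have e : S ^ n = ∑ m, ((Finset.univ.filter fun w => cnt w = m).card : ℝ) * (ell m) ^ t := by
    rw [hSdef, Fintype.sum_pow, ← Finset.sum_fiberwise (s := Finset.univ) (g := cnt)]
    refine Finset.sum_congr rfl fun m _ => ?_
    rw [Finset.sum_congr rfl (g := fun _ => ell m ^ t), Finset.sum_const, nsmul_eq_mul]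
    intro w hw
    rw [Real.finsetProd_rpow _ _ (fun i _ => (hlam _).1.le), hprod, (Finset.mem_filter.mp hw).2]
  have : q ^ t * S ^ n ≤ ((n + 1 : ℕ) : ℝ) ^ s := by
    rw [e, Finset.mul_sum]
    have : ∀ m ∈ (Finset.univ : Finset (Fin s → Fin (n+1))), q ^ t * (((Finset.univ.filter fun w => cnt w = m).card : ℝ) * (ell m) ^ t) ≤ 1 := by
      intro m _
      have := hm m
      rw [Real.mul_rpow hq.le (hell m).le] at this
      linarith
    refine (Finset.sum_le_sum this).trans ?_
    simp
  linarith

lemma three_points {s : ℕ} {T : Fin s → ℂ → ℂ} {lam : Fin s → ℝ} {z : Fin s → ℂ}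
    (hlam : ∀ i, 0 < lam i ∧ lam i < 1) (hT : ∀ i x, T i x = lam i • x + z i) {J : Set ℂ}
    (hself : J = ⋃ i, T i '' J) (hJc : IsCompact J) (hJne : J.Nonempty) (hline : ¬ Collinear ℝ J) :
    ∃ (p : Fin 3 → List (Fin s)) (N : ℕ) (q : ℝ), 0 < q ∧ q < 1 ∧ (∀ j, (p j).length = N) ∧ (∀ j, cr lam (p j) = q) ∧
      cdet (cz lam z (p 1) - cz lam z (p 0)) (cz lam z (p 2) - cz lam z (p 0)) ≠ 0 := by
  obtain ⟨x0, hx0⟩ := hJne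
  have h3 : ∃ x1 ∈ J, ∃ x2 ∈ J, cdet (x1 - x0) (x2 - x0) ≠ 0 := by
    by_contra hcon
    push Not at hcon
    apply hline
    rw [collinear_iff_of_mem hx0]
    by_cases hall : ∀ y ∈ J, y = x0
    · exact ⟨0, fun y hy => ⟨0, by simp [hall y hy]⟩⟩
    · push Not at hall
      obtain ⟨y, hy, hne⟩ := hall
      refine ⟨y - x0, fun w hw => ?_⟩
      have h := hcon y hy w hw
      have hn : Complex.normSq (y - x0) ≠ 0 := by simpa [sub_eq_zero] using hne
      refine ⟨((y - x0).re * (w - x0).re + (y - x0).im * (w - x0).im) / Complex.normSq (y - x0), ?_⟩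
      simp only [cdet] at h
      rw [Complex.normSq_apply] at hn ⊢
      simp only [Complex.sub_re, Complex.sub_im] at h hn ⊢
      apply Complex.ext
      · simp only [vadd_eq_add, Complex.add_re, Complex.smul_re, smul_eq_mul, Complex.sub_re]
        rw [div_mul_eq_mul_div, ← sub_eq_iff_eq_add, eq_div_iff hn]
        linear_combination (-(y.im - x0.im)) * h
      · simp only [vadd_eq_add, Complex.add_im, Complex.smul_im, smul_eq_mul, Complex.sub_im]
        rw [div_mul_eq_mul_div, ← sub_eq_iff_eq_add, eq_div_iff hn]
        linear_combination ((y.re - x0.re)) * h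
  obtain ⟨x1, hx1, x2, hx2, hdet⟩ := h3
  let F : ℂ × ℂ × ℂ → ℝ := fun y => cdet (y.2.1 - y.1) (y.2.2 - y.1)
  have hF : Continuous F := by
    simp only [F, cdet]; fun_prop
  have hopen : ∀ᶠ y in nhds ((x0, x1, x2) : ℂ × ℂ × ℂ), F y ≠ 0 := (hF.tendsto _).eventually_ne hdet
  obtain ⟨ε, hε, hball⟩ := Metric.eventually_nhds_iff.mp hopen
  obtain ⟨r, hr0, hr1, hr⟩ := exists_ratio hlam
  obtain ⟨D, hD⟩ := hJc.isBounded.exists_norm_le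
  have hlim : Filter.Tendsto (fun n : ℕ => r ^ n * (2 * D)) Filter.atTop (nhds 0) := by
    simpa using (tendsto_pow_atTop_nhds_zero_of_lt_one hr0.le hr1).mul_const (2 * D)
  obtain ⟨n, hn, hn1⟩ := ((hlim.eventually (gt_mem_nhds hε)).and (Filter.eventually_ge_atTop 1)).exists
  have hclose : ∀ (w : Fin n → Fin s) (x y : ℂ), x ∈ Tw lam z (List.ofFn w) '' J → y ∈ Tw lam z (List.ofFn w) '' J → dist y x < ε := by
    rintro w _ _ ⟨x, hx, rfl⟩ ⟨y, hy, rfl⟩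
    rw [dist_eq_norm, Tw_dist hlam]
    have h1 := cr_le hlam r hr (List.ofFn w)
    rw [List.length_ofFn] at h1
    have h2 : ‖y - x‖ ≤ 2 * D := (norm_sub_le _ _).trans (by linarith [hD x hx, hD y hy])
    exact (mul_le_mul h1 h2 (norm_nonneg _) (by positivity)).trans_lt hn
  obtain ⟨w0, hw0⟩ := Tw_cover hT hself n x0 hx0
  obtain ⟨w1, hw1⟩ := Tw_cover hT hself n x1 hx1
  obtain ⟨w2, hw2⟩ := Tw_cover hT hself n x2 hx2
  let v0 := List.ofFn w0
  let v1 := List.ofFn w1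
  let v2 := List.ofFn w2
  let p : Fin 3 → List (Fin s) := ![v0 ++ (v1 ++ v2), v1 ++ (v0 ++ v2), v2 ++ (v0 ++ v1)]
  have hq : ∀ j, cr lam (p j) = cr lam (p 0) := by
    intro j
    fin_cases j
    · rfl
    · simp [p, cr_append]; ring
    · simp [p, cr_append]; ring
  have hlen : ∀ j, (p j).length = n + (n + n) := by
    intro j
    fin_cases j <;> simp [p, v0, v1, v2]
  refine ⟨p, n + (n + n), cr lam (p 0), cr_pos hlam _, ?_, hlen, hq, ?_⟩
  · refine (cr_le hlam r hr (p 0)).trans_lt ?_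
    rw [hlen]
    exact pow_lt_one₀ hr0.le hr1 (by omega)
  · have hdiff : ∀ j, cz lam z (p j) - cz lam z (p 0) = Tw lam z (p j) x0 - Tw lam z (p 0) x0 := by
      intro j; rw [Tw, Tw, hq j]; ring
    rw [hdiff, hdiff]
    have := @hball (Tw lam z (p 0) x0, Tw lam z (p 1) x0, Tw lam z (p 2) x0) ?_
    · exact this
    · simp only [Prod.dist_eq, sup_lt_iff]
      refine ⟨hclose w0 _ _ hw0 ?_, hclose w1 _ _ hw1 ?_, hclose w2 _ _ hw2 ?_⟩
      · exact ⟨Tw lam z (v1 ++ v2) x0, Tw_mem hT hself _ hx0, by simp [p, Tw_append, v0]⟩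
      · exact ⟨Tw lam z (v0 ++ v2) x0, Tw_mem hT hself _ hx0, by simp [p, Tw_append, v1]⟩
      · exact ⟨Tw lam z (v0 ++ v1) x0, Tw_mem hT hself _ hx0, by simp [p, Tw_append, v2]⟩


lemma pt_mem {ι : Type*} [Fintype ι] (ρ : ℝ) (hρ : 0 < ρ) (hρ1 : ρ < 1) (d : ι → ℂ) {J : Set ℂ}
    (hJc : IsCompact J) (hJne : J.Nonempty) (h : ∀ i, ∀ x ∈ J, d i + ρ • x ∈ J) (w : ℕ → ι) : pt ρ d w ∈ J := by
  obtain ⟨x0, hx0⟩ := hJne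
  have hin : ∀ L : ℕ, ∀ x ∈ J, (∑ k ∈ Finset.range L, ρ ^ k • d (w k)) + ρ ^ L • x ∈ J := by
    intro L
    induction L with
    | zero => intro x hx; simpa using hx
    | succ L ih =>
      intro x hx
      have := ih _ (h (w L) x hx)
      rw [Finset.sum_range_succ, pow_succ, mul_smul, add_assoc, ← smul_add]
      exact this
  have h1 := (pt_summable ρ hρ hρ1 d w).hasSum.tendsto_sum_nat
  have h2 : Filter.Tendsto (fun n : ℕ => ρ ^ n • x0) Filter.atTop (nhds 0) := by
    simpa using (tendsto_pow_atTop_nhds_zero_of_lt_one hρ.le hρ1).smul_const x0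
  have h3 := h1.add h2
  rw [add_zero] at h3
  exact hJc.isClosed.mem_of_tendsto h3 (Filter.Eventually.of_forall fun n => hin n x0 hx0)

lemma pt_sep {ι : Type*} [Fintype ι] [Nonempty ι] (ρ : ℝ) (hρ : 0 < ρ) (hρ1 : ρ < 1) (d : ι → ℂ) {J : Set ℂ}
    (hJc : IsCompact J) (hJne : J.Nonempty) (h : ∀ i, ∀ x ∈ J, d i + ρ • x ∈ J)
    (hdisj : ∀ i j, i ≠ j → ∀ x ∈ J, ∀ y ∈ J, d i + ρ • x ≠ d j + ρ • y) :
    ∃ c : ℝ, 0 < c ∧ ∀ w w' : ℕ → ι, w 0 ≠ w' 0 → c ≤ ‖pt ρ d w - pt ρ d w'‖ := by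
  have hc : ∀ e : ι × ι, ∃ c : ℝ, 0 < c ∧ (e.1 ≠ e.2 → ∀ x ∈ J, ∀ y ∈ J, c ≤ ‖(d e.1 + ρ • x) - (d e.2 + ρ • y)‖) := by
    rintro ⟨i, j⟩
    by_cases hij : i = j
    · exact ⟨1, one_pos, fun h => absurd hij h⟩
    · obtain ⟨m, hm, hmin⟩ := (hJc.prod hJc).exists_isMinOn (hJne.prod hJne)
        (f := fun p : ℂ × ℂ => ‖(d i + ρ • p.1) - (d j + ρ • p.2)‖) (by fun_prop)
      refine ⟨_, norm_pos_iff.mpr (sub_ne_zero.mpr (hdisj i j hij m.1 hm.1 m.2 hm.2)), fun _ x hx y hy => ?_⟩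
      exact hmin (show (x, y) ∈ J ×ˢ J from ⟨hx, hy⟩)
  choose C hC0 hC using hc
  obtain ⟨e0, he0⟩ := Finite.exists_min C
  refine ⟨C e0, hC0 e0, fun w w' hne => ?_⟩
  have hs : ∀ w : ℕ → ι, pt ρ d w = d (w 0) + ρ • pt ρ d (fun k => w (k + 1)) := by
    intro w
    rw [pt_split ρ hρ hρ1 d 1 w]
    simp [fs]
  rw [hs w, hs w']
  exact (he0 (w 0, w' 0)).trans (hC (w 0, w' 0) hne _ (pt_mem ρ hρ hρ1 d hJc hJne h _) _ (pt_mem ρ hρ hρ1 d hJc hJne h _))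

lemma lower_bound {s : ℕ} {T : Fin s → ℂ → ℂ} {lam : Fin s → ℝ} {z : Fin s → ℂ}
    (hlam : ∀ i, 0 < lam i ∧ lam i < 1) (hT : ∀ i x, T i x = lam i • x + z i) {J : Set ℂ}
    (hJc : IsCompact J) (hJne : J.Nonempty) (hself : J = ⋃ i, T i '' J)
    (hSSC : ∀ i j, i ≠ j → Disjoint (T i '' J) (T j '' J)) (hline : ¬ Collinear ℝ J)
    (a : ℂ) (ha : a ∉ J) : min 1 (dimH J) ≤ dimH (radialProj a '' J) := by
  apply ENNReal.le_of_forall_nnreal_lt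
  intro r hr
  obtain ⟨t, hrt, ht⟩ := ENNReal.lt_iff_exists_nnreal_btwn.mp hr
  have ht1 : (t : ℝ) ≤ 1 := by
    have : (t : ENNReal) ≤ 1 := (ht.trans_le (min_le_left _ _)).le
    exact_mod_cast this
  have hrt' : (r : ℝ) < t := by exact_mod_cast hrt
  have hS := sum_gt_one hlam hT hself hJc t (ht.trans_le (min_le_right _ _))
  obtain ⟨p, N, q, hq0, hq1, hlen, hcr, hA⟩ := three_points hlam hT hself hJc hJne hline
  obtain ⟨n, l, K, hl, hK, hcard⟩ := pigeon lam hlam t hS q hq0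
  have hKne : K.Nonempty := by
    rw [Finset.nonempty_iff_ne_empty]
    rintro rfl
    simp at hcard
    linarith
  have : Nonempty K := hKne.to_subtype
  obtain ⟨w0, hw0⟩ := hKne
  obtain ⟨r0, hr0, hr01, hr0'⟩ := exists_ratio hlam
  have hl1 : l ≤ 1 := by
    rw [← hK w0 hw0]
    exact (cr_le hlam r0 hr0' _).trans (pow_le_one₀ hr0.le hr01.le)
  let wd : Fin 3 × K → List (Fin s) := fun i => p i.1 ++ List.ofFn i.2.1
  let d : Fin 3 × K → ℂ := fun i => cz lam z (wd i)
  have hTw : ∀ i x, d i + (q * l) • x = Tw lam z (wd i) x := by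
    intro i x
    rw [Tw, cr_append, hcr, hK _ i.2.2, add_comm]
  have hρ : 0 < q * l := mul_pos hq0 hl
  have hρ1 : q * l < 1 := by nlinarith
  have hin : ∀ i, ∀ x ∈ J, d i + (q * l) • x ∈ J := fun i x hx => by
    rw [hTw]; exact Tw_mem hT hself _ hx
  have hpinj : Function.Injective p := by
    intro i j hij
    have h01 : p 0 ≠ p 1 := fun h => hA (by rw [h]; simp [cdet])
    have h02 : p 0 ≠ p 2 := fun h => hA (by rw [h]; simp [cdet])
    have h12 : p 1 ≠ p 2 := fun h => hA (by rw [h]; simp only [cdet]; ring)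
    fin_cases i <;> fin_cases j <;> first | rfl | (exfalso; simp at hij; first | exact h01 hij | exact h02 hij | exact h12 hij | exact h01 hij.symm | exact h02 hij.symm | exact h12 hij.symm)
  have hwinj : Function.Injective wd := by
    rintro ⟨i, v⟩ ⟨j, v'⟩ hij
    obtain ⟨h1, h2⟩ := List.append_inj hij (by rw [hlen, hlen])
    exact Prod.ext (hpinj h1) (Subtype.ext (List.ofFn_injective h2))
  have hdisj : ∀ i j, i ≠ j → ∀ x ∈ J, ∀ y ∈ J, d i + (q * l) • x ≠ d j + (q * l) • y := by
    intro i j hij x hx y hy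
    rw [hTw, hTw]
    have := Tw_disj hlam hT hself hSSC (wd i) (wd j) (by simp [wd, hlen]) (fun h => hij (hwinj h))
    exact this.ne_of_mem ⟨x, hx, rfl⟩ ⟨y, hy, rfl⟩
  obtain ⟨c, hc, hsep⟩ := pt_sep (q * l) hρ hρ1 d hJc hJne hin hdisj
  have hmem := pt_mem (q * l) hρ hρ1 d hJc hJne hin
  have := core (fun j => cz lam z (p j)) (fun i : K => q • cz lam z (List.ofFn i.1)) (q * l) hρ hρ1 hA t ht1
    (by rw [Fintype.card_coe]; exact hcard) c hc d (fun i => by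
      show cz lam z (p i.1 ++ _) = _
      rw [cz_append, hcr]) hsep a (fun w h => ha (h ▸ hmem w)) r hrt'
  rw [ENNReal.ofReal_coe_nnreal] at this
  refine this.trans (dimH_mono (image_mono ?_))
  rintro _ ⟨w, rfl⟩
  exact hmem w

lemma upper_bound {J : Set ℂ} (hJc : IsCompact J) (hJne : J.Nonempty) (a : ℂ) (ha : a ∉ J) :
    dimH (radialProj a '' J) ≤ min 1 (dimH J) := by
  apply le_min
  · have h1 : radialProj a '' J ⊆ range (fun θ : ℝ => Complex.exp (θ * Complex.I)) := by
      rintro _ ⟨x, hx, rfl⟩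
      have hne : x - a ≠ 0 := sub_ne_zero.mpr (fun h => ha (h ▸ hx))
      refine ⟨Complex.arg (x - a), ?_⟩
      have := Complex.norm_mul_exp_arg_mul_I (x - a)
      show Complex.exp (Complex.arg (x - a) * Complex.I) = ‖x - a‖⁻¹ • (x - a)
      conv_rhs => rw [← this]
      have h0 : (‖x - a‖ : ℂ) ≠ 0 := by simpa using hne
      rw [Complex.real_smul, ← mul_assoc]
      simp only [norm_mul, Complex.norm_real, norm_norm, Complex.norm_exp_ofReal_mul_I, mul_one, Complex.ofReal_inv]
      rw [inv_mul_cancel₀ h0, one_mul]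
    refine (dimH_mono h1).trans ?_
    have hcd : ContDiff ℝ 1 (fun θ : ℝ => Complex.exp (θ * Complex.I)) := by
      have : ContDiff ℝ 1 (fun θ : ℝ => (θ : ℂ)) := Complex.ofRealCLM.contDiff
      exact (this.mul contDiff_const).cexp
    have := hcd.dimH_range_le
    simpa using this
  · obtain ⟨m, hm, hmin⟩ := hJc.exists_isMinOn hJne (f := fun x => ‖x - a‖) (by fun_prop)
    have hδ : 0 < ‖m - a‖ := norm_pos_iff.mpr (sub_ne_zero.mpr fun h => ha (h ▸ hm))
    have hL : LipschitzOnWith (Real.toNNReal (2 / ‖m - a‖)) (radialProj a) J := by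
      apply LipschitzOnWith.of_dist_le_mul
      intro x hx y hy
      have hx' : ‖m - a‖ ≤ ‖x - a‖ := hmin hx
      have hy' : ‖m - a‖ ≤ ‖y - a‖ := hmin hy
      have hxp : 0 < ‖x - a‖ := hδ.trans_le hx'
      have hyp : 0 < ‖y - a‖ := hδ.trans_le hy'
      rw [Real.coe_toNNReal _ (by positivity), dist_eq_norm, dist_eq_norm]
      have e : radialProj a x - radialProj a y = ‖x - a‖⁻¹ • (x - y) + (‖x - a‖⁻¹ * ‖y - a‖⁻¹ * (‖y - a‖ - ‖x - a‖)) • (y - a) := by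
        have : ‖x - a‖⁻¹ * ‖y - a‖⁻¹ * (‖y - a‖ - ‖x - a‖) = ‖x - a‖⁻¹ - ‖y - a‖⁻¹ := by
          field_simp
        rw [this, radialProj, radialProj, sub_smul]
        simp only [Complex.real_smul]
        ring
      rw [e]
      refine (norm_add_le _ _).trans ?_
      rw [norm_smul, norm_smul, norm_mul, norm_mul, norm_inv, norm_inv, norm_norm, norm_norm]
      have h3 : ‖(‖y - a‖ - ‖x - a‖)‖ ≤ ‖x - y‖ := by
        have := abs_norm_sub_norm_le (y - a) (x - a)
        rw [sub_sub_sub_cancel_right, norm_sub_rev y x] at this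
        exact this
      have h4 : ‖x - a‖⁻¹ ≤ ‖m - a‖⁻¹ := inv_anti₀ hδ hx'
      have h5 : ‖x - a‖⁻¹ * ‖y - a‖⁻¹ * ‖(‖y - a‖ - ‖x - a‖)‖ * ‖y - a‖ = ‖x - a‖⁻¹ * ‖(‖y - a‖ - ‖x - a‖)‖ := by
        field_simp
      rw [h5]
      have h6 := mul_le_mul h4 h3 (norm_nonneg _) (by positivity)
      have h7 := mul_le_mul_of_nonneg_right h4 (norm_nonneg (x - y))
      have h8 : 2 / ‖m - a‖ * ‖x - y‖ = ‖m - a‖⁻¹ * ‖x - y‖ + ‖m - a‖⁻¹ * ‖x - y‖ := by ring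
      rw [h8]
      exact add_le_add h7 h6
    exact hL.dimH_image_le

/-- For a self-similar set defined by homotheties satisfying the Strong Separation
Condition and not contained in a line, the radial projection from any point outside
the set has full Hausdorff dimension `min {1, dim_H 𝒥}`. -/
theorem stmt7 (s : ℕ) (T : Fin s → ℂ → ℂ) (lam : Fin s → ℝ) (z : Fin s → ℂ)
    (hlam : ∀ i, 0 < lam i ∧ lam i < 1)
    (hT : ∀ i x, T i x = lam i • x + z i)
    (J : Set ℂ) (hJc : IsCompact J) (hJne : J.Nonempty)
    (hself : J = ⋃ i, T i '' J)
    (hSSC : ∀ i j, i ≠ j → Disjoint (T i '' J) (T j '' J))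
    (hline : ¬ Collinear ℝ J)
    (a : ℂ) (ha : a ∉ J) :
    dimH (radialProj a '' J) = min 1 (dimH J) := by
  exact le_antisymm (upper_bound hJc hJne a ha) (lower_bound hlam hT hJc hJne hself hSSC hline a ha)
end

section
/- Let 𝒥 ⊆ ℝ² be a self-similar set of Hausdorff dimension α, 0 < α ≤ 1, satisfying the Open Set Condition and not contained in a line. Then there exist constants κ with 0 < κ ≤ α and C ≥ 1, independent of δ, such that for all 0 < δ ≤ 1, |𝒥^δ ∩ R| ≤ C r₁^κ r₂^{α−κ} |𝒥^δ| (two-dimensional Lebesgue measure) whenever R is a rectangle of dimensions r₁ × r₂ with δ ≤ r₁ ≤ r₂. -/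
open MeasureTheory Metric Set

/-- A rectangle with side lengths `r₂` (long side) and `r₁` (short side). -/
def IsRect (R : Set ℂ) (r₁ r₂ : ℝ) : Prop :=
  ∃ z w : ℂ, ‖w‖ = 1 ∧
    R = (fun p : ℝ × ℝ => z + p.1 • w + p.2 • (w * Complex.I)) '' (Icc 0 r₂ ×ˢ Icc 0 r₁)

/-- A strip of half-width `t`. -/
def IsStrip (t : ℝ) (S : Set ℂ) : Prop :=
  ∃ (u : ℂ) (c : ℝ), ‖u‖ = 1 ∧ S = {x | |inner ℝ u x - c| ≤ t}

open Classical in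
noncomputable def mN {s : ℕ} (T : Fin s → ℂ → ℂ) (J : Set ℂ) (p : Fin s → ℝ) : ℕ → Set ℂ → ℝ
  | 0, S => if (J ∩ S).Nonempty then 1 else 0
  | n + 1, S => ∑ i, p i * mN T J p n (T i ⁻¹' S)

theorem mN_nonneg {s : ℕ} (T : Fin s → ℂ → ℂ) (J : Set ℂ) (p : Fin s → ℝ) (hp : ∀ i, 0 ≤ p i)
    (n : ℕ) : ∀ S, 0 ≤ mN T J p n S := by
  induction n with
  | zero => intro S; simp only [mN]; split_ifs <;> norm_num
  | succ n ih => intro S; simp only [mN]; exact Finset.sum_nonneg fun i _ => mul_nonneg (hp i) (ih _)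

theorem mN_mono {s : ℕ} (T : Fin s → ℂ → ℂ) (J : Set ℂ) (p : Fin s → ℝ) (hp : ∀ i, 0 ≤ p i)
    (n : ℕ) : ∀ S S', S ⊆ S' → mN T J p n S ≤ mN T J p n S' := by
  induction n with
  | zero =>
    intro S S' h
    simp only [mN]
    by_cases h1 : (J ∩ S).Nonempty
    · have h2 : (J ∩ S').Nonempty := h1.mono (inter_subset_inter_right _ h)
      simp [h1, h2]
    · simp only [h1, if_false]; split_ifs <;> norm_num
  | succ n ih =>
    intro S S' h; simp only [mN]
    exact Finset.sum_le_sum fun i _ => mul_le_mul_of_nonneg_left (ih _ _ (preimage_mono h)) (hp i)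

theorem mN_succ_le {s : ℕ} (T : Fin s → ℂ → ℂ) (J : Set ℂ) (p : Fin s → ℝ) (hp : ∀ i, 0 ≤ p i)
    (hs : ∑ i, p i = 1) (hJ : ∀ i, T i '' J ⊆ J)
    (n : ℕ) : ∀ S, mN T J p (n+1) S ≤ mN T J p n S := by
  induction n with
  | zero =>
    intro S
    simp only [mN]
    by_cases h1 : (J ∩ S).Nonempty
    · simp only [h1, if_true]
      refine le_trans (Finset.sum_le_sum fun i _ => ?_) hs.le
      have := hp i
      split_ifs <;> linarith
    · have : ∀ i, ¬ (J ∩ T i ⁻¹' S).Nonempty := by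
        rintro i ⟨x, hx, hxS⟩
        exact h1 ⟨T i x, hJ i ⟨x, hx, rfl⟩, hxS⟩
      simp [h1, this]
  | succ n ih =>
    intro S
    rw [mN, mN]
    exact Finset.sum_le_sum fun i _ => mul_le_mul_of_nonneg_left (ih _) (hp i)

theorem mN_zero' {s : ℕ} (T : Fin s → ℂ → ℂ) (J : Set ℂ) (p : Fin s → ℝ)
    (hJ : ∀ i, T i '' J ⊆ J)
    (n : ℕ) : ∀ S, J ∩ S = ∅ → mN T J p n S = 0 := by
  induction n with
  | zero => intro S h; simp [mN, h]
  | succ n ih =>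
    intro S h
    rw [mN]
    refine Finset.sum_eq_zero fun i _ => ?_
    rw [ih, mul_zero]
    ext x
    simp only [mem_inter_iff, mem_preimage, mem_empty_iff_false, iff_false, not_and]
    intro hx hS
    have : T i x ∈ J ∩ S := ⟨hJ i ⟨x, hx, rfl⟩, hS⟩
    simp [h] at this

theorem mN_one {s : ℕ} (T : Fin s → ℂ → ℂ) (J : Set ℂ) (hne : J.Nonempty) (p : Fin s → ℝ)
    (hs : ∑ i, p i = 1) (hJ : ∀ i, T i '' J ⊆ J)
    (n : ℕ) : ∀ S, J ⊆ S → mN T J p n S = 1 := by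
  induction n with
  | zero => intro S h; simp [mN, inter_eq_left.2 h, hne]
  | succ n ih =>
    intro S h
    rw [mN, ← hs]
    refine Finset.sum_congr rfl fun i _ => ?_
    rw [ih, mul_one]
    exact fun x hx => h (hJ i ⟨x, hx, rfl⟩)

theorem existsM {s : ℕ} (T : Fin s → ℂ → ℂ) (J : Set ℂ) (hne : J.Nonempty) (p : Fin s → ℝ)
    (hp : ∀ i, 0 ≤ p i) (hs : ∑ i, p i = 1) (hJ : ∀ i, T i '' J ⊆ J) :
    ∃ M : Set ℂ → ℝ, (∀ S, 0 ≤ M S) ∧ (∀ S S', S ⊆ S' → M S ≤ M S') ∧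
      (∀ S, J ∩ S = ∅ → M S = 0) ∧ (∀ S, J ⊆ S → M S = 1) ∧
      (∀ S, M S = ∑ i, p i * M (T i ⁻¹' S)) := by
  have hlim : ∀ S, Filter.Tendsto (fun n => mN T J p n S) Filter.atTop
      (nhds (⨅ n, mN T J p n S)) := fun S =>
    tendsto_atTop_ciInf (antitone_nat_of_succ_le fun n => mN_succ_le T J p hp hs hJ n S)
      ⟨0, by rintro _ ⟨n, rfl⟩; exact mN_nonneg T J p hp n S⟩
  refine ⟨fun S => ⨅ n, mN T J p n S, ?_, ?_, ?_, ?_, ?_⟩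
  · exact fun S => le_ciInf fun n => mN_nonneg T J p hp n S
  · exact fun S S' h => le_of_tendsto_of_tendsto' (hlim S) (hlim S') fun n => mN_mono T J p hp n _ _ h
  · intro S h; simp [mN_zero' T J p hJ _ S h]
  · intro S h; simp [mN_one T J hne p hs hJ _ S h]
  · intro S
    have h1 := (hlim S).comp (Filter.tendsto_add_atTop_nat 1)
    refine tendsto_nhds_unique h1 ?_
    have : ((fun n => mN T J p n S) ∘ fun a => a + 1) =
        fun n => ∑ i, p i * mN T J p n (T i ⁻¹' S) := by
      ext n; simp [mN]
    rw [this]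
    exact tendsto_finsetSum _ fun i _ => (hlim _).const_mul _

/-- Stopping family at scale `r`. -/
structure Sys (J Op : Set ℂ) (M : Set ℂ → ℝ) (D Λ r : ℝ) where
  ι : Type
  fin : Fintype ι
  f : ι → ℂ → ℂ
  l : ι → ℝ
  lb : ∀ k, Λ * r ≤ l k
  lpos : ∀ k, 0 < l k
  ub : ∀ k, l k ≤ r
  hd : ∀ k x y, dist (f k x) (f k y) = l k * dist x y
  hsurj : ∀ k, Function.Surjective (f k)
  hstrip : ∀ k t S, IsStrip t S → IsStrip (t / l k) (f k ⁻¹' S)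
  hOp : ∀ k, f k '' Op ⊆ Op
  hJ : ∀ k, f k '' J ⊆ J
  hcov : ∀ x ∈ J, ∃ k, x ∈ f k '' J
  hM : ∀ S, M S = ∑ k, l k ^ D * M (f k ⁻¹' S)
  hdisj : ∀ k k', k ≠ k' → Disjoint (f k '' Op) (f k' '' Op)

theorem strip_pre (lam : ℝ) (h0 : 0 < lam) (rot : ℂ ≃ₗᵢ[ℝ] ℂ) (z : ℂ) (t : ℝ) (S : Set ℂ)
    (h : IsStrip t S) : IsStrip (t / lam) ((fun x => lam • rot x + z) ⁻¹' S) := by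
  obtain ⟨u, c, hu, rfl⟩ := h
  refine ⟨rot.symm u, (c - inner ℝ u z) / lam, by simpa using hu, ?_⟩
  ext x
  have e : inner ℝ (rot.symm u) x = inner ℝ u (rot x) := by
    rw [← rot.inner_map_map]; simp
  simp only [mem_preimage, mem_ofPred_eq]
  rw [inner_add_right, inner_smul_right, e, le_div_iff₀ h0]
  conv_rhs => rw [← abs_of_pos h0, ← abs_mul, abs_of_pos h0]
  have : (inner ℝ u (rot x) - (c - inner ℝ u z) / lam) * lam =
    lam * inner ℝ u (rot x) + inner ℝ u z - c := by field_simp; ring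
  rw [this]

noncomputable def Sys.one (J Op : Set ℂ) (M : Set ℂ → ℝ) (D Λ r : ℝ) (hr : r = 1) (hΛ : Λ ≤ 1) :
    Sys J Op M D Λ r where
  ι := Unit
  fin := inferInstance
  f := fun _ => id
  l := fun _ => 1
  lb := by simp [hr, hΛ]
  lpos := by simp
  ub := by simp [hr]
  hd := by simp
  hsurj := fun _ => Function.surjective_id
  hstrip := by simp
  hOp := by simp
  hJ := by simp
  hcov := by simp
  hM := by simp
  hdisj := by simp

noncomputable def Sys.step {s : ℕ} (T : Fin s → ℂ → ℂ) (lam : Fin s → ℝ)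
    (rot : Fin s → ℂ ≃ₗᵢ[ℝ] ℂ) (z : Fin s → ℂ)
    (hlam : ∀ i, 0 < lam i ∧ lam i < 1)
    (hT : ∀ i x, T i x = lam i • (rot i x) + z i)
    (J Op : Set ℂ) (hself : J = ⋃ i, T i '' J)
    (hOp : (⋃ i, T i '' Op) ⊆ Op)
    (hdis : ∀ i j, i ≠ j → Disjoint (T i '' Op) (T j '' Op))
    (M : Set ℂ → ℝ) (D Λ r : ℝ)
    (hMT : ∀ S, M S = ∑ i, lam i ^ D * M (T i ⁻¹' S))
    (r' : Fin s → ℝ) (Y : ∀ i, Sys J Op M D Λ (r' i))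
    (h1 : ∀ i k, Λ * r ≤ lam i * (Y i).l k) (h2 : ∀ i k, lam i * (Y i).l k ≤ r) :
    Sys J Op M D Λ r where
  ι := Σ i, (Y i).ι
  fin := by
    haveI := fun i => (Y i).fin
    infer_instance
  f := fun k => T k.1 ∘ (Y k.1).f k.2
  l := fun k => lam k.1 * (Y k.1).l k.2
  lb := fun k => h1 _ _
  lpos := fun k => mul_pos (hlam _).1 ((Y k.1).lpos _)
  ub := fun k => h2 _ _
  hd := by
    rintro ⟨i, k⟩ x y
    simp only [Function.comp, hT]
    rw [dist_add_right, dist_smul₀, (rot i).dist_map, (Y i).hd, Real.norm_of_nonneg (hlam i).1.le,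
      mul_assoc]
  hsurj := by
    rintro ⟨i, k⟩
    refine Function.Surjective.comp ?_ ((Y i).hsurj k)
    intro y
    obtain ⟨x, hx⟩ := (rot i).surjective ((lam i)⁻¹ • (y - z i))
    refine ⟨x, ?_⟩
    rw [hT, hx, smul_smul, mul_inv_cancel₀ (hlam i).1.ne', one_smul, sub_add_cancel]
  hstrip := by
    rintro ⟨i, k⟩ t S hS
    have h3 := strip_pre (lam i) (hlam i).1 (rot i) (z i) t S hS
    rw [← funext (hT i)] at h3
    have h4 := (Y i).hstrip k _ _ h3
    rw [div_div] at h4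
    exact h4
  hOp := by
    rintro ⟨i, k⟩ _ ⟨x, hx, rfl⟩
    exact hOp (mem_iUnion.2 ⟨i, _, (Y i).hOp k ⟨x, hx, rfl⟩, rfl⟩)
  hJ := by
    rintro ⟨i, k⟩ _ ⟨x, hx, rfl⟩
    refine hself.ge ?_
    exact mem_iUnion.2 ⟨i, _, (Y i).hJ k ⟨x, hx, rfl⟩, rfl⟩
  hcov := by
    intro x hx
    rw [hself] at hx
    obtain ⟨i, y, hy, rfl⟩ := mem_iUnion.1 hx
    obtain ⟨k, w, hw, rfl⟩ := (Y i).hcov y hy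
    exact ⟨⟨i, k⟩, w, hw, rfl⟩
  hM := by
    intro S
    let _ := fun i => (Y i).fin
    rw [hMT, Fintype.sum_sigma]
    refine Finset.sum_congr rfl fun i _ => ?_
    rw [(Y i).hM, Finset.mul_sum]
    refine Finset.sum_congr rfl fun k _ => ?_
    rw [Real.mul_rpow (hlam i).1.le ((Y i).lpos k).le, mul_assoc]
    rfl
  hdisj := by
    rintro ⟨i, k⟩ ⟨j, m⟩ hne
    simp only [image_comp]
    by_cases hij : i = j
    · subst hij
      have : k ≠ m := by rintro rfl; exact hne rfl
      refine (disjoint_image_iff ?_).2 ((Y i).hdisj k m this)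
      intro x y hxy
      rw [hT, hT, add_left_inj] at hxy
      exact (rot i).injective (smul_right_injective _ (hlam i).1.ne' hxy)
    · exact (hdis i j hij).mono (image_mono ((Y i).hOp k)) (image_mono ((Y j).hOp m))

theorem exists_sys {s : ℕ} (T : Fin s → ℂ → ℂ) (lam : Fin s → ℝ)
    (rot : Fin s → ℂ ≃ₗᵢ[ℝ] ℂ) (z : Fin s → ℂ)
    (hlam : ∀ i, 0 < lam i ∧ lam i < 1)
    (hT : ∀ i x, T i x = lam i • (rot i x) + z i)
    (J Op : Set ℂ) (hself : J = ⋃ i, T i '' J)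
    (hOp : (⋃ i, T i '' Op) ⊆ Op)
    (hdis : ∀ i j, i ≠ j → Disjoint (T i '' Op) (T j '' Op))
    (M : Set ℂ → ℝ) (D Λ L : ℝ) (hΛ0 : 0 < Λ) (hΛ1 : Λ < 1) (hΛ : ∀ i, Λ ≤ lam i)
    (hL : ∀ i, lam i ≤ L) (hL0 : 0 < L)
    (hMT : ∀ S, M S = ∑ i, lam i ^ D * M (T i ⁻¹' S)) (n : ℕ) :
    ∀ r, L ^ n ≤ r → r ≤ 1 → Nonempty (Sys J Op M D Λ r) := by
  induction n with
  | zero => 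
    intro r h h'
    exact ⟨Sys.one J Op M D Λ r (le_antisymm h' (by simpa using h)) hΛ1.le⟩
  | succ n ih =>
    intro r h h'
    have hr : 0 < r := lt_of_lt_of_le (pow_pos hL0 _) h
    have key : ∀ i, ∃ r', ∃ Y : Sys J Op M D Λ r', (∀ k, Λ * r ≤ lam i * Y.l k) ∧
        ∀ k, lam i * Y.l k ≤ r := by
      intro i
      have hi := (hlam i).1
      by_cases hc : lam i ≤ r
      · refine ⟨1, Sys.one J Op M D Λ 1 rfl hΛ1.le, ?_, ?_⟩
        · intro k
          change Λ * r ≤ lam i * 1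
          nlinarith [hΛ i]
        · intro k
          change lam i * 1 ≤ r
          linarith
      · push Not at hc
        obtain ⟨Y⟩ := ih (r / lam i) (by
          rw [le_div_iff₀ hi]
          refine le_trans ?_ h
          rw [pow_succ]
          exact mul_le_mul_of_nonneg_left (hL i) (pow_pos hL0 _).le) ((div_le_one hi).2 hc.le)
        refine ⟨_, Y, ?_, ?_⟩
        · intro k
          have := mul_le_mul_of_nonneg_left (Y.lb k) hi.le
          calc Λ * r = lam i * (Λ * (r / lam i)) := by field_simp
            _ ≤ _ := this
        · intro k
          have := mul_le_mul_of_nonneg_left (Y.ub k) hi.le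
          calc _ ≤ lam i * (r / lam i) := this
            _ = r := by field_simp
    choose r' Y h1 h2 using key
    exact ⟨Sys.step T lam rot z hlam hT J Op hself hOp hdis M D Λ r hMT r' Y h1 h2⟩

theorem strip_gap (J : Set ℂ) (hne : J.Nonempty) (hline : ¬ Collinear ℝ J) :
    ∃ ε : ℝ, 0 < ε ∧ ∀ S, IsStrip ε S → ∃ x ∈ J, x ∉ S := by
  obtain ⟨a, ha⟩ := hne
  rw [collinear_iff_of_mem ha] at hline
  push Not at hline
  have hb : ∃ b ∈ J, b ≠ a := by
    obtain ⟨b, hb, h⟩ := hline 0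
    refine ⟨b, hb, ?_⟩
    simpa using h 0
  obtain ⟨b, hb, hba⟩ := hb
  obtain ⟨c, hc, h⟩ := hline (b - a)
  obtain ⟨p, hp⟩ : ∃ p, p = b - a := ⟨_, rfl⟩
  obtain ⟨q, hq⟩ : ∃ q, q = c - a := ⟨_, rfl⟩
  have hp0 : p ≠ 0 := by rw [hp]; exact sub_ne_zero.2 hba
  have hN : 0 < p.re ^ 2 + p.im ^ 2 := by
    have := Complex.normSq_pos.2 hp0
    rw [Complex.normSq_apply] at this
    nlinarith
  have hd : p.re * q.im - p.im * q.re ≠ 0 := by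
    intro hd
    refine h ((p.re * q.re + p.im * q.im) / (p.re ^ 2 + p.im ^ 2)) ?_
    rw [← hp, vadd_eq_add, ← sub_eq_iff_eq_add, ← hq]
    apply Complex.ext
    · simp only [Complex.real_smul, Complex.mul_re, Complex.ofReal_re, Complex.ofReal_im]
      field_simp
      linear_combination (-p.im) * hd
    · simp only [Complex.real_smul, Complex.mul_im, Complex.ofReal_re, Complex.ofReal_im]
      field_simp
      linear_combination (p.re) * hd
  obtain ⟨d, hdd⟩ : ∃ d, d = p.re * q.im - p.im * q.re := ⟨_, rfl⟩
  rw [← hdd] at hd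
  obtain ⟨K, hK⟩ : ∃ K, K = |p.re| + |p.im| + |q.re| + |q.im| := ⟨_, rfl⟩
  have hK0 : 0 ≤ K := by rw [hK]; positivity
  have hdpos : 0 < |d| := abs_pos.2 hd
  refine ⟨|d| / (8 * (K + 1)), by positivity, ?_⟩
  rintro _ ⟨u, m, hu, rfl⟩
  by_contra hcon
  push Not at hcon
  have h1 := hcon a ha
  have h2 := hcon b hb
  have h3 := hcon c hc
  simp only [mem_ofPred_eq, Complex.inner] at h1 h2 h3
  simp only [Complex.mul_re, Complex.conj_re, Complex.conj_im] at h1 h2 h3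
  obtain ⟨ε, hε⟩ : ∃ ε, ε = |d| / (8 * (K + 1)) := ⟨_, rfl⟩
  rw [← hε] at h1 h2 h3
  have hε' : 8 * (ε * (K + 1)) = |d| := by rw [hε]; field_simp
  have hεp : 0 < ε := by rw [hε]; positivity
  have e1 : |u.re * p.re + u.im * p.im| ≤ 2 * ε := by
    have := (abs_sub _ _).trans (add_le_add h2 h1)
    rw [hp, Complex.sub_re, Complex.sub_im]
    refine le_trans (le_of_eq ?_) (this.trans (by linarith))
    congr 1; ring
  have e2 : |u.re * q.re + u.im * q.im| ≤ 2 * ε := by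
    have := (abs_sub _ _).trans (add_le_add h3 h1)
    rw [hq, Complex.sub_re, Complex.sub_im]
    refine le_trans (le_of_eq ?_) (this.trans (by linarith))
    congr 1; ring
  have g : ∀ x y X Y : ℝ, |x| ≤ 2 * ε → |y| ≤ 2 * ε → |X| ≤ K → |Y| ≤ K →
      |x * X - y * Y| ≤ 4 * (ε * K) := by
    intro x y X Y hx hy hX hY
    refine (abs_sub _ _).trans ?_
    rw [abs_mul, abs_mul]
    have a1 := mul_le_mul hx hX (abs_nonneg _) (by positivity)
    have a2 := mul_le_mul hy hY (abs_nonneg _) (by positivity)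
    linarith
  have b1 := abs_nonneg p.re
  have b2 := abs_nonneg p.im
  have b3 := abs_nonneg q.re
  have b4 := abs_nonneg q.im
  have f1 : |u.re * d| ≤ 4 * (ε * K) := by
    have := g _ _ q.im p.im e1 e2 (by linarith) (by linarith)
    convert this using 2
    rw [hdd]; ring
  have f2 : |u.im * d| ≤ 4 * (ε * K) := by
    have := g _ _ p.re q.re e2 e1 (by linarith) (by linarith)
    convert this using 2
    rw [hdd]; ring
  rw [abs_mul] at f1 f2
  have hu1 : 1 ≤ |u.re| + |u.im| := by
    rw [← hu]; exact Complex.norm_le_abs_re_add_abs_im u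
  nlinarith

theorem strip_step {J Op : Set ℂ} {M : Set ℂ → ℝ} {D Λ r ε K : ℝ} (Y : Sys J Op M D Λ r)
    (hgap : ∀ S, IsStrip ε S → ∃ x ∈ J, x ∉ S)
    (hK : ∀ x ∈ J, ∀ y ∈ J, dist x y ≤ K) (hr : r * K ≤ ε / 2) (hK0 : 0 ≤ K)
    (t : ℝ) (ht : t ≤ ε / 2) (S : Set ℂ) (hS : IsStrip t S) :
    ∃ k, J ∩ Y.f k ⁻¹' S = ∅ := by
  obtain ⟨u, c, hu, rfl⟩ := hS
  obtain ⟨x, hx, hxS⟩ := hgap _ ⟨u, c, hu, rfl⟩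
  obtain ⟨k, y, hy, rfl⟩ := Y.hcov x hx
  refine ⟨k, ?_⟩
  ext w
  simp only [mem_inter_iff, mem_preimage, mem_empty_iff_false, iff_false, not_and,
    mem_ofPred_eq] at hxS ⊢
  intro hw hwS
  apply hxS
  have h1 : dist (Y.f k y) (Y.f k w) ≤ ε / 2 := by
    rw [Y.hd]
    refine le_trans ?_ hr
    exact mul_le_mul (Y.ub k) (hK y hy w hw) dist_nonneg ((Y.lpos k).le.trans (Y.ub k))
  have h2 : |inner ℝ u (Y.f k y - Y.f k w)| ≤ ε / 2 := by
    refine (abs_real_inner_le_norm _ _).trans ?_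
    rw [hu, one_mul, ← dist_eq_norm]; exact h1
  rw [inner_sub_right] at h2
  have := abs_add_le (inner ℝ u (Y.f k y) - inner ℝ u (Y.f k w)) (inner ℝ u (Y.f k w) - c)
  rw [sub_add_sub_cancel] at this
  linarith

theorem sys_sum {J Op : Set ℂ} {M : Set ℂ → ℝ} {D Λ r : ℝ} (Y : Sys J Op M D Λ r)
    (hM1 : ∀ S, J ⊆ S → M S = 1) : letI := Y.fin; ∑ k, Y.l k ^ D = 1 := by
  have := Y.hM univ
  rw [hM1 _ (subset_univ _)] at this
  rw [this]
  simp [hM1 _ (subset_univ _)]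

theorem strip_iter {J Op : Set ℂ} {M : Set ℂ → ℝ} {D Λ r ε K : ℝ} (Y : Sys J Op M D Λ r)
    (hgap : ∀ S, IsStrip ε S → ∃ x ∈ J, x ∉ S)
    (hK : ∀ x ∈ J, ∀ y ∈ J, dist x y ≤ K) (hr : r * K ≤ ε / 2) (hK0 : 0 ≤ K) (hε : 0 < ε)
    (hM0 : ∀ S, 0 ≤ M S) (hMle : ∀ S, M S ≤ 1) (hMd : ∀ S, J ∩ S = ∅ → M S = 0)
    (hM1 : ∀ S, J ⊆ S → M S = 1) (hq0 : 0 < Λ * r) (hq1 : Λ * r < 1) (hD : 0 < D) (n : ℕ) :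
    ∀ t S, 0 < t → t ≤ ε / 2 * (Λ * r) ^ n → IsStrip t S → M S ≤ (1 - (Λ * r) ^ D) ^ n := by
  classical
  let _ := Y.fin
  have hp1 : (Λ * r) ^ D < 1 := Real.rpow_lt_one hq0.le hq1 hD
  induction n with
  | zero => intro t S _ _ _; simpa using hMle S
  | succ n ih =>
    intro t S ht0 ht hS
    have hpw : (Λ * r) ^ (n + 1) ≤ 1 := pow_le_one₀ hq0.le hq1.le
    obtain ⟨k0, hk0⟩ := strip_step Y hgap hK hr hK0 t (by nlinarith) S hS
    have hsum := sys_sum Y hM1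
    have hP : 0 ≤ (1 - (Λ * r) ^ D) ^ n := pow_nonneg (by linarith) _
    have hterm : ∀ k, Y.l k ^ D * M (Y.f k ⁻¹' S) ≤
        (if k = k0 then 0 else 1) * (Y.l k ^ D * (1 - (Λ * r) ^ D) ^ n) := by
      intro k
      split_ifs with hk
      · subst hk; rw [hMd _ hk0]; simp
      · rw [one_mul]
        refine mul_le_mul_of_nonneg_left ?_ (Real.rpow_nonneg (Y.lpos k).le _)
        refine ih (t / Y.l k) _ (div_pos ht0 (Y.lpos k)) ?_ (Y.hstrip k t S hS)
        rw [div_le_iff₀ (Y.lpos k)]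
        refine ht.trans ?_
        rw [pow_succ, ← mul_assoc]
        exact mul_le_mul_of_nonneg_left (Y.lb k) (by positivity)
    have h0 : (Λ * r) ^ D ≤ Y.l k0 ^ D := Real.rpow_le_rpow hq0.le (Y.lb k0) hD.le
    calc M S = ∑ k, Y.l k ^ D * M (Y.f k ⁻¹' S) := Y.hM S
      _ ≤ ∑ k, (if k = k0 then 0 else 1) * (Y.l k ^ D * (1 - (Λ * r) ^ D) ^ n) :=
        Finset.sum_le_sum fun k _ => hterm k
      _ = ∑ k, (Y.l k ^ D * (1 - (Λ * r) ^ D) ^ n -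
            if k = k0 then (Y.l k ^ D * (1 - (Λ * r) ^ D) ^ n) else 0) := by
        refine Finset.sum_congr rfl fun k _ => ?_
        split_ifs <;> ring
      _ = (1 - Y.l k0 ^ D) * (1 - (Λ * r) ^ D) ^ n := by
        rw [Finset.sum_sub_distrib, ← Finset.sum_mul, hsum]
        simp; ring
      _ ≤ _ := by
        rw [pow_succ, mul_comm]
        exact mul_le_mul_of_nonneg_left (by linarith) hP

theorem strip_decay {J Op : Set ℂ} {M : Set ℂ → ℝ} {D Λ r ε K α : ℝ} (Y : Sys J Op M D Λ r)
    (hgap : ∀ S, IsStrip ε S → ∃ x ∈ J, x ∉ S)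
    (hK : ∀ x ∈ J, ∀ y ∈ J, dist x y ≤ K) (hr : r * K ≤ ε / 2) (hK0 : 0 ≤ K) (hε : 0 < ε)
    (hM0 : ∀ S, 0 ≤ M S) (hMle : ∀ S, M S ≤ 1) (hMd : ∀ S, J ∩ S = ∅ → M S = 0)
    (hM1 : ∀ S, J ⊆ S → M S = 1) (hq0 : 0 < Λ * r) (hq1 : Λ * r < 1) (hD : 0 < D) (hα : 0 < α) :
    ∃ κ C : ℝ, 0 < κ ∧ κ ≤ α ∧ 0 < C ∧ ∀ t S, 0 < t → IsStrip t S → M S ≤ C * t ^ κ := by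
  have hp1 : (Λ * r) ^ D < 1 := Real.rpow_lt_one hq0.le hq1 hD
  have hp0 : 0 < (Λ * r) ^ D := Real.rpow_pos_of_pos hq0 _
  obtain ⟨q, hq⟩ : ∃ q, q = Λ * r := ⟨_, rfl⟩
  obtain ⟨κ, hκ0, hκα, hκ⟩ : ∃ κ, 0 < κ ∧ κ ≤ α ∧ 1 - (Λ * r) ^ D ≤ q ^ κ := by
    have hl : Real.log q < 0 := Real.log_neg (hq ▸ hq0) (hq ▸ hq1)
    have hl' : Real.log (1 - (Λ * r) ^ D) < 0 := Real.log_neg (by linarith) (by linarith)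
    refine ⟨min α (Real.log (1 - (Λ * r) ^ D) / Real.log q), lt_min hα (div_pos_of_neg_of_neg hl' hl),
      min_le_left _ _, ?_⟩
    refine le_trans ?_ (Real.rpow_le_rpow_of_exponent_ge (hq ▸ hq0) (hq ▸ hq1).le (min_le_right _ _))
    rw [Real.rpow_def_of_pos (x := q) (hq ▸ hq0), mul_div_cancel₀ _ hl.ne, Real.exp_log (by linarith)]
  have hq0' : 0 < q := hq ▸ hq0
  have hA : 0 < (q * (ε / 2)) := by positivity
  refine ⟨κ, ((q * (ε / 2)) ^ κ)⁻¹, hκ0, hκα, by positivity, ?_⟩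
  intro t S ht hS
  rw [inv_mul_eq_div, ← Real.div_rpow ht.le hA.le]
  by_cases htε : ε / 2 < t
  · refine (hMle S).trans (Real.one_le_rpow ?_ hκ0.le)
    rw [le_div_iff₀ hA]
    have : q < 1 := hq ▸ hq1
    nlinarith
  · push Not at htε
    obtain ⟨n, hn1, hn2⟩ := exists_nat_pow_near_of_lt_one (x := t / (ε / 2)) (by positivity)
      ((div_le_one (by positivity)).2 htε) hq0' (hq ▸ hq1)
    have h1 := strip_iter Y hgap hK hr hK0 hε hM0 hMle hMd hM1 hq0 hq1 hD n t S ht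
      (by rw [div_le_iff₀ (by positivity)] at hn2; rw [← hq]; linarith) hS
    refine h1.trans ((pow_le_pow_left₀ (by linarith) hκ n).trans ?_)
    rw [← Real.rpow_natCast, ← Real.rpow_mul hq0'.le, mul_comm, Real.rpow_mul hq0'.le,
      Real.rpow_natCast]
    refine Real.rpow_le_rpow (by positivity) ?_ hκ0.le
    rw [lt_div_iff₀ (by positivity), pow_succ] at hn1
    rw [le_div_iff₀ hA]
    linarith

theorem exists_D {s : ℕ} (hs : 0 < s) (lam : Fin s → ℝ) (hlam : ∀ i, 0 < lam i ∧ lam i < 1) :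
    ∃ D : ℝ, 0 ≤ D ∧ ∑ i, lam i ^ D = 1 := by
  have hc : Continuous fun d : ℝ => ∑ i, lam i ^ d :=
    continuous_finsetSum _ fun i _ => Real.continuous_const_rpow (hlam i).1.ne'
  have ht : Filter.Tendsto (fun d : ℝ => ∑ i, lam i ^ d) Filter.atTop (nhds (∑ i : Fin s, 0)) :=
    tendsto_finsetSum _ fun i _ => tendsto_rpow_atTop_of_base_lt_one _
      (by linarith [(hlam i).1]) (hlam i).2
  rw [Finset.sum_const_zero] at ht
  obtain ⟨d, hd1, hd0⟩ := ((ht.eventually (gt_mem_nhds one_pos)).and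
    (Filter.eventually_ge_atTop 0)).exists
  obtain ⟨D, hD, hD1⟩ := intermediate_value_Icc' hd0 hc.continuousOn
    (show (1 : ℝ) ∈ _ by
      refine ⟨hd1.le, ?_⟩
      simp only [Real.rpow_zero, Finset.sum_const, Finset.card_univ, Fintype.card_fin, nsmul_eq_mul,
        mul_one]
      exact_mod_cast hs)
  exact ⟨D, hD.1, hD1⟩

theorem dim_le {J Op : Set ℂ} {M : Set ℂ → ℝ} {D Λ K : ℝ} (hD : 0 ≤ D)
    (Y : ∀ r, 0 < r → r ≤ 1 → Nonempty (Sys J Op M D Λ r))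
    (hK : ∀ x ∈ J, ∀ y ∈ J, dist x y ≤ K) (hK0 : 0 ≤ K)
    (hM1 : ∀ S, J ⊆ S → M S = 1) : dimH J ≤ ENNReal.ofReal D := by
  have hY : ∀ n : ℕ, Nonempty (Sys J Op M D Λ (1 / (n + 1 : ℝ))) := fun n =>
    Y _ (by positivity) (by rw [div_le_one (by positivity)]; linarith [n.cast_nonneg (α := ℝ)])
  let Y' := fun n => (hY n).some
  let _ := fun n => (Y' n).fin
  have hdiam : ∀ n k, ediam ((Y' n).f k '' J) ≤ ENNReal.ofReal ((Y' n).l k * K) := by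
    intro n k
    refine ediam_le ?_
    rintro _ ⟨x, hx, rfl⟩ _ ⟨y, hy, rfl⟩
    rw [edist_dist, (Y' n).hd]
    exact ENNReal.ofReal_le_ofReal (mul_le_mul_of_nonneg_left (hK x hx y hy) ((Y' n).lpos k).le)
  have hsum : ∀ n, ∑ k, ediam ((Y' n).f k '' J) ^ D ≤ ENNReal.ofReal (K ^ D) := by
    intro n
    calc _ ≤ ∑ k, ENNReal.ofReal ((Y' n).l k ^ D * K ^ D) := by
          refine Finset.sum_le_sum fun k _ => ?_
          refine (ENNReal.rpow_le_rpow (hdiam n k) hD).trans (le_of_eq ?_)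
          rw [ENNReal.ofReal_rpow_of_nonneg (mul_nonneg ((Y' n).lpos k).le hK0) hD,
            Real.mul_rpow ((Y' n).lpos k).le hK0]
      _ = ENNReal.ofReal (K ^ D) := by
          rw [← ENNReal.ofReal_sum_of_nonneg, ← Finset.sum_mul, sys_sum (Y' n) hM1, one_mul]
          intro k _
          exact mul_nonneg (Real.rpow_nonneg ((Y' n).lpos k).le _) (Real.rpow_nonneg hK0 _)
  have hH := MeasureTheory.Measure.hausdorffMeasure_le_liminf_sum (ι := fun n => (Y' n).ι)
    (l := Filter.atTop) D J
    (fun n : ℕ => ENNReal.ofReal (1 / (n + 1 : ℝ) * K))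
    (by
      have := (tendsto_one_div_add_atTop_nhds_zero_nat (𝕜 := ℝ)).mul_const K
      rw [zero_mul] at this
      simpa using ENNReal.tendsto_ofReal this)
    (fun n k => (Y' n).f k '' J)
    (Filter.Eventually.of_forall fun n k => (hdiam n k).trans
      (ENNReal.ofReal_le_ofReal (mul_le_mul_of_nonneg_right ((Y' n).ub k) hK0)))
    (Filter.Eventually.of_forall fun n x hx => mem_iUnion.2 ((Y' n).hcov x hx))
  have hfin : μH[D] J ≤ ENNReal.ofReal (K ^ D) := by
    refine hH.trans ?_
    exact (Filter.liminf_le_liminf (Filter.Eventually.of_forall hsum)).trans (by simp)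
  have := dimH_le_of_hausdorffMeasure_ne_top (s := J) (d := D.toNNReal) (by
    rw [Real.coe_toNNReal _ hD]
    exact ne_top_of_le_ne_top ENNReal.ofReal_ne_top hfin)
  exact this

theorem pack {J Op : Set ℂ} {M : Set ℂ → ℝ} {D Λ r ρ : ℝ} (Y : Sys J Op M D Λ r)
    (x0 : ℂ) (hρ : 0 < ρ) (hx0 : ball x0 ρ ⊆ Op) (hr : 0 < r) (hΛ : 0 < Λ)
    (F : Finset Y.ι) (A : Set ℂ) (hA : volume A ≠ ⊤)
    (h : ∀ k ∈ F, ball (Y.f k x0) (Λ * r * ρ) ⊆ A) :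
    F.card * ((Λ * r * ρ) ^ 2 * Real.pi) ≤ (volume A).toReal := by
  have hb : ∀ k, ball (Y.f k x0) (Λ * r * ρ) ⊆ Y.f k '' Op := by
    intro k y hy
    obtain ⟨x, rfl⟩ := Y.hsurj k y
    refine ⟨x, hx0 ?_, rfl⟩
    rw [mem_ball, Y.hd] at hy
    rw [mem_ball]
    have h1 := Y.lb k
    have h2 := Y.lpos k
    have h3 : Y.l k * dist x x0 < Y.l k * ρ :=
      hy.trans_le (mul_le_mul_of_nonneg_right h1 hρ.le)
    exact lt_of_mul_lt_mul_left h3 h2.le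
  have h1 : volume (⋃ k ∈ F, ball (Y.f k x0) (Λ * r * ρ)) =
      ∑ k ∈ F, volume (ball (Y.f k x0) (Λ * r * ρ)) :=
    measure_biUnion_finset (fun k _ k' _ hkk => (Y.hdisj k k' hkk).mono (hb k) (hb k'))
      fun k _ => measurableSet_ball
  have h2 := measure_mono (μ := volume) (iUnion₂_subset h)
  rw [h1] at h2
  have h3 := ENNReal.toReal_mono hA h2
  refine le_trans (le_of_eq ?_) h3
  have h0 : 0 ≤ Λ * r * ρ := by positivity
  simp [Complex.volume_ball, ENNReal.toReal_ofReal h0]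

theorem rect_decay {J Op : Set ℂ} {M : Set ℂ → ℝ} {D Λ ρ κ C' A B : ℝ}
    (x0 : ℂ) (hρ : 0 < ρ) (hx0 : ball x0 ρ ⊆ Op) (hΛ : 0 < Λ) (hΛ1 : Λ < 1)
    (hB : ∀ y ∈ J, dist y x0 ≤ B) (hB0 : 0 ≤ B) (hA : 0 < A) (hκ : 0 < κ) (hD : 0 ≤ D)
    (hM0 : ∀ S, 0 ≤ M S)
    (hMm : ∀ S S', S ⊆ S' → M S ≤ M S') (hMd : ∀ S, J ∩ S = ∅ → M S = 0) (hC' : 0 < C')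
    (hstrip : ∀ t S, 0 < t → IsStrip t S → M S ≤ C' * t ^ κ)
    (r₁ r₂ : ℝ) (h1 : 0 < r₁) (h12 : r₁ ≤ r₂) (Y : Sys J Op M D Λ r₂)
    (S S' : Set ℂ) (c : ℂ) (hS : S ⊆ S') (hS' : IsStrip (A * r₁) S')
    (hSc : S ⊆ closedBall c (A * r₂)) :
    M S ≤ (((A + B + ρ) / (Λ * ρ)) ^ 2 * (C' * (A / Λ) ^ κ)) * (r₁ ^ κ * r₂ ^ (D - κ)) := by
  classical
  let _ := Y.fin
  have h2 : 0 < r₂ := h1.trans_le h12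
  let F : Finset Y.ι := Finset.univ.filter fun k => (J ∩ Y.f k ⁻¹' S).Nonempty
  have hcard : (F.card : ℝ) ≤ ((A + B + ρ) / (Λ * ρ)) ^ 2 := by
    have := pack Y x0 hρ hx0 h2 hΛ F (closedBall c ((A + B + ρ) * r₂)) (by
      simp [Complex.volume_closedBall]
      finiteness) (by
      intro k hk v hv
      obtain ⟨y, hy, hyS⟩ := (Finset.mem_filter.1 hk).2
      have a1 := hSc hyS
      rw [mem_closedBall] at a1 ⊢
      rw [mem_ball] at hv
      have a2 : dist (Y.f k x0) (Y.f k y) ≤ r₂ * B := by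
        rw [Y.hd, dist_comm]
        exact mul_le_mul (Y.ub k) (hB y hy) dist_nonneg h2.le
      have a3 : Λ * r₂ * ρ ≤ r₂ * ρ := by nlinarith [mul_pos h2 hρ]
      have a4 := dist_triangle v (Y.f k x0) c
      have a5 := dist_triangle (Y.f k x0) (Y.f k y) c
      linarith)
    have h0 : 0 ≤ (A + B + ρ) * r₂ := by positivity
    simp only [Complex.volume_closedBall, ENNReal.toReal_mul, ENNReal.toReal_pow,
      ENNReal.toReal_ofReal h0] at this
    have hpi : ((NNReal.pi : ENNReal)).toReal = Real.pi := rfl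
    rw [hpi, ← mul_assoc] at this
    have := le_of_mul_le_mul_right this Real.pi_pos
    rw [div_pow, le_div_iff₀ (by positivity)]
    have h3 : (F.card * (Λ * ρ) ^ 2) * r₂ ^ 2 ≤ (A + B + ρ) ^ 2 * r₂ ^ 2 := by
      calc _ = (F.card : ℝ) * (Λ * r₂ * ρ) ^ 2 := by ring
        _ ≤ _ := this
        _ = _ := by ring
    exact le_of_mul_le_mul_right h3 (by positivity)
  have hterm : ∀ k ∈ F, Y.l k ^ D * M (Y.f k ⁻¹' S) ≤
      r₂ ^ D * (C' * (A / Λ * (r₁ / r₂)) ^ κ) := by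
    intro k _
    have hl := Y.lpos k
    refine mul_le_mul (Real.rpow_le_rpow hl.le (Y.ub k) hD) ?_ (hM0 _) (by positivity)
    refine (hMm _ _ (preimage_mono hS)).trans
      ((hstrip _ _ (by positivity) (Y.hstrip k _ _ hS')).trans ?_)
    refine mul_le_mul_of_nonneg_left (Real.rpow_le_rpow (by positivity) ?_ hκ.le) hC'.le
    calc A * r₁ / Y.l k ≤ A * r₁ / (Λ * r₂) :=
          div_le_div_of_nonneg_left (by positivity) (by positivity) (Y.lb k)
      _ = _ := by field_simp
  calc M S = ∑ k, Y.l k ^ D * M (Y.f k ⁻¹' S) := Y.hM S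
    _ = ∑ k ∈ F, Y.l k ^ D * M (Y.f k ⁻¹' S) := by
      symm
      refine Finset.sum_subset (Finset.subset_univ _) fun k _ hk => ?_
      have : J ∩ Y.f k ⁻¹' S = ∅ := by
        by_contra hne
        exact hk (Finset.mem_filter.2 ⟨Finset.mem_univ _, nonempty_iff_ne_empty.2 hne⟩)
      rw [hMd _ this, mul_zero]
    _ ≤ F.card * (r₂ ^ D * (C' * (A / Λ * (r₁ / r₂)) ^ κ)) := by
      rw [← nsmul_eq_mul]
      exact Finset.sum_le_card_nsmul _ _ _ hterm
    _ ≤ ((A + B + ρ) / (Λ * ρ)) ^ 2 * (r₂ ^ D * (C' * (A / Λ * (r₁ / r₂)) ^ κ)) :=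
      mul_le_mul_of_nonneg_right hcard (by positivity)
    _ = _ := by
      rw [Real.mul_rpow (by positivity) (by positivity), Real.div_rpow h1.le h2.le,
        Real.rpow_sub h2]
      ring

theorem vol_bound {J Op : Set ℂ} {M : Set ℂ → ℝ} {D Λ ρ K δ r₁ : ℝ} (hJc : IsCompact J)
    (x0 a : ℂ) (ha : a ∈ J) (hρ : 0 < ρ) (hx0 : ball x0 ρ ⊆ Op) (hxa : dist x0 a + ρ ≤ 1)
    (hΛ : 0 < Λ) (hΛ1 : Λ < 1) (hD : 0 ≤ D)
    (hK : ∀ x ∈ J, ∀ y ∈ J, dist x y ≤ K) (hK0 : 0 ≤ K)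
    (hM0 : ∀ S, 0 ≤ M S) (hM1 : ∀ S, J ⊆ S → M S = 1)
    (hδ : 0 < δ) (hδr : δ ≤ r₁) (Y : Sys J Op M D Λ δ) (R S : Set ℂ)
    (hS : ∀ v x, x ∈ R → dist v x ≤ (K + 1) * r₁ → v ∈ S) :
    (volume (cthickening δ J ∩ R)).toReal ≤
      M S * ((K + 1) ^ 2 / (Λ ^ D * (Λ * ρ) ^ 2)) * (volume (cthickening δ J)).toReal := by
  classical
  let _ := Y.fin
  have hfin : volume (cthickening δ J) ≠ ⊤ := hJc.cthickening.measure_ne_top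
  have hP := pack Y x0 hρ hx0 hδ hΛ Finset.univ (cthickening δ J) hfin (by
    intro k _ v hv
    refine mem_cthickening_of_dist_le v (Y.f k a) δ J (Y.hJ k ⟨a, ha, rfl⟩) ?_
    rw [mem_ball] at hv
    have h1 := dist_triangle v (Y.f k x0) (Y.f k a)
    rw [Y.hd] at h1
    have h2 := mul_le_mul_of_nonneg_right (Y.ub k) (dist_nonneg (x := x0) (y := a))
    have h3 : Λ * δ * ρ ≤ δ * ρ := by nlinarith [mul_pos hδ hρ]
    nlinarith)
  obtain ⟨P, hPdef⟩ : ∃ P, P = (volume (cthickening δ J)).toReal := ⟨_, rfl⟩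
  rw [← hPdef] at hP ⊢
  let F : Finset Y.ι := Finset.univ.filter fun k => ∃ x ∈ R, ∃ y ∈ J, dist x (Y.f k y) ≤ δ
  have hsub : cthickening δ J ∩ R ⊆ ⋃ k ∈ F, closedBall (Y.f k a) ((K + 1) * δ) := by
    rintro x ⟨hx, hxR⟩
    rw [hJc.cthickening_eq_biUnion_closedBall hδ.le] at hx
    obtain ⟨y, hy, hxy⟩ := mem_iUnion₂.1 hx
    obtain ⟨k, w, hw, rfl⟩ := Y.hcov y hy
    refine mem_iUnion₂.2 ⟨k, Finset.mem_filter.2 ⟨Finset.mem_univ _, x, hxR, w, hw, hxy⟩, ?_⟩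
    rw [mem_closedBall] at hxy ⊢
    have h1 := dist_triangle x (Y.f k w) (Y.f k a)
    rw [Y.hd] at h1
    have h2 := mul_le_mul (Y.ub k) (hK w hw a ha) dist_nonneg hδ.le
    linarith
  have hK1 : 0 ≤ (K + 1) * δ := by positivity
  have hV : (volume (cthickening δ J ∩ R)).toReal ≤ F.card * (((K + 1) * δ) ^ 2 * Real.pi) := by
    have h1 : volume (cthickening δ J ∩ R) ≤
        ∑ k ∈ F, volume (closedBall (Y.f k a) ((K + 1) * δ)) :=
      (measure_mono hsub).trans (measure_biUnion_finset_le _ _)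
    have h2 := ENNReal.toReal_mono (by
      simp [Complex.volume_closedBall]
      finiteness) h1
    refine h2.trans (le_of_eq ?_)
    simp [Complex.volume_closedBall, ENNReal.toReal_ofReal hK1]
  have hF : F.card * (Λ * δ) ^ D ≤ M S := by
    calc F.card * (Λ * δ) ^ D = ∑ k ∈ F, (Λ * δ) ^ D := by simp
      _ ≤ ∑ k ∈ F, Y.l k ^ D * M (Y.f k ⁻¹' S) := by
        refine Finset.sum_le_sum fun k hk => ?_
        obtain ⟨x, hxR, y, hy, hxy⟩ := (Finset.mem_filter.1 hk).2
        rw [hM1, mul_one]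
        · exact Real.rpow_le_rpow (by positivity) (Y.lb k) hD
        · intro w hw
          refine hS _ x hxR ?_
          have h1 := dist_triangle (Y.f k w) (Y.f k y) x
          rw [Y.hd, dist_comm (Y.f k y)] at h1
          have h2 := mul_le_mul (Y.ub k) (hK w hw y hy) dist_nonneg hδ.le
          nlinarith
      _ ≤ ∑ k, Y.l k ^ D * M (Y.f k ⁻¹' S) :=
        Finset.sum_le_sum_of_subset_of_nonneg (Finset.subset_univ _)
          fun k _ _ => mul_nonneg (Real.rpow_nonneg (Y.lpos k).le _) (hM0 _)
      _ = M S := (Y.hM S).symm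
  have hN : 1 ≤ (Finset.univ : Finset Y.ι).card * δ ^ D := by
    rw [← sys_sum Y hM1, ← nsmul_eq_mul]
    exact Finset.sum_le_card_nsmul _ _ _ fun k _ => Real.rpow_le_rpow (Y.lpos k).le (Y.ub k) hD
  have hpi := Real.pi_pos
  have hδD : 0 < δ ^ D := Real.rpow_pos_of_pos hδ _
  have hΛD : 0 < Λ ^ D := Real.rpow_pos_of_pos hΛ _
  rw [Real.mul_rpow hΛ.le hδ.le] at hF
  -- (Λδρ)²π ≤ δ^D P
  have hP2 : (Λ * δ * ρ) ^ 2 * Real.pi ≤ δ ^ D * P := by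
    have h1 := mul_le_mul_of_nonneg_left hP hδD.le
    have h2 := mul_le_mul_of_nonneg_right hN (show 0 ≤ (Λ * δ * ρ) ^ 2 * Real.pi by positivity)
    linarith
  refine hV.trans ?_
  have hE : 0 < (Λ * ρ) ^ 2 := by positivity
  have e1 : (F.card : ℝ) ≤ M S / (Λ ^ D * δ ^ D) := by
    rw [le_div_iff₀ (by positivity)]; exact hF
  have e2 : δ ^ 2 * Real.pi ≤ δ ^ D * P / (Λ * ρ) ^ 2 := by
    rw [le_div_iff₀ hE]; linarith
  have hMS := hM0 S
  calc (F.card : ℝ) * (((K + 1) * δ) ^ 2 * Real.pi)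
      = (K + 1) ^ 2 * (F.card * (δ ^ 2 * Real.pi)) := by ring
    _ ≤ (K + 1) ^ 2 * (M S / (Λ ^ D * δ ^ D) * (δ ^ D * P / (Λ * ρ) ^ 2)) := by
      refine mul_le_mul_of_nonneg_left ?_ (by positivity)
      exact mul_le_mul e1 e2 (by positivity) (by positivity)
    _ = _ := by field_simp

theorem rect_sub {R : Set ℂ} {r₁ r₂ K : ℝ} (hR : IsRect R r₁ r₂) (h1 : 0 < r₁) (h12 : r₁ ≤ r₂)
    (hK0 : 0 ≤ K) :
    ∃ (S' : Set ℂ) (c : ℂ), IsStrip ((K + 3) * r₁) S' ∧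
      (∀ v x, x ∈ R → dist v x ≤ (K + 1) * r₁ → v ∈ S' ∩ closedBall c ((K + 3) * r₂)) := by
  obtain ⟨z, w, hw, rfl⟩ := hR
  have hwI : ‖w * Complex.I‖ = 1 := by simp [hw]
  refine ⟨_, z, ⟨w * Complex.I, inner ℝ (w * Complex.I) z, hwI, rfl⟩, ?_⟩
  rintro v _ ⟨⟨p1, p2⟩, ⟨⟨hp1, hp1'⟩, ⟨hp2, hp2'⟩⟩, rfl⟩ hv
  simp only at hp1 hp1' hp2 hp2' hv
  obtain ⟨x, hx⟩ : ∃ x, x = z + p1 • w + p2 • (w * Complex.I) := ⟨_, rfl⟩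
  rw [← hx] at hv
  have hin : inner ℝ (w * Complex.I) w = (0 : ℝ) := by
    simp [Complex.inner]; ring
  constructor
  · have e : inner ℝ (w * Complex.I) v - inner ℝ (w * Complex.I) z =
        inner ℝ (w * Complex.I) (v - x) + p2 := by
      rw [inner_sub_right, hx, inner_add_right, inner_add_right, inner_smul_right, inner_smul_right,
        hin, real_inner_self_eq_norm_sq, hwI]
      ring
    rw [mem_ofPred_eq, e]
    have h2 := abs_real_inner_le_norm (w * Complex.I) (v - x)
    rw [hwI, one_mul, ← dist_eq_norm] at h2
    have h3 := abs_add_le (inner ℝ (w * Complex.I) (v - x)) p2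
    rw [abs_of_nonneg hp2] at h3
    linarith
  · rw [mem_closedBall]
    have h2 : dist x z ≤ p1 + p2 := by
      rw [dist_eq_norm, hx, add_assoc, add_sub_cancel_left]
      refine (norm_add_le _ _).trans ?_
      rw [norm_smul, norm_smul, hw, hwI, Real.norm_of_nonneg hp1, Real.norm_of_nonneg hp2]
      linarith
    have h3 := dist_triangle v x z
    nlinarith

/-- For a self-similar set `𝒥` of dimension `α` satisfying the Open Set Condition and
not contained in a line, `|𝒥^δ ∩ R| ≤ C r₁^κ r₂^{α-κ} |𝒥^δ|` whenever `R` is a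
rectangle of dimensions `δ ≤ r₁ ≤ r₂`. -/
theorem stmt17 (s : ℕ) (T : Fin s → ℂ → ℂ) (lam : Fin s → ℝ)
    (rot : Fin s → ℂ ≃ₗᵢ[ℝ] ℂ) (z : Fin s → ℂ)
    (hlam : ∀ i, 0 < lam i ∧ lam i < 1)
    (hT : ∀ i x, T i x = lam i • (rot i x) + z i)
    (J : Set ℂ) (hJc : IsCompact J) (hJne : J.Nonempty)
    (hself : J = ⋃ i, T i '' J)
    (hOSC : ∃ Op : Set ℂ, IsOpen Op ∧ Op.Nonempty ∧ (⋃ i, T i '' Op) ⊆ Op ∧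
      ∀ i j, i ≠ j → Disjoint (T i '' Op) (T j '' Op))
    (α : ℝ) (hα0 : 0 < α) (hα1 : α ≤ 1) (hdim : dimH J = ENNReal.ofReal α)
    (hline : ¬ Collinear ℝ J) :
    ∃ κ C : ℝ, 0 < κ ∧ κ ≤ α ∧ 1 ≤ C ∧
      ∀ (δ r₁ r₂ : ℝ) (R : Set ℂ), 0 < δ → δ ≤ 1 → δ ≤ r₁ → r₁ ≤ r₂ →
        IsRect R r₁ r₂ →
        (volume (cthickening δ J ∩ R)).toReal ≤
          C * r₁ ^ κ * r₂ ^ (α - κ) * (volume (cthickening δ J)).toReal := by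
  obtain ⟨Op, hOo, ⟨y0, hy0⟩, hOT, hdis⟩ := hOSC
  obtain ⟨a, ha⟩ := hJne
  have hTJ : ∀ i, T i '' J ⊆ J := fun i x hx => hself.ge (mem_iUnion.2 ⟨i, hx⟩)
  have hs : 0 < s := by
    rw [hself] at ha
    obtain ⟨i, _⟩ := mem_iUnion.1 ha
    exact i.pos
  have : Nonempty (Fin s) := ⟨⟨0, hs⟩⟩
  obtain ⟨D, hD0, hD⟩ := exists_D hs lam hlam
  obtain ⟨M, hM0, hMm, hMd, hM1, hMT⟩ := existsM T J ⟨a, ha⟩ (fun i => lam i ^ D)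
    (fun i => Real.rpow_nonneg (hlam i).1.le _) hD hTJ
  have hMle : ∀ S, M S ≤ 1 := fun S => (hMm S univ (subset_univ _)).trans
    (hM1 univ (subset_univ _)).le
  obtain ⟨i0, hi0⟩ := Finite.exists_min lam
  obtain ⟨i1, hi1⟩ := Finite.exists_max lam
  obtain ⟨Λ, hΛdef⟩ : ∃ Λ, Λ = lam i0 := ⟨_, rfl⟩
  have hΛ0 : 0 < Λ := hΛdef ▸ (hlam i0).1
  have hΛ1 : Λ < 1 := hΛdef ▸ (hlam i0).2
  have hSys : ∀ r, 0 < r → r ≤ 1 → Nonempty (Sys J Op M D Λ r) := by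
    intro r hr hr1
    obtain ⟨n, hn⟩ := exists_pow_lt_of_lt_one hr (hlam i1).2
    exact exists_sys T lam rot z hlam hT J Op hself hOT hdis M D Λ (lam i1) hΛ0 hΛ1
      (fun i => hΛdef ▸ hi0 i) hi1 (hlam i1).1 hMT n r hn.le hr1
  obtain ⟨K, hK⟩ := isBounded_iff.1 hJc.isBounded
  have hK : ∀ x ∈ J, ∀ y ∈ J, dist x y ≤ K := fun x hx y hy => hK hx hy
  have hK0 : 0 ≤ K := dist_nonneg.trans (hK a ha a ha)
  have hαD : α ≤ D := by
    have := dim_le hD0 hSys hK hK0 hM1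
    rw [hdim] at this
    exact (ENNReal.ofReal_le_ofReal_iff hD0).1 this
  have hDpos : 0 < D := hα0.trans_le hαD
  obtain ⟨ε, hε, hgap⟩ := strip_gap J ⟨a, ha⟩ hline
  obtain ⟨κ, C', hκ0, hκα, hC', hstrip⟩ : ∃ κ C : ℝ, 0 < κ ∧ κ ≤ α ∧ 0 < C ∧
      ∀ t S, 0 < t → IsStrip t S → M S ≤ C * t ^ κ := by
    obtain ⟨r0, hr0, hr1, hrK⟩ : ∃ r0 : ℝ, 0 < r0 ∧ r0 ≤ 1 ∧ r0 * K ≤ ε / 2 := by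
      refine ⟨min 1 (ε / 2 / (K + 1)), lt_min one_pos (by positivity), min_le_left _ _, ?_⟩
      have h1 : min 1 (ε / 2 / (K + 1)) ≤ ε / 2 / (K + 1) := min_le_right _ _
      rw [le_div_iff₀ (by positivity)] at h1
      have h2 : 0 < min 1 (ε / 2 / (K + 1)) := lt_min one_pos (by positivity)
      linarith
    obtain ⟨Y⟩ := hSys r0 hr0 hr1
    exact strip_decay Y hgap hK hrK hK0 hε hM0 hMle hMd hM1 (by positivity)
      (by nlinarith) hDpos hα0
  -- an interior point of Op close to J
  obtain ⟨x0, hx0O, hx0a⟩ : ∃ x0 ∈ Op, dist x0 a ≤ 1 / 2 := by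
    obtain ⟨b, hb⟩ : ∃ b, b = dist y0 a + K := ⟨_, rfl⟩
    have hb0 : 0 ≤ b := by rw [hb]; positivity
    have hq : 0 < 1 / (2 * (b + 1)) := by positivity
    obtain ⟨Y⟩ := hSys (1 / (2 * (b + 1))) hq (by
      rw [div_le_one (by positivity)]; linarith)
    obtain ⟨k, a0, ha0, hka⟩ := Y.hcov a ha
    refine ⟨Y.f k y0, Y.hOp k ⟨y0, hy0, rfl⟩, ?_⟩
    rw [← hka, Y.hd]
    have h1 : dist y0 a0 ≤ b := by
      rw [hb]; exact (dist_triangle _ a _).trans (by linarith [hK a ha a0 ha0])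
    calc _ ≤ 1 / (2 * (b + 1)) * b := mul_le_mul (Y.ub k) h1 dist_nonneg hq.le
      _ ≤ 1 / 2 := by
        rw [div_mul_eq_mul_div, div_le_div_iff₀ (by positivity) (by positivity)]; linarith
  obtain ⟨ρ', hρ', hball'⟩ := Metric.isOpen_iff.1 hOo x0 hx0O
  obtain ⟨ρ, hρdef⟩ : ∃ ρ, ρ = min ρ' (1 / 2) := ⟨_, rfl⟩
  have hρ : 0 < ρ := by rw [hρdef]; exact lt_min hρ' (by norm_num)
  have hρ2 : ρ ≤ 1 / 2 := by rw [hρdef]; exact min_le_right _ _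
  have hball : ball x0 ρ ⊆ Op := (ball_subset_ball (by rw [hρdef]; exact min_le_left _ _)).trans hball'
  have hB : ∀ y ∈ J, dist y x0 ≤ K + 1 := by
    intro y hy
    have := dist_triangle_right y x0 a
    linarith [hK y hy a ha]
  obtain ⟨E, hE⟩ : ∃ E, E = (K + 1) ^ 2 / (Λ ^ D * (Λ * ρ) ^ 2) := ⟨_, rfl⟩
  have hE0 : 0 < E := by rw [hE]; positivity
  obtain ⟨G1, hG1⟩ : ∃ G, G = (((K + 3) + (K + 1) + ρ) / (Λ * ρ)) ^ 2 *
    (C' * ((K + 3) / Λ) ^ κ) := ⟨_, rfl⟩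
  have hG10 : 0 < G1 := by rw [hG1]; positivity
  obtain ⟨G2, hG2⟩ : ∃ G, G = C' * (K + 3) ^ κ := ⟨_, rfl⟩
  have hG20 : 0 < G2 := by rw [hG2]; positivity
  refine ⟨κ, max 1 ((G1 + G2) * E), hκ0, hκα, le_max_left _ _, ?_⟩
  intro δ r₁ r₂ R hδ hδ1 hδr hr hR
  have h1 : 0 < r₁ := hδ.trans_le hδr
  have h2 : 0 < r₂ := h1.trans_le hr
  obtain ⟨S', c, hS', hsub⟩ := rect_sub hR h1 hr hK0
  obtain ⟨S, hSdef⟩ : ∃ S, S = S' ∩ closedBall c ((K + 3) * r₂) := ⟨_, rfl⟩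
  rw [← hSdef] at hsub
  obtain ⟨Y⟩ := hSys δ hδ hδ1
  have hvol := vol_bound hJc x0 a ha hρ hball (by linarith) hΛ0 hΛ1 hD0 hK hK0 hM0 hM1 hδ hδr Y R S
    hsub
  rw [← hE] at hvol
  have hp1 : 0 < r₁ ^ κ := Real.rpow_pos_of_pos h1 _
  have hp2 : 0 < r₂ ^ (α - κ) := Real.rpow_pos_of_pos h2 _
  have hMS : M S ≤ (G1 + G2) * (r₁ ^ κ * r₂ ^ (α - κ)) := by
    by_cases hr2 : r₂ ≤ 1
    · obtain ⟨Y2⟩ := hSys r₂ h2 hr2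
      have := rect_decay x0 hρ hball hΛ0 hΛ1 hB (by linarith) (show 0 < K + 3 by linarith) hκ0 hD0
        hM0 hMm hMd hC' hstrip r₁ r₂ h1 hr Y2 S S' c (hSdef ▸ inter_subset_left) hS'
        (hSdef ▸ inter_subset_right)
      rw [← hG1] at this
      refine this.trans (mul_le_mul (by linarith) ?_ (by positivity) (by positivity))
      exact mul_le_mul_of_nonneg_left
        (Real.rpow_le_rpow_of_exponent_ge h2 hr2 (by linarith)) hp1.le
    · push Not at hr2
      have h3 := hstrip _ _ (by positivity) hS'
      have h4 : 1 ≤ r₂ ^ (α - κ) := Real.one_le_rpow hr2.le (by linarith)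
      rw [Real.mul_rpow (by linarith) h1.le, ← mul_assoc, ← hG2] at h3
      refine (hMm S S' (hSdef ▸ inter_subset_left)).trans (h3.trans ?_)
      refine mul_le_mul (by linarith) ?_ hp1.le (by positivity)
      nlinarith
  refine hvol.trans (mul_le_mul_of_nonneg_right ?_ ENNReal.toReal_nonneg)
  calc M S * E ≤ (G1 + G2) * (r₁ ^ κ * r₂ ^ (α - κ)) * E := mul_le_mul_of_nonneg_right hMS hE0.le
    _ = ((G1 + G2) * E) * (r₁ ^ κ * r₂ ^ (α - κ)) := by ring
    _ ≤ max 1 ((G1 + G2) * E) * (r₁ ^ κ * r₂ ^ (α - κ)) :=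
      mul_le_mul_of_nonneg_right (le_max_right _ _) (by positivity)
    _ = _ := by ring
end
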